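/- arXiv:2103.09025 — 2 statements merged into one kernel-verified Lean document; each statement's English description precedes it below -/
import Mathlib

section
/- For each N ≥ 1, let X_N = U_N D_N U_N^* be an N×N Hermitian random matrix, where U_N is Haar-distributed on the unitary group U(N) and D_N is a random real diagonal matrix independent of U_N. Let λ_1^{(N)} ≤ ⋯ ≤ λ_N^{(N)} be the eigenvalues of X_N, let m_N = (1/N) Σ_{i=1}^N δ_{λ_i^{(N)}} be the empirical eigenvalue distribution, and let λ̃_1^{(N)} ≤ ⋯ ≤ λ̃_{N−1}^{(N)} be the eigenvalues of the principal submatrix X̃_N obtained by deleting the last row and column of X_N. Set M_k(κ_N) = Σ_{i=1}^N (λ_i^{(N)})^k − Σ_{j=1}^{N−1} (λ̃_j^{(N)})^k. Assume that sup_{N≥1} E[M_k(m_N)] < ∞ for every even k. Then for every k ≥ 1, E[M_k(κ_N)^2] = Σ_{ρ_1, ρ_2 ∈ NC(k)} |K(ρ_1)| · |K(ρ_2)| · E[fc_{ρ_1}(m_N) fc_{ρ_2}(m_N)] + O(1/N) as N → ∞, where |K(ρ)| denotes the number of blocks of the Kreweras complement of ρ. -/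
open MeasureTheory ProbabilityTheory Finset
open scoped Classical

/-- Measurable structure on matrices (entrywise, i.e. the product σ-algebra). -/
instance matrixMeasurableSpace {m n α : Type*} [MeasurableSpace α] :
    MeasurableSpace (Matrix m n α) :=
  inferInstanceAs (MeasurableSpace (m → n → α))

/-- `ρ` is a partition of the finite set `S ⊆ ℕ`: its blocks are nonempty subsets of `S`
and every element of `S` lies in exactly one block. -/
def IsPartitionOn (S : Finset ℕ) (ρ : Finset (Finset ℕ)) : Prop :=
  (∀ B ∈ ρ, B.Nonempty) ∧ (∀ B ∈ ρ, B ⊆ S) ∧ (∀ x ∈ S, ∃! B, B ∈ ρ ∧ x ∈ B)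

/-- A family of blocks is non-crossing if no two distinct blocks cross. -/
def IsNoncrossing (ρ : Finset (Finset ℕ)) : Prop :=
  ∀ B ∈ ρ, ∀ C ∈ ρ, B ≠ C →
    ¬ ∃ a b c d : ℕ, a ∈ B ∧ b ∈ B ∧ c ∈ C ∧ d ∈ C ∧ a < c ∧ c < b ∧ b < d

/-- `ρ` is a non-crossing partition of `S`. -/
def IsNCPartitionOn (S : Finset ℕ) (ρ : Finset (Finset ℕ)) : Prop :=
  IsPartitionOn S ρ ∧ IsNoncrossing ρ

/-- `NC(k)`: the finite set of all non-crossing partitions of `{1, …, k}`. -/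
noncomputable def NCFinset (k : ℕ) : Finset (Finset (Finset ℕ)) :=
  ((Finset.Icc 1 k).powerset.powerset).filter (IsNCPartitionOn (Finset.Icc 1 k))

/-- The unbarred copy of a block: `a ↦ 2a`.  In the interleaved linear order
`s₁ < s̄₁ < s₂ < s̄₂ < ⋯` on a set of points and their barred copies, the point `a`
is encoded as `2a` and its barred copy `ā` as `2a+1`. -/
def unbarred (B : Finset ℕ) : Finset ℕ := B.image (fun a => 2 * a)

/-- The barred copy of a block: `a ↦ 2a + 1`. -/
def barred (B : Finset ℕ) : Finset ℕ := B.image (fun a => 2 * a + 1)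

/-- `ν` is the Kreweras complement of the non-crossing partition `ρ` of `S`:
`ν` is a partition of the barred copy of `S` (identified with `S`) such that
`ρ ∪ ν` is non-crossing in the interleaved order, and `ν` is maximal (coarsest)
with this property, i.e. every other such partition refines it. -/
def IsKrewerasOn (S : Finset ℕ) (ρ ν : Finset (Finset ℕ)) : Prop :=
  IsNCPartitionOn S ρ ∧ IsPartitionOn S ν ∧
  IsNoncrossing (ρ.image unbarred ∪ ν.image barred) ∧
  ∀ ν', IsPartitionOn S ν' → IsNoncrossing (ρ.image unbarred ∪ ν'.image barred) →
    ∀ B ∈ ν', ∃ C ∈ ν, B ⊆ C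



/-- `ρ` saturates `A`: every block of `ρ` meeting `A` is contained in `A`. -/
def IsSaturated (ρ : Finset (Finset ℕ)) (A : Finset ℕ) : Prop :=
  ∀ B ∈ ρ, ∀ x ∈ B, ∀ y ∈ B, x ∈ A → y ∈ A

/-- No interval `(u, v]` with `1 ≤ u < v` is saturated by `ρ`.  For `ρ ∈ NC(k)` this says that
`v̄` is the smallest element of its block in the Kreweras complement. -/
def IsMinGap (ρ : Finset (Finset ℕ)) (v : ℕ) : Prop :=
  ∀ u, 1 ≤ u → u < v → ¬ IsSaturated ρ (Finset.Ioc u v)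

theorem IsPartitionOn.eq_of_mem {S : Finset ℕ} {ρ : Finset (Finset ℕ)} (h : IsPartitionOn S ρ)
    {B C : Finset ℕ} (hB : B ∈ ρ) (hC : C ∈ ρ) {x : ℕ} (hxB : x ∈ B) (hxC : x ∈ C) : B = C := by
  obtain ⟨E, -, hE⟩ := h.2.2 x (h.2.1 B hB hxB)
  rw [hE B ⟨hB, hxB⟩, hE C ⟨hC, hxC⟩]

theorem IsKrewerasOn.isSaturated_of_mem {S : Finset ℕ} {ρ ν : Finset (Finset ℕ)}
    (h : IsKrewerasOn S ρ ν) {u v : ℕ} {B : Finset ℕ} (hB : B ∈ ν)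
    (hu : u ∈ B) (hv : v ∈ B) : IsSaturated ρ (Finset.Ioc u v) := by
  intro E hE x hx y hy hxA
  by_contra hyA
  rw [Finset.mem_Ioc] at hxA hyA
  have hEm : unbarred E ∈ ρ.image unbarred ∪ ν.image barred :=
    Finset.mem_union_left _ (Finset.mem_image_of_mem _ hE)
  have hBm : barred B ∈ ρ.image unbarred ∪ ν.image barred :=
    Finset.mem_union_right _ (Finset.mem_image_of_mem _ hB)
  have hxE : 2 * x ∈ unbarred E := Finset.mem_image_of_mem _ hx
  have hyE : 2 * y ∈ unbarred E := Finset.mem_image_of_mem _ hy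
  have huB : 2 * u + 1 ∈ barred B := Finset.mem_image.2 ⟨u, hu, rfl⟩
  have hvB : 2 * v + 1 ∈ barred B := Finset.mem_image.2 ⟨v, hv, rfl⟩
  have hne : unbarred E ≠ barred B := by
    intro heq
    rw [heq] at hxE
    obtain ⟨z, -, hz⟩ := Finset.mem_image.1 hxE
    omega
  rcases le_or_gt y u with hyu | hyu
  · exact h.2.2.1 _ hEm _ hBm hne ⟨2 * y, 2 * x, 2 * u + 1, 2 * v + 1, hyE, hxE, huB, hvB,
      by omega, by omega, by omega⟩
  · exact h.2.2.1 _ hBm _ hEm hne.symm ⟨2 * u + 1, 2 * v + 1, 2 * x, 2 * y, huB, hvB, hxE, hyE,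
      by omega, by omega, by omega⟩

theorem IsKrewerasOn.mem_of_isSaturated {S : Finset ℕ} {ρ ν : Finset (Finset ℕ)}
    (h : IsKrewerasOn S ρ ν) {u v : ℕ} (huv : u < v) (huS : u ∈ S) (hvS : v ∈ S)
    (hsat : IsSaturated ρ (Finset.Ioc u v)) : ∃ B ∈ ν, u ∈ B ∧ v ∈ B := by
  set ν' : Finset (Finset ℕ) := insert {u, v} ((S \ {u, v}).image fun x => {x}) with hν'
  have hmem : ∀ B, B ∈ ν' ↔ B = {u, v} ∨ ∃ x ∈ S, x ≠ u ∧ x ≠ v ∧ B = {x} := by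
    intro B
    simp only [hν', Finset.mem_insert, Finset.mem_image, Finset.mem_sdiff,
      Finset.mem_singleton]
    constructor
    · rintro (h | ⟨x, ⟨hx, hx'⟩, rfl⟩)
      · exact Or.inl h
      · exact Or.inr ⟨x, hx, by tauto, by tauto, rfl⟩
    · rintro (h | ⟨x, hx, h1, h2, rfl⟩)
      · exact Or.inl h
      · exact Or.inr ⟨x, ⟨hx, by tauto⟩, rfl⟩
  have hpart : IsPartitionOn S ν' := by
    refine ⟨?_, ?_, ?_⟩
    · intro B hB
      rcases (hmem B).1 hB with rfl | ⟨x, -, -, -, rfl⟩ <;> simp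
    · intro B hB
      rcases (hmem B).1 hB with rfl | ⟨x, hx, -, -, rfl⟩
      · intro y hy
        simp only [Finset.mem_insert, Finset.mem_singleton] at hy
        rcases hy with rfl | rfl <;> assumption
      · simpa using hx
    · intro x hx
      by_cases hxuv : x = u ∨ x = v
      · refine ⟨{u, v}, ⟨(hmem _).2 (Or.inl rfl), by simpa using hxuv⟩, ?_⟩
        rintro B ⟨hB, hxB⟩
        rcases (hmem B).1 hB with rfl | ⟨y, -, h1, h2, rfl⟩
        · rfl
        · rw [Finset.mem_singleton] at hxB
          subst hxB
          tauto
      · refine ⟨{x}, ⟨(hmem _).2 (Or.inr ⟨x, hx, by tauto, by tauto, rfl⟩), by simp⟩, ?_⟩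
        rintro B ⟨hB, hxB⟩
        rcases (hmem B).1 hB with rfl | ⟨y, -, h1, h2, rfl⟩
        · simp only [Finset.mem_insert, Finset.mem_singleton] at hxB
          tauto
        · rw [Finset.mem_singleton] at hxB
          rw [hxB]
  have hnc : IsNoncrossing (ρ.image unbarred ∪ ν'.image barred) := by
    intro B hB C hC hBC
    rintro ⟨a, b, c, d, ha, hb, hc, hd, hac, hcb, hbd⟩
    have hbar : ∀ E, E ∈ ρ.image unbarred ∪ ν'.image barred →
        (∃ F ∈ ρ, E = unbarred F) ∨ E = barred {u, v} ∨ ∃ x, E = barred {x} := by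
      intro E hE
      rcases Finset.mem_union.1 hE with hE | hE
      · obtain ⟨F, hF, rfl⟩ := Finset.mem_image.1 hE
        exact Or.inl ⟨F, hF, rfl⟩
      · obtain ⟨F, hF, rfl⟩ := Finset.mem_image.1 hE
        rcases (hmem F).1 hF with rfl | ⟨x, -, -, -, rfl⟩
        · exact Or.inr (Or.inl rfl)
        · exact Or.inr (Or.inr ⟨x, rfl⟩)
    have hsing : ∀ x s t, s ∈ barred {x} → t ∈ barred {x} → s = t := by
      intro x s t hs ht
      simp only [barred, Finset.image_singleton, Finset.mem_singleton] at hs ht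
      rw [hs, ht]
    have hpair : ∀ s, s ∈ barred {u, v} → s = 2 * u + 1 ∨ s = 2 * v + 1 := by
      intro s hs
      simpa [barred] using hs
    rcases hbar B hB with ⟨E, hE, rfl⟩ | rfl | ⟨x, rfl⟩
    · obtain ⟨a', ha', rfl⟩ := Finset.mem_image.1 ha
      obtain ⟨b', hb', rfl⟩ := Finset.mem_image.1 hb
      rcases hbar C hC with ⟨F, hF, rfl⟩ | rfl | ⟨x, rfl⟩
      · obtain ⟨c', hc', rfl⟩ := Finset.mem_image.1 hc
        obtain ⟨d', hd', rfl⟩ := Finset.mem_image.1 hd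
        exact h.1.2 E hE F hF (fun heq => hBC (by rw [heq]))
          ⟨a', b', c', d', ha', hb', hc', hd', by omega, by omega, by omega⟩
      · have h1 := hsat E hE b' hb' a' ha'
        simp only [Finset.mem_Ioc] at h1
        rcases hpair c hc with rfl | rfl <;> rcases hpair d hd with rfl | rfl <;> omega
      · have := hsing x _ _ hc hd
        omega
    · rcases hbar C hC with ⟨F, hF, rfl⟩ | rfl | ⟨x, rfl⟩
      · obtain ⟨c', hc', rfl⟩ := Finset.mem_image.1 hc
        obtain ⟨d', hd', rfl⟩ := Finset.mem_image.1 hd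
        have h1 := hsat F hF c' hc' d' hd'
        simp only [Finset.mem_Ioc] at h1
        rcases hpair a ha with rfl | rfl <;> rcases hpair b hb with rfl | rfl <;> omega
      · exact hBC rfl
      · have := hsing x _ _ hc hd
        omega
    · have := hsing x _ _ ha hb
      omega
  obtain ⟨C, hC, hsub⟩ := h.2.2.2 ν' hpart hnc {u, v} ((hmem _).2 (Or.inl rfl))
  exact ⟨C, hC, hsub (by simp), hsub (by simp)⟩

/-- The number of blocks of the Kreweras complement, in terms of saturated intervals. -/
theorem IsKrewerasOn.card_eq {k : ℕ} {ρ ν : Finset (Finset ℕ)}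
    (h : IsKrewerasOn (Finset.Icc 1 k) ρ ν) :
    ν.card = ((Finset.Icc 1 k).filter (IsMinGap ρ)).card := by
  have hp := h.2.1
  refine Finset.card_bij (fun B hB => B.min' (hp.1 B hB)) ?_ ?_ ?_
  · intro B hB
    have hm := B.min'_mem (hp.1 B hB)
    have hmS := hp.2.1 B hB hm
    refine Finset.mem_filter.2 ⟨hmS, fun u hu huv hsat => ?_⟩
    have hmS' := Finset.mem_Icc.1 hmS
    obtain ⟨C, hC, huC, hvC⟩ := h.mem_of_isSaturated huv
      (Finset.mem_Icc.2 ⟨hu, by omega⟩) hmS hsat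
    rw [hp.eq_of_mem hC hB hvC hm] at huC
    exact absurd (B.min'_le u huC) (by omega)
  · intro B hB C hC heq
    refine hp.eq_of_mem hB hC (B.min'_mem (hp.1 B hB)) ?_
    exact heq ▸ C.min'_mem _
  · intro v hv
    obtain ⟨hvS, hvmin⟩ := Finset.mem_filter.1 hv
    obtain ⟨B, ⟨hB, hvB⟩, -⟩ := hp.2.2 v hvS
    refine ⟨B, hB, le_antisymm (B.min'_le v hvB) ?_⟩
    by_contra hlt
    push Not at hlt
    have hm := B.min'_mem (hp.1 B hB)
    exact hvmin _ (Finset.mem_Icc.1 (hp.2.1 B hB hm)).1 hlt (h.isSaturated_of_mem hB hm hvB)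

/-- The finite set of all non-crossing partitions of `S`. -/
noncomputable def ncPartitions (S : Finset ℕ) : Finset (Finset (Finset ℕ)) :=
  (S.powerset.powerset).filter (IsNCPartitionOn S)

theorem mem_ncPartitions {S : Finset ℕ} {ρ : Finset (Finset ℕ)} :
    ρ ∈ ncPartitions S ↔ IsNCPartitionOn S ρ := by
  refine ⟨fun h => (Finset.mem_filter.1 h).2, fun h => Finset.mem_filter.2 ⟨?_, h⟩⟩
  exact Finset.mem_powerset.2 fun B hB => Finset.mem_powerset.2 (h.1.2.1 B hB)

theorem isNCPartitionOn_relabel {f : ℕ → ℕ} (hf : StrictMono f) {S : Finset ℕ}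
    {ρ : Finset (Finset ℕ)} :
    IsNCPartitionOn (S.image f) (ρ.image (Finset.image f)) ↔ IsNCPartitionOn S ρ := by
  have hinj : Function.Injective (Finset.image f) := Finset.image_injective hf.injective
  have hmem : ∀ {x : ℕ} {B : Finset ℕ}, f x ∈ B.image f ↔ x ∈ B := by
    intro x B
    exact hf.injective.mem_finset_image
  constructor
  · rintro ⟨⟨h1, h2, h3⟩, h4⟩
    refine ⟨⟨fun B hB => ?_, fun B hB => ?_, fun x hx => ?_⟩, fun B hB C hC hBC => ?_⟩
    · simpa using h1 _ (Finset.mem_image_of_mem _ hB)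
    · exact (Finset.image_subset_image_iff hf.injective).1 (h2 _ (Finset.mem_image_of_mem _ hB))
    · obtain ⟨E, ⟨hE, hxE⟩, hu⟩ := h3 (f x) (Finset.mem_image_of_mem _ hx)
      obtain ⟨B, hB, rfl⟩ := Finset.mem_image.1 hE
      exact ⟨B, ⟨hB, hmem.1 hxE⟩, fun C hC => hinj (hu _ ⟨Finset.mem_image_of_mem _ hC.1,
        hmem.2 hC.2⟩)⟩
    · rintro ⟨a, b, c, d, ha, hb, hc, hd, hac, hcb, hbd⟩
      exact h4 _ (Finset.mem_image_of_mem _ hB) _ (Finset.mem_image_of_mem _ hC)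
        (fun h => hBC (hinj h)) ⟨f a, f b, f c, f d, hmem.2 ha, hmem.2 hb, hmem.2 hc, hmem.2 hd,
          hf hac, hf hcb, hf hbd⟩
  · rintro ⟨⟨h1, h2, h3⟩, h4⟩
    refine ⟨⟨fun B' hB' => ?_, fun B' hB' => ?_, fun x' hx' => ?_⟩, fun B' hB' C' hC' hBC => ?_⟩
    · obtain ⟨B, hB, rfl⟩ := Finset.mem_image.1 hB'
      simpa using h1 _ hB
    · obtain ⟨B, hB, rfl⟩ := Finset.mem_image.1 hB'
      exact Finset.image_subset_image (h2 _ hB)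
    · obtain ⟨x, hx, rfl⟩ := Finset.mem_image.1 hx'
      obtain ⟨B, ⟨hB, hxB⟩, hu⟩ := h3 x hx
      refine ⟨B.image f, ⟨Finset.mem_image_of_mem _ hB, hmem.2 hxB⟩, ?_⟩
      rintro C' ⟨hC', hxC⟩
      obtain ⟨C, hC, rfl⟩ := Finset.mem_image.1 hC'
      rw [hu C ⟨hC, hmem.1 hxC⟩]
    · obtain ⟨B, hB, rfl⟩ := Finset.mem_image.1 hB'
      obtain ⟨C, hC, rfl⟩ := Finset.mem_image.1 hC'
      rintro ⟨a', b', c', d', ha', hb', hc', hd', hac, hcb, hbd⟩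
      obtain ⟨a, ha, rfl⟩ := Finset.mem_image.1 ha'
      obtain ⟨b, hb, rfl⟩ := Finset.mem_image.1 hb'
      obtain ⟨c, hc, rfl⟩ := Finset.mem_image.1 hc'
      obtain ⟨d, hd, rfl⟩ := Finset.mem_image.1 hd'
      exact h4 B hB C hC (fun h => hBC (by rw [h])) ⟨a, b, c, d, ha, hb, hc, hd,
        hf.lt_iff_lt.1 hac, hf.lt_iff_lt.1 hcb, hf.lt_iff_lt.1 hbd⟩

/-- Sums over `NC(S)` can be relabelled along strictly increasing maps. -/
theorem sum_ncPartitions_image {f : ℕ → ℕ} (hf : StrictMono f) (S : Finset ℕ)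
    (F : Finset (Finset ℕ) → ℝ) :
    ∑ ρ ∈ ncPartitions (S.image f), F ρ
      = ∑ ρ ∈ ncPartitions S, F (ρ.image (Finset.image f)) := by
  symm
  refine Finset.sum_bij (fun ρ _ => ρ.image (Finset.image f)) ?_ ?_ ?_ ?_
  · intro ρ hρ
    exact mem_ncPartitions.2 ((isNCPartitionOn_relabel hf).2 (mem_ncPartitions.1 hρ))
  · intro ρ _ ρ' _ h
    exact Finset.image_injective (Finset.image_injective hf.injective) h
  · intro ρ hρ
    have hρ' := mem_ncPartitions.1 hρ
    have hpre : ∀ B ∈ ρ, ∃ E : Finset ℕ, E.image f = B := by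
      intro B hB
      obtain ⟨E, -, hE⟩ := Finset.subset_image_iff.1 (hρ'.1.2.1 B hB)
      exact ⟨E, by exact_mod_cast hE⟩
    choose! g hg using hpre
    have himg : (ρ.image g).image (Finset.image f) = ρ := by
      rw [Finset.image_image]
      ext B
      simp only [Finset.mem_image, Function.comp_apply]
      constructor
      · rintro ⟨C, hC, rfl⟩
        rwa [hg C hC]
      · intro hB
        exact ⟨B, hB, hg B hB⟩
    refine ⟨ρ.image g, mem_ncPartitions.2 ((isNCPartitionOn_relabel hf).1 ?_), himg⟩
    rw [himg]
    exact hρ'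
  · intro ρ _
    rfl

/-- The weight `∏_{B ∈ ρ} c_{|B|}` of a partition. -/
noncomputable def blockWeight (c : ℕ → ℝ) (ρ : Finset (Finset ℕ)) : ℝ := ∏ B ∈ ρ, c B.card

theorem blockWeight_image (c : ℕ → ℝ) {f : ℕ → ℕ} (hf : StrictMono f) (ρ : Finset (Finset ℕ)) :
    blockWeight c (ρ.image (Finset.image f)) = blockWeight c ρ := by
  unfold blockWeight
  rw [Finset.prod_image (fun _ _ _ _ h => Finset.image_injective hf.injective h)]
  exact Finset.prod_congr rfl fun B _ => by rw [Finset.card_image_of_injective _ hf.injective]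

theorem IsNCPartitionOn.union {S : Finset ℕ} {v i : ℕ} (hA : Finset.Ioc v i ⊆ S)
    {ρ σ : Finset (Finset ℕ)} (hρ : IsNCPartitionOn (S \ Finset.Ioc v i) ρ)
    (hσ : IsNCPartitionOn (Finset.Ioc v i) σ) : IsNCPartitionOn S (ρ ∪ σ) := by
  refine ⟨⟨fun B hB => ?_, fun B hB => ?_, fun x hx => ?_⟩, fun B hB C hC hBC => ?_⟩
  · exact (Finset.mem_union.1 hB).elim (hρ.1.1 B) (hσ.1.1 B)
  · exact (Finset.mem_union.1 hB).elim (fun h => (hρ.1.2.1 B h).trans Finset.sdiff_subset)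
      (fun h => (hσ.1.2.1 B h).trans hA)
  · by_cases hxA : x ∈ Finset.Ioc v i
    · obtain ⟨B, ⟨hB, hxB⟩, hu⟩ := hσ.1.2.2 x hxA
      refine ⟨B, ⟨Finset.mem_union_right _ hB, hxB⟩, ?_⟩
      rintro C ⟨hC, hxC⟩
      rcases Finset.mem_union.1 hC with hC | hC
      · exact absurd hxA (Finset.mem_sdiff.1 (hρ.1.2.1 C hC hxC)).2
      · exact hu C ⟨hC, hxC⟩
    · obtain ⟨B, ⟨hB, hxB⟩, hu⟩ := hρ.1.2.2 x (Finset.mem_sdiff.2 ⟨hx, hxA⟩)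
      refine ⟨B, ⟨Finset.mem_union_left _ hB, hxB⟩, ?_⟩
      rintro C ⟨hC, hxC⟩
      rcases Finset.mem_union.1 hC with hC | hC
      · exact hu C ⟨hC, hxC⟩
      · exact absurd (hσ.1.2.1 C hC hxC) hxA
  · rintro ⟨a, b, c, d, ha, hb, hc, hd, hac, hcb, hbd⟩
    have hout : ∀ E ∈ ρ, ∀ x ∈ E, ¬ (v < x ∧ x ≤ i) := fun E hE x hx h =>
      (Finset.mem_sdiff.1 (hρ.1.2.1 E hE hx)).2 (Finset.mem_Ioc.2 h)
    have hin : ∀ E ∈ σ, ∀ x ∈ E, v < x ∧ x ≤ i := fun E hE x hx =>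
      Finset.mem_Ioc.1 (hσ.1.2.1 E hE hx)
    rcases Finset.mem_union.1 hB with hB | hB <;> rcases Finset.mem_union.1 hC with hC | hC
    · exact hρ.2 B hB C hC hBC ⟨a, b, c, d, ha, hb, hc, hd, hac, hcb, hbd⟩
    · have h1 := hout B hB b hb
      have h2 := hin C hC c hc
      have h3 := hin C hC d hd
      omega
    · have h1 := hout C hC c hc
      have h2 := hin B hB a ha
      have h3 := hin B hB b hb
      omega
    · exact hσ.2 B hB C hC hBC ⟨a, b, c, d, ha, hb, hc, hd, hac, hcb, hbd⟩

theorem IsNCPartitionOn.filter_subset {S A : Finset ℕ} (hA : A ⊆ S) {π : Finset (Finset ℕ)}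
    (hπ : IsNCPartitionOn S π) (hsat : IsSaturated π A) :
    IsNCPartitionOn A (π.filter (· ⊆ A)) := by
  refine ⟨⟨fun B hB => hπ.1.1 B (Finset.mem_filter.1 hB).1, fun B hB => (Finset.mem_filter.1 hB).2,
    fun x hx => ?_⟩,
    fun B hB C hC => hπ.2 B (Finset.mem_filter.1 hB).1 C (Finset.mem_filter.1 hC).1⟩
  obtain ⟨B, ⟨hB, hxB⟩, hu⟩ := hπ.1.2.2 x (hA hx)
  exact ⟨B, ⟨Finset.mem_filter.2 ⟨hB, fun y hy => hsat B hB x hxB y hy hx⟩, hxB⟩,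
    fun C hC => hu C ⟨(Finset.mem_filter.1 hC.1).1, hC.2⟩⟩

theorem IsNCPartitionOn.filter_not_subset {S A : Finset ℕ} {π : Finset (Finset ℕ)}
    (hπ : IsNCPartitionOn S π) (hsat : IsSaturated π A) :
    IsNCPartitionOn (S \ A) (π.filter (¬ · ⊆ A)) := by
  refine ⟨⟨fun B hB => hπ.1.1 B (Finset.mem_filter.1 hB).1, fun B hB x hx => ?_,
    fun x hx => ?_⟩,
    fun B hB C hC => hπ.2 B (Finset.mem_filter.1 hB).1 C (Finset.mem_filter.1 hC).1⟩
  · obtain ⟨hB, hBA⟩ := Finset.mem_filter.1 hB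
    refine Finset.mem_sdiff.2 ⟨hπ.1.2.1 B hB hx, fun hxA => hBA fun y hy => ?_⟩
    exact hsat B hB x hx y hy hxA
  · obtain ⟨hxS, hxA⟩ := Finset.mem_sdiff.1 hx
    obtain ⟨B, ⟨hB, hxB⟩, hu⟩ := hπ.1.2.2 x hxS
    exact ⟨B, ⟨Finset.mem_filter.2 ⟨hB, fun h => hxA (h hxB)⟩, hxB⟩,
      fun C hC => hu C ⟨(Finset.mem_filter.1 hC.1).1, hC.2⟩⟩

theorem isMinGap_union_iff {v i : ℕ} {ρ σ : Finset (Finset ℕ)}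
    (hσ : IsPartitionOn (Finset.Ioc v i) σ) : IsMinGap (ρ ∪ σ) v ↔ IsMinGap ρ v := by
  refine forall_congr' fun u => forall_congr' fun _ => forall_congr' fun _ => not_congr ?_
  constructor
  · exact fun h B hB => h B (Finset.mem_union_left _ hB)
  · intro h B hB x hx y hy hxA
    rcases Finset.mem_union.1 hB with hB | hB
    · exact h B hB x hx y hy hxA
    · have h1 := Finset.mem_Ioc.1 (hσ.2.1 B hB hx)
      have h2 := Finset.mem_Ioc.1 hxA
      omega

/-- Splitting a non-crossing partition along a saturated interval. -/
theorem sum_isSaturated_eq {S : Finset ℕ} {v i : ℕ} (hA : Finset.Ioc v i ⊆ S) (c : ℕ → ℝ) :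
    ∑ π ∈ (ncPartitions S).filter (fun π => IsSaturated π (Finset.Ioc v i) ∧ IsMinGap π v),
        blockWeight c π
      = (∑ σ ∈ ncPartitions (Finset.Ioc v i), blockWeight c σ)
        * ∑ ρ ∈ (ncPartitions (S \ Finset.Ioc v i)).filter (IsMinGap · v), blockWeight c ρ := by
  set A := Finset.Ioc v i with hAdef
  rw [Finset.sum_mul_sum, ← Finset.sum_product']
  refine Finset.sum_bij' (fun π _ => (π.filter (· ⊆ A), π.filter (¬ · ⊆ A)))
    (fun p _ => p.2 ∪ p.1) ?_ ?_ ?_ ?_ ?_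
  · intro π hπ
    obtain ⟨hπ, hsat, hmin⟩ := Finset.mem_filter.1 hπ
    have hπ' := mem_ncPartitions.1 hπ
    have hσ := hπ'.filter_subset hA hsat
    refine Finset.mem_product.2 ⟨mem_ncPartitions.2 hσ, Finset.mem_filter.2
      ⟨mem_ncPartitions.2 (hπ'.filter_not_subset hsat), ?_⟩⟩
    rw [← isMinGap_union_iff hσ.1]
    convert hmin using 1
    rw [Finset.union_comm]
    exact Finset.filter_union_filter_not_eq _ _
  · rintro ⟨σ, ρ⟩ hp
    obtain ⟨hσ, hρ⟩ := Finset.mem_product.1 hp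
    obtain ⟨hρ, hmin⟩ := Finset.mem_filter.1 hρ
    have hσ := mem_ncPartitions.1 hσ
    have hρ := mem_ncPartitions.1 hρ
    refine Finset.mem_filter.2 ⟨mem_ncPartitions.2 (hρ.union hA hσ), ?_,
      (isMinGap_union_iff hσ.1).2 hmin⟩
    intro B hB x hx y hy hxA
    rcases Finset.mem_union.1 hB with hB | hB
    · exact absurd hxA (Finset.mem_sdiff.1 (hρ.1.2.1 B hB hx)).2
    · exact hσ.1.2.1 B hB hy
  · intro π _
    simp only
    rw [Finset.union_comm]
    exact Finset.filter_union_filter_not_eq _ _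
  · rintro ⟨σ, ρ⟩ hp
    obtain ⟨hσ, hρ⟩ := Finset.mem_product.1 hp
    have hσ := mem_ncPartitions.1 hσ
    have hρ := mem_ncPartitions.1 (Finset.mem_filter.1 hρ).1
    have hσA : ∀ B ∈ σ, B ⊆ A := hσ.1.2.1
    have hρA : ∀ B ∈ ρ, ¬ B ⊆ A := by
      intro B hB hBA
      obtain ⟨x, hx⟩ := hρ.1.1 B hB
      exact (Finset.mem_sdiff.1 (hρ.1.2.1 B hB hx)).2 (hBA hx)
    ext B
    · simp only [Finset.mem_filter, Finset.mem_union]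
      exact ⟨fun h => h.1.resolve_left fun h' => hρA B h' h.2, fun h => ⟨Or.inr h, hσA B h⟩⟩
    · simp only [Finset.mem_filter, Finset.mem_union]
      exact ⟨fun h => h.1.resolve_right fun h' => h.2 (hσA B h'), fun h => ⟨Or.inl h, hρA B h⟩⟩
  · intro π _
    exact (Finset.prod_filter_mul_prod_filter_not π (· ⊆ A) _).symm

theorem isSaturated_Ioc_iff_of_isSaturated {π : Finset (Finset ℕ)} {u v i : ℕ} (huv : u ≤ v)
    (hvi : v ≤ i) (h : IsSaturated π (Finset.Ioc v i)) :
    IsSaturated π (Finset.Ioc u i) ↔ IsSaturated π (Finset.Ioc u v) := by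
  have key : ∀ x, x ∈ Finset.Ioc u i ↔ x ∈ Finset.Ioc u v ∨ x ∈ Finset.Ioc v i := by
    intro x
    simp only [Finset.mem_Ioc]
    omega
  have hdisj : ∀ x, ¬ (x ∈ Finset.Ioc u v ∧ x ∈ Finset.Ioc v i) := by
    intro x
    simp only [Finset.mem_Ioc]
    omega
  constructor
  · intro h' B hB x hx y hy hxA
    have h1 := h' B hB x hx y hy ((key x).2 (Or.inl hxA))
    exact ((key y).1 h1).resolve_right fun h2 => hdisj x ⟨hxA, h B hB y hy x hx h2⟩
  · intro h' B hB x hx y hy hxA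
    rcases (key x).1 hxA with h1 | h1
    · exact (key y).2 (Or.inl (h' B hB x hx y hy h1))
    · exact (key y).2 (Or.inr (h B hB x hx y hy h1))

/-- Every gap `i` has exactly one minimal representative `v ≤ i`. -/
theorem existsUnique_isMinGap (π : Finset (Finset ℕ)) {i : ℕ} (hi : 1 ≤ i) :
    ∃! v, (1 ≤ v ∧ v ≤ i) ∧ IsSaturated π (Finset.Ioc v i) ∧ IsMinGap π v := by
  have hex : ∃ v, (1 ≤ v ∧ v ≤ i) ∧ IsSaturated π (Finset.Ioc v i) :=
    ⟨i, ⟨hi, le_rfl⟩, by simp [IsSaturated]⟩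
  have hspec := Nat.find_spec hex
  refine ⟨Nat.find hex, ⟨hspec.1, hspec.2, fun u hu huv hsat => ?_⟩, ?_⟩
  · refine Nat.find_min hex huv ⟨⟨hu, by omega⟩, ?_⟩
    exact (isSaturated_Ioc_iff_of_isSaturated huv.le hspec.1.2 hspec.2).2 hsat
  · rintro v ⟨hv, hsat, hmin⟩
    refine le_antisymm ?_ (Nat.find_min' hex ⟨hv, hsat⟩)
    by_contra hlt
    push Not at hlt
    exact hmin _ hspec.1.1 hlt ((isSaturated_Ioc_iff_of_isSaturated hlt.le hv.2 hsat).1 hspec.2)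

/-- The moment attached to a sequence of free cumulants. -/
noncomputable def ncMoment (c : ℕ → ℝ) (k : ℕ) : ℝ :=
  ∑ ρ ∈ ncPartitions (Finset.Icc 1 k), blockWeight c ρ

/-- The sum of the block weights over `NC(k)`, weighted by the number of minimal gaps. -/
noncomputable def ncGapMoment (c : ℕ → ℝ) (k : ℕ) : ℝ :=
  ∑ ρ ∈ ncPartitions (Finset.Icc 1 k),
    (((Finset.Icc 1 k).filter (IsMinGap ρ)).card : ℝ) * blockWeight c ρ

theorem sum_ncPartitions_Ioc (c : ℕ → ℝ) (v j : ℕ) :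
    ∑ σ ∈ ncPartitions (Finset.Ioc v (v + j)), blockWeight c σ = ncMoment c j := by
  have hf : StrictMono (fun x : ℕ => x + v) := fun a b h => Nat.add_lt_add_right h v
  have himg : Finset.Ioc v (v + j) = (Finset.Icc 1 j).image (fun x => x + v) := by
    rw [Finset.image_add_right_Icc]
    ext x
    simp only [Finset.mem_Ioc, Finset.mem_Icc]
    omega
  rw [himg, sum_ncPartitions_image hf]
  exact Finset.sum_congr rfl fun ρ _ => blockWeight_image c hf ρ

theorem sum_isMinGap_sdiff (c : ℕ → ℝ) {k j v : ℕ} (hv : v ≤ k - j) (hjk : j ≤ k) :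
    ∑ ρ ∈ (ncPartitions (Finset.Icc 1 k \ Finset.Ioc v (v + j))).filter (IsMinGap · v),
        blockWeight c ρ
      = ∑ ρ ∈ (ncPartitions (Finset.Icc 1 (k - j))).filter (IsMinGap · v), blockWeight c ρ := by
  set f : ℕ → ℕ := fun x => if x ≤ v then x else x + j with hfdef
  have hf : StrictMono f := by
    intro a b hab
    simp only [hfdef]
    split_ifs <;> omega
  have himg : Finset.Icc 1 k \ Finset.Ioc v (v + j) = (Finset.Icc 1 (k - j)).image f := by
    ext x
    simp only [Finset.mem_sdiff, Finset.mem_Icc, Finset.mem_Ioc, Finset.mem_image, hfdef]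
    constructor
    · intro h
      by_cases hx : x ≤ v
      · exact ⟨x, by omega, by rw [if_pos hx]⟩
      · exact ⟨x - j, by omega, by rw [if_neg (by omega)]; omega⟩
    · rintro ⟨y, hy, rfl⟩
      split_ifs <;> omega
  have hfm : ∀ u x, u < v → (f x ∈ Finset.Ioc u v ↔ x ∈ Finset.Ioc u v) := by
    intro u x huv
    simp only [Finset.mem_Ioc, hfdef]
    split_ifs <;> omega
  have hmin : ∀ ρ : Finset (Finset ℕ), IsMinGap (ρ.image (Finset.image f)) v ↔ IsMinGap ρ v := by
    intro ρ
    refine forall_congr' fun u => forall_congr' fun _ => forall_congr' fun huv => not_congr ?_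
    simp only [IsSaturated, Finset.forall_mem_image, hfm u _ huv]
  rw [himg, Finset.sum_filter, Finset.sum_filter, sum_ncPartitions_image hf]
  exact Finset.sum_congr rfl fun ρ _ => by rw [hmin, blockWeight_image c hf]

/-- The Newton-type recursion linking `∑_ρ |K(ρ)| fc_ρ` and the moments. -/
theorem sum_ncMoment_mul_ncGapMoment (c : ℕ → ℝ) (k : ℕ) :
    ∑ j ∈ Finset.range k, ncMoment c j * ncGapMoment c (k - j) = k * ncMoment c k := by
  have h1 : ∀ j ∈ Finset.range k, ncMoment c j * ncGapMoment c (k - j)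
      = ∑ v ∈ Finset.Icc 1 (k - j), ∑ π ∈ ncPartitions (Finset.Icc 1 k),
        if IsSaturated π (Finset.Ioc v (v + j)) ∧ IsMinGap π v then blockWeight c π else 0 := by
    intro j hj
    have hj := Finset.mem_range.1 hj
    have h2 : ncGapMoment c (k - j) = ∑ v ∈ Finset.Icc 1 (k - j),
        ∑ ρ ∈ (ncPartitions (Finset.Icc 1 (k - j))).filter (IsMinGap · v), blockWeight c ρ := by
      simp only [ncGapMoment, Finset.sum_filter]
      rw [Finset.sum_comm]
      refine Finset.sum_congr rfl fun ρ _ => ?_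
      rw [← Finset.sum_filter, Finset.sum_const, nsmul_eq_mul]
    rw [h2, Finset.mul_sum]
    refine Finset.sum_congr rfl fun v hv => ?_
    have hv := Finset.mem_Icc.1 hv
    have hA : Finset.Ioc v (v + j) ⊆ Finset.Icc 1 k := by
      intro x hx
      simp only [Finset.mem_Ioc, Finset.mem_Icc] at hx ⊢
      omega
    rw [← Finset.sum_filter, sum_isSaturated_eq hA, sum_ncPartitions_Ioc,
      sum_isMinGap_sdiff c hv.2 hj.le]
  rw [Finset.sum_congr rfl h1]
  simp only [Finset.sum_comm (t := ncPartitions (Finset.Icc 1 k))]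
  rw [ncMoment, Finset.mul_sum]
  refine Finset.sum_congr rfl fun π _ => ?_
  rw [Finset.sum_sigma', ← Finset.sum_filter, Finset.sum_const, nsmul_eq_mul]
  congr 2
  conv_rhs => rw [← Nat.add_sub_cancel (n := k) (m := 1), ← Nat.card_Icc]
  refine Finset.card_bij (fun p _ => p.2 + p.1) ?_ ?_ ?_
  · rintro ⟨j, v⟩ hp
    simp only [Finset.mem_filter, Finset.mem_sigma, Finset.mem_range, Finset.mem_Icc] at hp ⊢
    omega
  · rintro ⟨j, v⟩ hp ⟨j', v'⟩ hp' heq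
    simp only [Finset.mem_filter, Finset.mem_sigma, Finset.mem_range, Finset.mem_Icc] at hp hp' heq
    have hu := (existsUnique_isMinGap π (i := v + j) (by omega)).unique
      ⟨⟨hp.1.2.1, by omega⟩, hp.2⟩ ⟨⟨hp'.1.2.1, by omega⟩, by rw [heq]; exact hp'.2⟩
    subst hu
    obtain rfl : j = j' := by omega
    rfl
  · intro i hi
    have hi := Finset.mem_Icc.1 hi
    obtain ⟨v, ⟨hv, hp⟩, -⟩ := existsUnique_isMinGap π hi.1
    refine ⟨⟨i - v, v⟩, ?_, by simp only; omega⟩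
    simp only [Finset.mem_filter, Finset.mem_sigma, Finset.mem_range, Finset.mem_Icc]
    refine ⟨⟨by omega, by omega, by omega⟩, ?_⟩
    rwa [show v + (i - v) = i by omega]

theorem ncMoment_zero (c : ℕ → ℝ) : ncMoment c 0 = 1 := by
  have h : ncPartitions (Finset.Icc 1 0) = {∅} := by
    ext ρ
    rw [mem_ncPartitions, Finset.mem_singleton]
    constructor
    · intro h
      refine Finset.eq_empty_of_forall_notMem fun B hB => ?_
      obtain ⟨x, hx⟩ := h.1.1 B hB
      simpa using h.1.2.1 B hB hx
    · rintro rfl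
      exact ⟨⟨by simp, by simp, by simp⟩, by simp [IsNoncrossing]⟩
  rw [ncMoment, h]
  simp [blockWeight]

/-- A sequence determined from moments by the Newton recursion is polynomial in the moments. -/
theorem exists_mvPolynomial_newton (k : ℕ) (hk : 1 ≤ k) :
    ∃ p : MvPolynomial ℕ ℝ, ∀ m P : ℕ → ℝ, m 0 = 1 →
      (∀ k, 1 ≤ k → ∑ j ∈ Finset.range k, m j * P (k - j) = k * m k) →
      P k = MvPolynomial.eval m p := by
  induction k using Nat.strong_induction_on with
  | _ k ih =>
    choose! q hq using ih
    refine ⟨MvPolynomial.C (k : ℝ) * MvPolynomial.X k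
      - ∑ j ∈ Finset.Ico 1 k, MvPolynomial.X j * q (k - j), fun m P h0 h => ?_⟩
    have h1 := h k hk
    rw [Finset.range_eq_Ico, Finset.sum_eq_sum_Ico_succ_bot (by omega), h0, one_mul,
      Nat.sub_zero] at h1
    have h2 : ∑ j ∈ Finset.Ico (0 + 1) k, m j * P (k - j)
        = ∑ j ∈ Finset.Ico 1 k, m j * MvPolynomial.eval m (q (k - j)) := by
      refine Finset.sum_congr rfl fun j hj => ?_
      have hj := Finset.mem_Ico.1 hj
      rw [hq (k - j) (by omega) (by omega) m P h0 h]
    rw [h2] at h1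
    simp only [map_sub, map_mul, MvPolynomial.eval_C, MvPolynomial.eval_X, map_sum]
    linarith

theorem isNCPartitionOn_singleton {k : ℕ} (hk : 1 ≤ k) :
    IsNCPartitionOn (Finset.Icc 1 k) {Finset.Icc 1 k} := by
  refine ⟨⟨?_, ?_, fun x hx => ⟨Finset.Icc 1 k, ⟨by simp, hx⟩, fun B hB => by simpa using hB.1⟩⟩,
    ?_⟩
  · simpa using hk
  · simp
  · intro B hB C hC hBC
    rw [Finset.mem_singleton] at hB hC
    exact absurd (hB.trans hC.symm) hBC

theorem card_lt_of_ne_singleton {k : ℕ} {ρ : Finset (Finset ℕ)}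
    (hρ : IsNCPartitionOn (Finset.Icc 1 k) ρ) (hne : ρ ≠ {Finset.Icc 1 k}) {B : Finset ℕ}
    (hB : B ∈ ρ) : 1 ≤ B.card ∧ B.card < k := by
  refine ⟨(hρ.1.1 B hB).card_pos, lt_of_le_of_ne ?_ fun h => hne ?_⟩
  · simpa using Finset.card_le_card (hρ.1.2.1 B hB)
  · have hBk : B = Finset.Icc 1 k :=
      Finset.eq_of_subset_of_card_le (hρ.1.2.1 B hB) (by simp [h])
    refine Finset.eq_singleton_iff_unique_mem.2 ⟨hBk ▸ hB, fun C hC => ?_⟩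
    obtain ⟨x, hx⟩ := hρ.1.1 C hC
    rw [← hBk]
    exact hρ.1.eq_of_mem hC hB hx (hBk ▸ hρ.1.2.1 C hC hx)

/-- Free cumulants are polynomial in the moments. -/
theorem exists_mvPolynomial_freeCumulant (k : ℕ) (hk : 1 ≤ k) :
    ∃ p : MvPolynomial ℕ ℝ, ∀ m c : ℕ → ℝ, (∀ k, 1 ≤ k → m k = ncMoment c k) →
      c k = MvPolynomial.eval m p := by
  induction k using Nat.strong_induction_on with
  | _ k ih =>
    choose! q hq using ih
    refine ⟨MvPolynomial.X k - ∑ ρ ∈ (ncPartitions (Finset.Icc 1 k)).erase {Finset.Icc 1 k},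
      ∏ B ∈ ρ, q B.card, fun m c h => ?_⟩
    have h1 := h k hk
    rw [ncMoment, ← Finset.add_sum_erase _ _
      (mem_ncPartitions.2 (isNCPartitionOn_singleton hk))] at h1
    have h2 : ∑ ρ ∈ (ncPartitions (Finset.Icc 1 k)).erase {Finset.Icc 1 k}, blockWeight c ρ
        = ∑ ρ ∈ (ncPartitions (Finset.Icc 1 k)).erase {Finset.Icc 1 k},
          ∏ B ∈ ρ, MvPolynomial.eval m (q B.card) := by
      refine Finset.sum_congr rfl fun ρ hρ => Finset.prod_congr rfl fun B hB => ?_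
      obtain ⟨hne, hρ⟩ := Finset.mem_erase.1 hρ
      obtain ⟨h3, h4⟩ := card_lt_of_ne_singleton (mem_ncPartitions.1 hρ) hne hB
      exact hq B.card h4 h3 m c h
    rw [h2] at h1
    simp only [map_sub, MvPolynomial.eval_X, map_sum, map_prod]
    simp only [blockWeight, Finset.prod_singleton, Nat.card_Icc, Nat.add_sub_cancel] at h1
    linarith

/-- If `M = 1 + M B` then `z M' = M ⬝ (M ⬝ z B')`. -/
theorem PowerSeries.X_mul_derivative_of_eq_one_add {R : Type*} [CommRing R]
    {M B : PowerSeries R} (h : M = 1 + M * B) :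
    PowerSeries.X * PowerSeries.derivative R M
      = M * (M * (PowerSeries.X * PowerSeries.derivative R B)) := by
  have h1 : PowerSeries.derivative R M
      = M * PowerSeries.derivative R B + B * PowerSeries.derivative R M := by
    conv_lhs => rw [h]
    simp
  have h2 : M * (1 - B) = 1 := by
    linear_combination h
  linear_combination (PowerSeries.X * M) * h1 - PowerSeries.X * PowerSeries.derivative R M * h2

theorem Matrix.trace_mul_pow_comm {m n R : Type*} [Fintype m] [Fintype n] [DecidableEq m]
    [DecidableEq n] [CommRing R] (A : Matrix m n R) (B : Matrix n m R) {l : ℕ} (hl : 1 ≤ l) :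
    ((A * B) ^ l).trace = ((B * A) ^ l).trace := by
  obtain ⟨l, rfl⟩ := Nat.exists_eq_add_of_le' hl
  have key : ∀ l, (A * B) ^ (l + 1) = A * ((B * A) ^ l * B) := by
    intro l
    induction l with
    | zero => simp
    | succ l ih =>
      rw [pow_succ, ih, pow_succ]
      simp only [Matrix.mul_assoc]
  rw [key, Matrix.trace_mul_comm, pow_succ, Matrix.mul_assoc]

theorem Matrix.trace_submatrix_pow {n : ℕ} {R : Type*} [CommRing R]
    (X : Matrix (Fin (n + 1)) (Fin (n + 1)) R) {l : ℕ} (hl : 1 ≤ l) :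
    ((X.submatrix Fin.castSucc Fin.castSucc) ^ l).trace
      = (((1 - Matrix.single (Fin.last n) (Fin.last n) 1) * X) ^ l).trace := by
  set J : Matrix (Fin (n + 1)) (Fin n) R := (1 : Matrix (Fin (n + 1)) (Fin (n + 1)) R).submatrix
    id Fin.castSucc with hJ
  set J' : Matrix (Fin n) (Fin (n + 1)) R := (1 : Matrix (Fin (n + 1)) (Fin (n + 1)) R).submatrix
    Fin.castSucc id with hJ'
  have h1 : X.submatrix Fin.castSucc Fin.castSucc = J' * (X * J) := by
    ext i j
    simp [hJ, hJ', Matrix.mul_apply, Matrix.one_apply]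
  have h2 : J * J' = 1 - Matrix.single (Fin.last n) (Fin.last n) 1 := by
    ext i j
    have h3 := congrFun (congrFun (Matrix.one_mul (1 : Matrix (Fin (n + 1)) (Fin (n + 1)) R)) i) j
    rw [Matrix.mul_apply, Fin.sum_univ_castSucc] at h3
    rw [Matrix.sub_apply, ← h3, Matrix.mul_apply, Matrix.single_apply]
    simp only [hJ, hJ', Matrix.submatrix_apply]
    rw [eq_sub_iff_add_eq]
    refine congrArg₂ (· + ·) rfl ?_
    rw [Matrix.one_apply, Matrix.one_apply]
    by_cases hi : i = Fin.last n <;> by_cases hj : Fin.last n = j <;>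
      simp [hi, hj, eq_comm]
  rw [h1, Matrix.trace_mul_pow_comm J' (X * J) hl, Matrix.mul_assoc, h2,
    Matrix.trace_mul_pow_comm X _ hl]

/-- The moments of the Rayleigh measure and of the spectral measure at the last basis vector
satisfy Newton's recursion. -/
theorem Matrix.sum_pow_last_mul_trace_sub {n : ℕ} {R : Type*} [CommRing R]
    (X : Matrix (Fin (n + 1)) (Fin (n + 1)) R) (k : ℕ) :
    ∑ j ∈ Finset.range k, (X ^ j) (Fin.last n) (Fin.last n)
        * ((X ^ (k - j)).trace - ((X.submatrix Fin.castSucc Fin.castSucc) ^ (k - j)).trace)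
      = k * (X ^ k) (Fin.last n) (Fin.last n) := by
  set e := Fin.last n
  set Q : Matrix (Fin (n + 1)) (Fin (n + 1)) R := Matrix.single e e 1 with hQ
  set Y := (1 - Q) * X with hY
  set μ : ℕ → R := fun j => (X ^ j) e e with hμ
  set b : ℕ → R := fun i => (X * Y ^ i) e e with hb
  have hQmul : ∀ A B : Matrix (Fin (n + 1)) (Fin (n + 1)) R, (A * Q * B) e e = A e e * B e e := by
    intro A B
    rw [Matrix.mul_assoc, Matrix.mul_apply, Finset.sum_eq_single e]
    · simp [hQ]
    · intro j _ hj
      rw [hQ, Matrix.single_mul_apply_of_ne _ _ _ _ _ hj, mul_zero]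
    · simp
  have hstep : ∀ l i, (X ^ (l + 1) * Y ^ i) e e = (X ^ l * Y ^ (i + 1)) e e + μ l * b i := by
    intro l i
    have : X ^ (l + 1) * Y ^ i = X ^ l * Y ^ (i + 1) + X ^ l * Q * (X * Y ^ i) := by
      rw [pow_succ X, pow_succ' Y]
      generalize Y ^ i = Z
      rw [hY]
      noncomm_ring
    rw [this, Matrix.add_apply, hQmul]
  have hc : ∀ l i, (X ^ (l + 1) * Y ^ i) e e
      = ∑ s ∈ Finset.range (l + 1), μ s * b (i + l - s) := by
    intro l
    induction l with
    | zero => intro i; simp [hμ, hb]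
    | succ l ih =>
      intro i
      rw [hstep, ih, Finset.sum_range_succ _ (l + 1)]
      congr 1
      · refine Finset.sum_congr rfl fun s hs => ?_
        rw [show i + 1 + l - s = i + (l + 1) - s by omega]
      · rw [show i + (l + 1) - (l + 1) = i by omega]
  have htr : ∀ m, (X ^ m).trace - (Y ^ m).trace
      = ∑ s ∈ Finset.range m, μ s * ((m - s : ℕ) * b (m - 1 - s)) := by
    intro m
    have htel : ∀ i, i < m → (Y ^ i * X ^ (m - i)).trace - (Y ^ (i + 1) * X ^ (m - (i + 1))).trace
        = ∑ s ∈ Finset.range (m - i), μ s * b (m - 1 - s) := by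
      intro i hi
      obtain ⟨l, rfl⟩ : ∃ l, m = i + 1 + l := ⟨m - (i + 1), by omega⟩
      have h1 : i + 1 + l - i = l + 1 := by omega
      have h2 : i + 1 + l - (i + 1) = l := by omega
      have h3 : Y ^ i * X ^ (l + 1) - Y ^ (i + 1) * X ^ l = Y ^ i * (Q * X ^ (l + 1)) := by
        rw [pow_succ Y, pow_succ' X]
        generalize Y ^ i = Z
        generalize X ^ l = W
        rw [hY]
        noncomm_ring
      rw [h1, h2, ← Matrix.trace_sub, h3, Matrix.trace_mul_comm, Matrix.mul_assoc,
        hQ, Matrix.trace_single_mul, smul_eq_mul, one_mul, hc]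
      refine Finset.sum_congr rfl fun s _ => ?_
      rw [show i + 1 + l - 1 - s = i + l - s by omega]
    have hsum := Finset.sum_range_sub' (fun i => (Y ^ i * X ^ (m - i)).trace) m
    simp only [pow_zero, one_mul, Nat.sub_zero, Nat.sub_self, mul_one] at hsum
    rw [← hsum, Finset.sum_congr rfl fun i hi => htel i (Finset.mem_range.1 hi)]
    rw [Finset.sum_comm' (t' := Finset.range m) (s' := fun s => Finset.range (m - s))]
    · refine Finset.sum_congr rfl fun s _ => ?_
      rw [Finset.sum_const, Finset.card_range, nsmul_eq_mul]
      ring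
    · intro x y
      simp only [Finset.mem_range]
      omega
  set M : PowerSeries R := PowerSeries.mk μ with hM
  set B : PowerSeries R := PowerSeries.mk (fun i => if i = 0 then 0 else b (i - 1)) with hB
  have hMB : M = 1 + M * B := by
    ext l
    rcases l with _ | l
    · simp [hM, hB, hμ]
    · rw [map_add, PowerSeries.coeff_mul, Finset.Nat.sum_antidiagonal_eq_sum_range_succ_mk,
        Finset.sum_range_succ]
      have := hc l 0
      simp only [pow_zero, mul_one, zero_add] at this
      simp only [hM, hB, PowerSeries.coeff_mk, PowerSeries.coeff_one, Nat.succ_ne_zero, if_false,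
        zero_add, Nat.sub_self, if_true, mul_zero, add_zero]
      rw [show μ (l + 1) = (X ^ (l + 1)) e e from rfl, this]
      refine Finset.sum_congr rfl fun s hs => ?_
      have hs := Finset.mem_range.1 hs
      rw [if_neg (by omega), show l + 1 - s - 1 = l - s by omega]
  have hXB : ∀ i, PowerSeries.coeff i (PowerSeries.X * PowerSeries.derivative R B)
      = i * b (i - 1) := by
    intro i
    rcases i with _ | i
    · simp
    · rw [PowerSeries.coeff_succ_X_mul, PowerSeries.coeff_derivative]
      simp [hB, mul_comm]
  have hP : ∀ m, PowerSeries.coeff m (M * (PowerSeries.X * PowerSeries.derivative R B))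
      = (X ^ m).trace - (Y ^ m).trace := by
    intro m
    rw [htr, PowerSeries.coeff_mul, Finset.Nat.sum_antidiagonal_eq_sum_range_succ_mk,
      Finset.sum_range_succ]
    simp only [hXB, hM, PowerSeries.coeff_mk, Nat.sub_self, Nat.cast_zero, zero_mul, mul_zero,
      add_zero]
    refine Finset.sum_congr rfl fun s _ => ?_
    rw [show m - 1 - s = m - s - 1 by omega]
  have hfin := congrArg (PowerSeries.coeff k) (PowerSeries.X_mul_derivative_of_eq_one_add hMB)
  rw [PowerSeries.coeff_mul k M, Finset.Nat.sum_antidiagonal_eq_sum_range_succ_mk,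
    Finset.sum_range_succ] at hfin
  simp only [hP, Nat.sub_self, pow_zero, sub_self, mul_zero, add_zero] at hfin
  have hlhs : PowerSeries.coeff k (PowerSeries.X * PowerSeries.derivative R M) = k * μ k := by
    rcases k with _ | k
    · simp
    · rw [PowerSeries.coeff_succ_X_mul, PowerSeries.coeff_derivative]
      simp [hM, mul_comm]
  rw [hlhs] at hfin
  rw [show (X ^ k) e e = μ k from rfl, hfin]
  refine Finset.sum_congr rfl fun j hj => ?_
  have hj := Finset.mem_range.1 hj
  rw [Matrix.trace_submatrix_pow X (by omega)]
  simp only [hM, PowerSeries.coeff_mk, hμ, hY, hQ]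
  rfl

/-- A left-invariant probability measure on a measurable group is right-invariant. -/
theorem isMulRightInvariant_of_isProbabilityMeasure {G : Type*} [Group G] [MeasurableSpace G]
    [MeasurableMul₂ G] [MeasurableInv G] (μ : Measure G) [IsProbabilityMeasure μ]
    [μ.IsMulLeftInvariant] : μ.IsMulRightInvariant := by
  have hprob : IsProbabilityMeasure μ.inv :=
    Measure.isProbabilityMeasure_map measurable_inv.aemeasurable
  have h : μ = μ.inv := by
    ext s hs
    have hm : Measurable (fun p : G × G => s.indicator (fun _ => (1 : ENNReal)) (p.1 * p.2)) :=
      (measurable_const.indicator hs).comp measurable_mul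
    have h1 : ∫⁻ x, ∫⁻ y, s.indicator (fun _ => (1 : ENNReal)) (x * y) ∂μ ∂μ.inv = μ s := by
      simp_rw [lintegral_mul_left_eq_self (μ := μ) (s.indicator fun _ => (1 : ENNReal)),
        lintegral_indicator_const hs]
      simp
    have h2 : ∫⁻ y, ∫⁻ x, s.indicator (fun _ => (1 : ENNReal)) (x * y) ∂μ.inv ∂μ = μ.inv s := by
      simp_rw [lintegral_mul_right_eq_self (μ := μ.inv) (s.indicator fun _ => (1 : ENNReal)),
        lintegral_indicator_const hs]
      simp
    rw [← h1, ← h2]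
    exact lintegral_lintegral_swap hm.aemeasurable
  rw [h]
  infer_instance

theorem measurable_matrix_entry {m n α : Type*} [MeasurableSpace α] (i : m) (j : n) :
    Measurable (fun A : Matrix m n α => A i j) :=
  (measurable_pi_apply j).comp (measurable_pi_apply (X := fun _ => n → α) i)

theorem measurable_matrix_of_entries {m n α β : Type*} [MeasurableSpace α] [MeasurableSpace β]
    {f : β → Matrix m n α} (h : ∀ i j, Measurable (fun x => f x i j)) : Measurable f :=
  measurable_pi_lambda f fun i => measurable_pi_lambda (fun x => f x i) fun j => h i j

instance unitaryGroup_measurableMul₂ (n : ℕ) :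
    MeasurableMul₂ (Matrix.unitaryGroup (Fin n) ℂ) := by
  refine ⟨Measurable.subtype_mk (measurable_matrix_of_entries fun i j => ?_)⟩
  have h : (fun p : Matrix.unitaryGroup (Fin n) ℂ × Matrix.unitaryGroup (Fin n) ℂ =>
      ((p.1 : Matrix (Fin n) (Fin n) ℂ) * (p.2 : Matrix (Fin n) (Fin n) ℂ)) i j)
      = fun p => ∑ l, (p.1 : Matrix (Fin n) (Fin n) ℂ) i l * (p.2 : Matrix (Fin n) (Fin n) ℂ) l j := by
    ext p
    exact Matrix.mul_apply
  refine h.symm ▸ (Finset.measurable_fun_sum _ fun l _ => Measurable.mul ?_ ?_)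
  · exact (measurable_matrix_entry i l).comp (measurable_subtype_coe.comp measurable_fst)
  · exact (measurable_matrix_entry l j).comp (measurable_subtype_coe.comp measurable_snd)

instance unitaryGroup_measurableInv (n : ℕ) :
    MeasurableInv (Matrix.unitaryGroup (Fin n) ℂ) := by
  refine ⟨Measurable.subtype_mk (measurable_matrix_of_entries fun i j => ?_)⟩
  have h : (fun p : Matrix.unitaryGroup (Fin n) ℂ => (star (p : Matrix (Fin n) (Fin n) ℂ)) i j)
      = fun p : Matrix.unitaryGroup (Fin n) ℂ => star ((p : Matrix (Fin n) (Fin n) ℂ) j i) := by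
    ext p
    exact Matrix.star_apply _ _ _
  have h2 : Measurable (fun p : Matrix.unitaryGroup (Fin n) ℂ =>
      (p : Matrix (Fin n) (Fin n) ℂ) j i) :=
    (measurable_matrix_entry j i).comp measurable_subtype_coe
  exact h.symm ▸ Complex.continuous_conj.measurable.comp h2

/-- The squared moduli of the last row of a matrix. -/
noncomputable def rowWeight {n : ℕ} (A : Matrix (Fin (n + 1)) (Fin (n + 1)) ℂ)
    (i : Fin (n + 1)) : ℝ := Complex.normSq (A (Fin.last n) i)

theorem measurable_rowWeight {n : ℕ} (i : Fin (n + 1)) :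
    Measurable (fun A : Matrix (Fin (n + 1)) (Fin (n + 1)) ℂ => rowWeight A i) :=
  Complex.continuous_normSq.measurable.comp (measurable_matrix_entry _ i)

theorem rowWeight_nonneg {n : ℕ} (A : Matrix (Fin (n + 1)) (Fin (n + 1)) ℂ) (i : Fin (n + 1)) :
    0 ≤ rowWeight A i := Complex.normSq_nonneg _

theorem sum_rowWeight {n : ℕ} {A : Matrix (Fin (n + 1)) (Fin (n + 1)) ℂ}
    (hA : A ∈ Matrix.unitaryGroup (Fin (n + 1)) ℂ) : ∑ i, rowWeight A i = 1 := by
  have h := congrFun (congrFun (Matrix.mem_unitaryGroup_iff.1 hA) (Fin.last n)) (Fin.last n)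
  rw [Matrix.mul_apply, Matrix.one_apply_eq] at h
  have h2 : ((∑ i, rowWeight A i : ℝ) : ℂ) = 1 := by
    rw [← h]
    push_cast
    refine Finset.sum_congr rfl fun i _ => ?_
    rw [Matrix.star_apply, rowWeight, ← Complex.mul_conj]
    rfl
  exact_mod_cast h2

theorem rowWeight_le_one {n : ℕ} {A : Matrix (Fin (n + 1)) (Fin (n + 1)) ℂ}
    (hA : A ∈ Matrix.unitaryGroup (Fin (n + 1)) ℂ) (i : Fin (n + 1)) : rowWeight A i ≤ 1 := by
  rw [← sum_rowWeight hA]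
  exact Finset.single_le_sum (fun j _ => rowWeight_nonneg A j) (Finset.mem_univ i)

theorem sum_normSq_col {n : ℕ} {A : Matrix (Fin (n + 1)) (Fin (n + 1)) ℂ}
    (hA : A ∈ Matrix.unitaryGroup (Fin (n + 1)) ℂ) (i : Fin (n + 1)) :
    ∑ m, Complex.normSq (A m i) = 1 := by
  have h := congrFun (congrFun (Matrix.mem_unitaryGroup_iff'.1 hA) i) i
  rw [Matrix.mul_apply, Matrix.one_apply_eq] at h
  have h2 : ((∑ m, Complex.normSq (A m i) : ℝ) : ℂ) = 1 := by
    rw [← h]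
    push_cast
    refine Finset.sum_congr rfl fun m _ => ?_
    rw [Matrix.star_apply, Complex.normSq_eq_conj_mul_self]
    rfl
  exact_mod_cast h2

/-- The sign `±1` attached to a Boolean. -/
def boolSign (b : Bool) : ℝ := if b then 1 else -1

theorem boolSign_sq (b : Bool) : boolSign b ^ 2 = 1 := by
  cases b <;> simp [boolSign]

theorem sum_exp_boolSign_le {ι : Type*} [Fintype ι] [DecidableEq ι] (a : ι → ℝ)
    (ha : ∑ i, a i ^ 2 ≤ 1) :
    ∑ ε : ι → Bool, Real.exp (∑ i, boolSign (ε i) * a i)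
      ≤ 2 ^ Fintype.card ι * Real.exp 1 := by
  have h1 : ∑ ε : ι → Bool, Real.exp (∑ i, boolSign (ε i) * a i)
      = ∏ i, ∑ b : Bool, Real.exp (boolSign b * a i) := by
    simp only [Real.exp_sum]
    exact (Fintype.prod_sum fun i b => Real.exp (boolSign b * a i)).symm
  rw [h1]
  have h2 : ∀ i, ∑ b : Bool, Real.exp (boolSign b * a i) ≤ 2 * Real.exp (a i ^ 2 / 2) := by
    intro i
    have h3 := Real.cosh_le_exp_half_sq (a i)
    rw [Real.cosh_eq] at h3
    simp only [Fintype.sum_bool, boolSign, if_true, one_mul, Bool.false_eq_true, if_false,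
      neg_one_mul]
    linarith
  calc ∏ i, ∑ b : Bool, Real.exp (boolSign b * a i)
      ≤ ∏ i, (2 * Real.exp (a i ^ 2 / 2)) :=
        Finset.prod_le_prod (fun i _ => Finset.sum_nonneg fun b _ => (Real.exp_pos _).le)
          fun i _ => h2 i
    _ = 2 ^ Fintype.card ι * Real.exp (∑ i, a i ^ 2 / 2) := by
        rw [Finset.prod_mul_distrib, Finset.prod_const, Finset.card_univ, Real.exp_sum]
    _ ≤ 2 ^ Fintype.card ι * Real.exp 1 := by
        gcongr
        rw [← Finset.sum_div]
        linarith [Finset.sum_nonneg fun i (_ : i ∈ Finset.univ) => sq_nonneg (a i)]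

theorem pow_le_factorial_mul_exp (x : ℝ) (l : ℕ) :
    x ^ (2 * l) ≤ (2 * l).factorial * (Real.exp x + Real.exp (-x)) := by
  have h1 := Real.pow_div_factorial_le_exp |x| (abs_nonneg x) (2 * l)
  rw [div_le_iff₀ (by positivity), (even_two_mul l).pow_abs] at h1
  have h2 : Real.exp |x| ≤ Real.exp x + Real.exp (-x) := by
    rcases abs_cases x with ⟨h, -⟩ | ⟨h, -⟩ <;> rw [h] <;>
      linarith [Real.exp_pos x, Real.exp_pos (-x)]
  calc x ^ (2 * l) ≤ Real.exp |x| * (2 * l).factorial := h1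
    _ ≤ _ := by rw [mul_comm]; gcongr

/-- Khintchine's inequality for even moments. -/
theorem sum_boolSign_pow_le {ι : Type*} [Fintype ι] [DecidableEq ι] (a : ι → ℝ)
    (ha : ∑ i, a i ^ 2 ≤ 1) (l : ℕ) :
    ∑ ε : ι → Bool, (∑ i, boolSign (ε i) * a i) ^ (2 * l)
      ≤ 2 ^ Fintype.card ι * (2 * (2 * l).factorial * Real.exp 1) := by
  have h1 := sum_exp_boolSign_le a ha
  have h2 := sum_exp_boolSign_le (fun i => -a i) (by simpa using ha)
  simp only [mul_neg, Finset.sum_neg_distrib] at h2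
  calc ∑ ε : ι → Bool, (∑ i, boolSign (ε i) * a i) ^ (2 * l)
      ≤ ∑ ε : ι → Bool, (2 * l).factorial * (Real.exp (∑ i, boolSign (ε i) * a i)
          + Real.exp (-∑ i, boolSign (ε i) * a i)) :=
        Finset.sum_le_sum fun ε _ => pow_le_factorial_mul_exp _ l
    _ ≤ (2 * l).factorial * (2 ^ Fintype.card ι * Real.exp 1
          + 2 ^ Fintype.card ι * Real.exp 1) := by
        rw [← Finset.mul_sum, Finset.sum_add_distrib]
        gcongr
    _ = _ := by ring

/-- The constant in Khintchine's inequality for complex coefficients. -/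
noncomputable def khintchineConst (l : ℕ) : ℝ := 2 ^ l * (4 * (2 * l).factorial * Real.exp 1)

theorem khintchineConst_nonneg (l : ℕ) : 0 ≤ khintchineConst l := by
  unfold khintchineConst
  positivity

theorem sum_normSq_boolSign_pow_le {ι : Type*} [Fintype ι] [DecidableEq ι] (z : ι → ℂ)
    (hz : ∑ i, Complex.normSq (z i) ≤ 1) (l : ℕ) :
    ∑ ε : ι → Bool, Complex.normSq (∑ i, (boolSign (ε i) : ℂ) * z i) ^ l
      ≤ 2 ^ Fintype.card ι * khintchineConst l := by
  have hre : ∑ i, (z i).re ^ 2 ≤ 1 := le_trans (Finset.sum_le_sum fun i _ => by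
    rw [Complex.normSq_apply]; nlinarith [mul_self_nonneg (z i).im]) hz
  have him : ∑ i, (z i).im ^ 2 ≤ 1 := le_trans (Finset.sum_le_sum fun i _ => by
    rw [Complex.normSq_apply]; nlinarith [mul_self_nonneg (z i).re]) hz
  have hpt : ∀ ε : ι → Bool, Complex.normSq (∑ i, (boolSign (ε i) : ℂ) * z i) ^ l
      ≤ 2 ^ l * ((∑ i, boolSign (ε i) * (z i).re) ^ (2 * l)
        + (∑ i, boolSign (ε i) * (z i).im) ^ (2 * l)) := by
    intro ε
    rw [Complex.normSq_apply, Complex.re_sum, Complex.im_sum]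
    simp only [Complex.re_ofReal_mul, Complex.im_ofReal_mul]
    rw [← sq, ← sq, pow_mul, pow_mul]
    refine (add_pow_le (sq_nonneg _) (sq_nonneg _) l).trans ?_
    gcongr
    · norm_num
    · omega
  calc _ ≤ ∑ ε : ι → Bool, 2 ^ l * ((∑ i, boolSign (ε i) * (z i).re) ^ (2 * l)
        + (∑ i, boolSign (ε i) * (z i).im) ^ (2 * l)) := Finset.sum_le_sum fun ε _ => hpt ε
    _ ≤ 2 ^ l * (2 ^ Fintype.card ι * (2 * (2 * l).factorial * Real.exp 1)
        + 2 ^ Fintype.card ι * (2 * (2 * l).factorial * Real.exp 1)) := by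
        rw [← Finset.mul_sum, Finset.sum_add_distrib]
        gcongr
        · exact sum_boolSign_pow_le _ hre l
        · exact sum_boolSign_pow_le _ him l
    _ = _ := by rw [khintchineConst]; ring

/-- Every unit vector is the last row of some unitary matrix. -/
theorem exists_unitary_last_row {n : ℕ} (v : Fin (n + 1) → ℂ)
    (hv : ∑ i, Complex.normSq (v i) = 1) :
    ∃ V ∈ Matrix.unitaryGroup (Fin (n + 1)) ℂ, ∀ i, V (Fin.last n) i = v i := by
  set x : EuclideanSpace ℂ (Fin (n + 1)) := WithLp.toLp 2 v with hx
  have hnorm : ‖x‖ = 1 := by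
    rw [EuclideanSpace.norm_eq, Real.sqrt_eq_one, ← hv]
    exact Finset.sum_congr rfl fun i _ => (Complex.normSq_eq_norm_sq _).symm
  obtain ⟨b, hb⟩ := Orthonormal.exists_orthonormalBasis_extension_of_card_eq (𝕜 := ℂ)
    (E := EuclideanSpace ℂ (Fin (n + 1))) (ι := Fin (n + 1)) (by simp)
    (v := fun _ => x) (s := {Fin.last n}) (by
      rw [orthonormal_iff_ite]
      rintro ⟨i, hi⟩ ⟨j, hj⟩
      rw [Set.mem_singleton_iff] at hi hj
      subst hi hj
      simp [inner_self_eq_norm_sq_to_K, hnorm])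
  refine ⟨Matrix.of fun i j => b i j, Matrix.mem_unitaryGroup_iff.2 ?_, fun i => ?_⟩
  · ext i j
    rw [Matrix.mul_apply, Matrix.one_apply]
    have h := orthonormal_iff_ite.1 b.orthonormal j i
    rw [PiLp.inner_apply] at h
    simp only [Matrix.star_apply, Matrix.of_apply]
    simp only [RCLike.inner_apply] at h
    exact h.trans (by simp [eq_comm])
  · rw [Matrix.of_apply, hb _ rfl]

theorem card_mul_sum_filter_eq_le {L N : ℕ} {a b : Fin L} (hab : a ≠ b)
    (h : (Fin L → Fin N) → ℝ) (h0 : ∀ t, 0 ≤ h t)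
    (hupd : ∀ t j, h (Function.update t a j) = h t) :
    N * ∑ t with t a = t b, h t ≤ ∑ t, h t := by
  have h1 : N * ∑ t with t a = t b, h t
      = ∑ p ∈ ({t | t a = t b} : Finset (Fin L → Fin N)) ×ˢ (univ : Finset (Fin N)),
          h (Function.update p.1 a p.2) := by
    rw [Finset.sum_product, Finset.mul_sum]
    refine Finset.sum_congr rfl fun t _ => ?_
    simp [hupd]
  have hinj : Set.InjOn (fun p : (Fin L → Fin N) × Fin N => Function.update p.1 a p.2)
      (({t | t a = t b} : Finset (Fin L → Fin N)) ×ˢ (univ : Finset (Fin N)) :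
        Finset ((Fin L → Fin N) × Fin N)) := by
    rintro ⟨t, j⟩ ht ⟨t', j'⟩ ht' heq
    simp only [Finset.coe_product, Set.mem_prod, Finset.mem_coe, Finset.mem_filter,
      Finset.mem_univ, true_and, and_true] at ht ht' heq
    have hj : j = j' := by simpa using congrFun heq a
    have ht2 : ∀ c, c ≠ a → t c = t' c := fun c hc => by simpa [hc] using congrFun heq c
    refine Prod.ext (funext fun c => ?_) hj
    by_cases hc : c = a
    · rw [hc]
      exact ht.trans ((ht2 b hab.symm).trans ht'.symm)
    · exact ht2 c hc
  rw [h1, ← Finset.sum_image (f := h) hinj]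
  exact Finset.sum_le_sum_of_subset_of_nonneg (Finset.subset_univ _) fun t _ _ => h0 t

/-- Tuples with a repetition contribute a fraction of order `1 / N` to a sum over all tuples of
a nonnegative function of one coordinate. -/
theorem card_mul_sum_not_injective_le {L N : ℕ} (c : Fin L) (g : Fin N → ℝ) (hg : ∀ i, 0 ≤ g i) :
    N * ∑ t : Fin L → Fin N with ¬ Function.Injective t, g (t c)
      ≤ L ^ 2 * ∑ t : Fin L → Fin N, g (t c) := by
  have h1 : ∑ t : Fin L → Fin N with ¬ Function.Injective t, g (t c)
      ≤ ∑ p : Fin L × Fin L with p.1 ≠ p.2 ∧ p.1 ≠ c,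
          ∑ t : Fin L → Fin N with t p.1 = t p.2, g (t c) := by
    simp_rw [Finset.sum_filter (fun t : Fin L → Fin N => _ = _)]
    rw [Finset.sum_comm, Finset.sum_filter]
    refine Finset.sum_le_sum fun t _ => ?_
    have hnn : ∀ p : Fin L × Fin L, 0 ≤ if t p.1 = t p.2 then g (t c) else 0 := fun p => by
      split_ifs
      · exact hg _
      · exact le_rfl
    split_ifs with ht
    · exact Finset.sum_nonneg fun p _ => hnn p
    · obtain ⟨a, b, hab, hne⟩ : ∃ a b, t a = t b ∧ a ≠ b := by
        simpa [Function.Injective] using ht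
      obtain ⟨a, b, hab, hne, hac⟩ : ∃ a b, t a = t b ∧ a ≠ b ∧ a ≠ c := by
        by_cases hac : a = c
        · exact ⟨b, a, hab.symm, hne.symm, fun h => hne (hac.trans h.symm)⟩
        · exact ⟨a, b, hab, hne, hac⟩
      refine (if_pos hab).symm.le.trans (Finset.single_le_sum (f := fun p : Fin L × Fin L =>
        if t p.1 = t p.2 then g (t c) else 0) (fun p _ => hnn p) (a := (a, b)) (by simp [hne, hac]))
  calc N * ∑ t : Fin L → Fin N with ¬ Function.Injective t, g (t c)
      ≤ N * ∑ p : Fin L × Fin L with p.1 ≠ p.2 ∧ p.1 ≠ c,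
          ∑ t : Fin L → Fin N with t p.1 = t p.2, g (t c) := by gcongr
    _ ≤ ∑ p : Fin L × Fin L with p.1 ≠ p.2 ∧ p.1 ≠ c, ∑ t : Fin L → Fin N, g (t c) := by
        rw [Finset.mul_sum]
        refine Finset.sum_le_sum fun p hp => ?_
        rw [Finset.mem_filter] at hp
        exact card_mul_sum_filter_eq_le hp.2.1 (fun t => g (t c)) (fun t => hg _)
          fun t j => by rw [Function.update_of_ne hp.2.2.symm]
    _ ≤ ∑ p : Fin L × Fin L, ∑ t : Fin L → Fin N, g (t c) :=
        Finset.sum_le_sum_of_subset_of_nonneg (Finset.filter_subset _ _)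
          fun _ _ _ => Finset.sum_nonneg fun t _ => hg _
    _ = _ := by simp [sq]

theorem card_mul_card_not_injective_le (L N : ℕ) :
    (N : ℝ) * #{t : Fin L → Fin N | ¬ Function.Injective t} ≤ L ^ 2 * N ^ L := by
  rcases L with _ | L
  · have : #{t : Fin 0 → Fin N | ¬ Function.Injective t} = 0 :=
      Finset.card_eq_zero.2 (Finset.filter_eq_empty_iff.2 fun t _ =>
        not_not.2 (Function.injective_of_subsingleton t))
    rw [this]
    simp
  · simpa using card_mul_sum_not_injective_le (N := N) (0 : Fin (L + 1)) (fun _ => 1)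
      fun _ => zero_le_one

theorem sum_apply_eq {L N : ℕ} (c : Fin L) (g : Fin N → ℝ) :
    N * ∑ t : Fin L → Fin N, g (t c) = N ^ L * ∑ i, g i := by
  have h1 : ∀ t : Fin L → Fin N, g (t c) = ∏ a, if a = c then g (t a) else 1 := fun t => by
    simp
  simp_rw [h1]
  rw [← Fintype.prod_sum (fun a i => if a = c then g i else 1),
    Fintype.prod_eq_mul_prod_compl c]
  have h2 : ∀ a ∈ ({c}ᶜ : Finset (Fin L)), (∑ i, if a = c then g i else 1) = (N : ℝ) := by
    intro a ha
    rw [Finset.mem_compl, Finset.mem_singleton] at ha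
    simp [ha]
  rw [Finset.prod_congr rfl h2, Finset.prod_const, Finset.card_compl, Fintype.card_fin,
    Finset.card_singleton]
  obtain ⟨l, rfl⟩ : ∃ l, L = l + 1 := Nat.exists_eq_succ_of_ne_zero (Fin.pos c).ne'
  simp [pow_succ]
  ring

/-- Joint moments of the squared moduli of the last row under a measure on the unitary group. -/
noncomputable def rowMoment {n L : ℕ} (μ : Measure (Matrix.unitaryGroup (Fin (n + 1)) ℂ))
    (t : Fin L → Fin (n + 1)) : ℝ :=
  ∫ g : Matrix.unitaryGroup (Fin (n + 1)) ℂ,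
    ∏ a, rowWeight (g : Matrix (Fin (n + 1)) (Fin (n + 1)) ℂ) (t a) ∂μ

theorem measurable_prod_rowWeight {n L : ℕ} (t : Fin L → Fin (n + 1)) :
    Measurable (fun A : Matrix (Fin (n + 1)) (Fin (n + 1)) ℂ => ∏ a, rowWeight A (t a)) :=
  Finset.measurable_fun_prod _ fun a _ => measurable_rowWeight (t a)

theorem norm_prod_rowWeight_le {n L : ℕ} {A : Matrix (Fin (n + 1)) (Fin (n + 1)) ℂ}
    (hA : A ∈ Matrix.unitaryGroup (Fin (n + 1)) ℂ) (t : Fin L → Fin (n + 1)) :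
    ‖∏ a, rowWeight A (t a)‖ ≤ 1 := by
  rw [Real.norm_of_nonneg (Finset.prod_nonneg fun a _ => rowWeight_nonneg _ _)]
  exact Finset.prod_le_one (fun a _ => rowWeight_nonneg _ _) fun a _ => rowWeight_le_one hA _

theorem integrable_prod_rowWeight {n L : ℕ}
    (μ : Measure (Matrix.unitaryGroup (Fin (n + 1)) ℂ)) [IsProbabilityMeasure μ]
    (t : Fin L → Fin (n + 1)) :
    Integrable (fun g : Matrix.unitaryGroup (Fin (n + 1)) ℂ =>
      ∏ a, rowWeight (g : Matrix (Fin (n + 1)) (Fin (n + 1)) ℂ) (t a)) μ :=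
  Integrable.of_bound ((measurable_prod_rowWeight t).comp
    measurable_subtype_coe).aestronglyMeasurable 1
    (Filter.Eventually.of_forall fun g => norm_prod_rowWeight_le g.2 t)

theorem integrable_rowWeight_pow {n : ℕ}
    (μ : Measure (Matrix.unitaryGroup (Fin (n + 1)) ℂ)) [IsProbabilityMeasure μ]
    (i : Fin (n + 1)) (L : ℕ) :
    Integrable (fun g : Matrix.unitaryGroup (Fin (n + 1)) ℂ =>
      rowWeight (g : Matrix (Fin (n + 1)) (Fin (n + 1)) ℂ) i ^ L) μ := by
  simpa using integrable_prod_rowWeight μ (fun _ : Fin L => i)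

theorem integral_rowWeight_pow_le {n : ℕ}
    (μ : Measure (Matrix.unitaryGroup (Fin (n + 1)) ℂ)) [IsProbabilityMeasure μ]
    [μ.IsMulLeftInvariant] (i : Fin (n + 1)) (L : ℕ) :
    ∫ g : Matrix.unitaryGroup (Fin (n + 1)) ℂ,
      rowWeight (g : Matrix (Fin (n + 1)) (Fin (n + 1)) ℂ) i ^ L ∂μ
      ≤ khintchineConst L / (n + 1 : ℝ) ^ L := by
  have hN : (0 : ℝ) < n + 1 := by positivity
  have hV : ∀ ε : Fin (n + 1) → Bool, ∃ V : Matrix.unitaryGroup (Fin (n + 1)) ℂ,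
      ∀ m, (V : Matrix (Fin (n + 1)) (Fin (n + 1)) ℂ) (Fin.last n) m
        = ((√(n + 1 : ℝ))⁻¹ : ℝ) * (boolSign (ε m) : ℂ) := by
    intro ε
    obtain ⟨V, hV, h⟩ := exists_unitary_last_row
      (fun m => (((√(n + 1 : ℝ))⁻¹ : ℝ) : ℂ) * (boolSign (ε m) : ℂ)) (by
        simp only [Complex.normSq_mul, Complex.normSq_ofReal, ← sq, boolSign_sq, mul_one, inv_pow,
          Real.sq_sqrt hN.le, Finset.sum_const, Finset.card_univ, Fintype.card_fin, nsmul_eq_mul]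
        push_cast
        exact mul_inv_cancel₀ hN.ne')
    exact ⟨⟨V, hV⟩, h⟩
  choose V hV using hV
  have hrow : ∀ ε (g : Matrix.unitaryGroup (Fin (n + 1)) ℂ),
      rowWeight ((V ε * g : Matrix.unitaryGroup (Fin (n + 1)) ℂ) :
        Matrix (Fin (n + 1)) (Fin (n + 1)) ℂ) i
      = (n + 1 : ℝ)⁻¹ * Complex.normSq (∑ m, (boolSign (ε m) : ℂ) *
        (g : Matrix (Fin (n + 1)) (Fin (n + 1)) ℂ) m i) := by
    intro ε g
    have h1 : ((V ε * g : Matrix.unitaryGroup (Fin (n + 1)) ℂ) :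
        Matrix (Fin (n + 1)) (Fin (n + 1)) ℂ) (Fin.last n) i
        = ((√(n + 1 : ℝ))⁻¹ : ℝ) * ∑ m, (boolSign (ε m) : ℂ) *
          (g : Matrix (Fin (n + 1)) (Fin (n + 1)) ℂ) m i := by
      rw [Submonoid.coe_mul, Matrix.mul_apply, Finset.mul_sum]
      exact Finset.sum_congr rfl fun m _ => by rw [hV, mul_assoc]
    rw [rowWeight, h1, Complex.normSq_mul, Complex.normSq_ofReal, ← sq, inv_pow,
      Real.sq_sqrt hN.le]
  have hinv : ∀ ε : Fin (n + 1) → Bool, ∫ g : Matrix.unitaryGroup (Fin (n + 1)) ℂ,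
      ((n + 1 : ℝ)⁻¹ * Complex.normSq (∑ m, (boolSign (ε m) : ℂ) *
        (g : Matrix (Fin (n + 1)) (Fin (n + 1)) ℂ) m i)) ^ L ∂μ
      = ∫ g : Matrix.unitaryGroup (Fin (n + 1)) ℂ,
        rowWeight (g : Matrix (Fin (n + 1)) (Fin (n + 1)) ℂ) i ^ L ∂μ := by
    intro ε
    rw [← integral_mul_left_eq_self (μ := μ) (fun g : Matrix.unitaryGroup (Fin (n + 1)) ℂ =>
      rowWeight (g : Matrix (Fin (n + 1)) (Fin (n + 1)) ℂ) i ^ L) (V ε)]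
    simp_rw [hrow]
  have hinteg : ∀ ε : Fin (n + 1) → Bool, Integrable
      (fun g : Matrix.unitaryGroup (Fin (n + 1)) ℂ =>
        ((n + 1 : ℝ)⁻¹ * Complex.normSq (∑ m, (boolSign (ε m) : ℂ) *
          (g : Matrix (Fin (n + 1)) (Fin (n + 1)) ℂ) m i)) ^ L) μ := by
    intro ε
    simp_rw [← hrow]
    exact (integrable_rowWeight_pow μ i L).comp_mul_left (V ε)
  have hpt : ∀ g : Matrix.unitaryGroup (Fin (n + 1)) ℂ, ∑ ε : Fin (n + 1) → Bool,
      ((n + 1 : ℝ)⁻¹ * Complex.normSq (∑ m, (boolSign (ε m) : ℂ) *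
        (g : Matrix (Fin (n + 1)) (Fin (n + 1)) ℂ) m i)) ^ L
      ≤ 2 ^ (n + 1) * (khintchineConst L / (n + 1 : ℝ) ^ L) := by
    intro g
    have h := sum_normSq_boolSign_pow_le
      (fun m => (g : Matrix (Fin (n + 1)) (Fin (n + 1)) ℂ) m i) (sum_normSq_col g.2 i).le L
    rw [Fintype.card_fin] at h
    simp only [mul_pow, ← Finset.mul_sum]
    refine (mul_le_mul_of_nonneg_left h (by positivity)).trans (le_of_eq ?_)
    rw [inv_pow]
    ring
  have hsum : (2 : ℝ) ^ (n + 1) * ∫ g : Matrix.unitaryGroup (Fin (n + 1)) ℂ,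
      rowWeight (g : Matrix (Fin (n + 1)) (Fin (n + 1)) ℂ) i ^ L ∂μ
      ≤ 2 ^ (n + 1) * (khintchineConst L / (n + 1 : ℝ) ^ L) := by
    calc _ = ∑ ε : Fin (n + 1) → Bool, ∫ g : Matrix.unitaryGroup (Fin (n + 1)) ℂ,
          ((n + 1 : ℝ)⁻¹ * Complex.normSq (∑ m, (boolSign (ε m) : ℂ) *
            (g : Matrix (Fin (n + 1)) (Fin (n + 1)) ℂ) m i)) ^ L ∂μ := by
          simp_rw [hinv]
          simp
      _ = ∫ g : Matrix.unitaryGroup (Fin (n + 1)) ℂ, ∑ ε : Fin (n + 1) → Bool,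
          ((n + 1 : ℝ)⁻¹ * Complex.normSq (∑ m, (boolSign (ε m) : ℂ) *
            (g : Matrix (Fin (n + 1)) (Fin (n + 1)) ℂ) m i)) ^ L ∂μ :=
          (integral_finsetSum _ fun ε _ => hinteg ε).symm
      _ ≤ ∫ _ : Matrix.unitaryGroup (Fin (n + 1)) ℂ,
          2 ^ (n + 1) * (khintchineConst L / (n + 1 : ℝ) ^ L) ∂μ := by
          exact integral_mono (integrable_finsetSum _ fun ε _ => hinteg ε)
            (integrable_const _) hpt
      _ = _ := by simp
  exact le_of_mul_le_mul_left hsum (by positivity)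

theorem prod_le_sum_pow {L : ℕ} (hL : 1 ≤ L) (x : Fin L → ℝ) (hx : ∀ a, 0 ≤ x a) :
    ∏ a, x a ≤ ∑ a, x a ^ L := by
  have : Nonempty (Fin L) := ⟨⟨0, hL⟩⟩
  obtain ⟨c, -, hc⟩ := Finset.exists_max_image univ x Finset.univ_nonempty
  calc ∏ a, x a ≤ ∏ _a : Fin L, x c :=
        Finset.prod_le_prod (fun a _ => hx a) fun a ha => hc a ha
    _ = x c ^ L := by simp
    _ ≤ ∑ a, x a ^ L :=
        Finset.single_le_sum (f := fun a => x a ^ L) (fun a _ => pow_nonneg (hx a) L)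
          (Finset.mem_univ c)

theorem rowMoment_nonneg {n L : ℕ} (μ : Measure (Matrix.unitaryGroup (Fin (n + 1)) ℂ))
    (t : Fin L → Fin (n + 1)) : 0 ≤ rowMoment μ t :=
  integral_nonneg fun _ => Finset.prod_nonneg fun _ _ => rowWeight_nonneg _ _

theorem rowMoment_le {n L : ℕ} (μ : Measure (Matrix.unitaryGroup (Fin (n + 1)) ℂ))
    [IsProbabilityMeasure μ] [μ.IsMulLeftInvariant] (t : Fin L → Fin (n + 1)) :
    rowMoment μ t ≤ (1 + L * khintchineConst L) / (n + 1 : ℝ) ^ L := by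
  rcases Nat.eq_zero_or_pos L with rfl | hL
  · simp [rowMoment]
  calc rowMoment μ t ≤ ∫ g : Matrix.unitaryGroup (Fin (n + 1)) ℂ,
        ∑ a, rowWeight (g : Matrix (Fin (n + 1)) (Fin (n + 1)) ℂ) (t a) ^ L ∂μ :=
        integral_mono (integrable_prod_rowWeight μ t)
          (integrable_finsetSum _ fun a _ => integrable_rowWeight_pow μ (t a) L)
          fun g => prod_le_sum_pow hL _ fun a => rowWeight_nonneg _ _
    _ = ∑ a, ∫ g : Matrix.unitaryGroup (Fin (n + 1)) ℂ,
        rowWeight (g : Matrix (Fin (n + 1)) (Fin (n + 1)) ℂ) (t a) ^ L ∂μ :=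
        integral_finsetSum _ fun a _ => integrable_rowWeight_pow μ (t a) L
    _ ≤ ∑ _a : Fin L, khintchineConst L / (n + 1 : ℝ) ^ L :=
        Finset.sum_le_sum fun a _ => integral_rowWeight_pow_le μ (t a) L
    _ = L * khintchineConst L / (n + 1 : ℝ) ^ L := by simp [mul_div_assoc]
    _ ≤ _ := by gcongr; linarith

theorem sum_rowMoment {n : ℕ} (L : ℕ) (μ : Measure (Matrix.unitaryGroup (Fin (n + 1)) ℂ))
    [IsProbabilityMeasure μ] : ∑ t : Fin L → Fin (n + 1), rowMoment μ t = 1 := by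
  simp only [rowMoment]
  rw [← integral_finsetSum _ fun t _ => integrable_prod_rowWeight μ t]
  have h : ∀ g : Matrix.unitaryGroup (Fin (n + 1)) ℂ, ∑ t : Fin L → Fin (n + 1),
      ∏ a, rowWeight (g : Matrix (Fin (n + 1)) (Fin (n + 1)) ℂ) (t a) = 1 := fun g => by
    rw [← Fintype.prod_sum (fun (_ : Fin L) i =>
      rowWeight (g : Matrix (Fin (n + 1)) (Fin (n + 1)) ℂ) i), sum_rowWeight g.2]
    simp
  simp [h]

theorem rowMoment_comp_perm {n L : ℕ} (μ : Measure (Matrix.unitaryGroup (Fin (n + 1)) ℂ))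
    [μ.IsMulRightInvariant] (σ : Equiv.Perm (Fin (n + 1))) (t : Fin L → Fin (n + 1)) :
    rowMoment μ (σ ∘ t) = rowMoment μ t := by
  have hP : (1 : Matrix (Fin (n + 1)) (Fin (n + 1)) ℂ).submatrix id σ
      ∈ Matrix.unitaryGroup (Fin (n + 1)) ℂ := by
    rw [Matrix.mem_unitaryGroup_iff, Matrix.star_eq_conjTranspose, Matrix.conjTranspose_submatrix,
      Matrix.submatrix_mul_equiv, Matrix.conjTranspose_one, one_mul, Matrix.submatrix_id_id]
  rw [rowMoment, rowMoment, ← integral_mul_right_eq_self (μ := μ) (fun g =>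
    ∏ a, rowWeight (g : Matrix (Fin (n + 1)) (Fin (n + 1)) ℂ) (t a)) (⟨_, hP⟩ :
    Matrix.unitaryGroup (Fin (n + 1)) ℂ)]
  refine integral_congr_ae (Filter.Eventually.of_forall fun g => ?_)
  refine Finset.prod_congr rfl fun a _ => ?_
  have h := Matrix.mul_submatrix_one (Equiv.refl (Fin (n + 1))) σ
    (g : Matrix (Fin (n + 1)) (Fin (n + 1)) ℂ)
  simp only [Equiv.coe_refl, Equiv.refl_symm, Function.id_comp] at h
  simp only [rowWeight, Submonoid.coe_mul, h, Matrix.submatrix_apply, id, Function.comp]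

theorem rowMoment_eq_of_injective {n L : ℕ} (μ : Measure (Matrix.unitaryGroup (Fin (n + 1)) ℂ))
    [μ.IsMulRightInvariant] {t t' : Fin L → Fin (n + 1)} (ht : Function.Injective t)
    (ht' : Function.Injective t') : rowMoment μ t = rowMoment μ t' := by
  let e : {x // x ∈ Set.range t} ≃ {x // x ∈ Set.range t'} :=
    (Equiv.ofInjective t ht).symm.trans (Equiv.ofInjective t' ht')
  have h : t' = e.extendSubtype ∘ t := by
    ext1 a
    rw [Function.comp, Equiv.extendSubtype_apply_of_mem e _ ⟨a, rfl⟩]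
    have : (⟨t a, ⟨a, rfl⟩⟩ : {x // x ∈ Set.range t}) = Equiv.ofInjective t ht a := rfl
    rw [this]
    simp [e]
  rw [h, rowMoment_comp_perm]

theorem abs_rowMoment_sub_le {n L : ℕ} (μ : Measure (Matrix.unitaryGroup (Fin (n + 1)) ℂ))
    [IsProbabilityMeasure μ] [μ.IsMulLeftInvariant] [μ.IsMulRightInvariant]
    {t : Fin L → Fin (n + 1)} (ht : Function.Injective t) :
    |rowMoment μ t - 1 / (n + 1 : ℝ) ^ L|
      ≤ L ^ 2 * (1 + L * khintchineConst L) / (n + 1 : ℝ) ^ (L + 1) := by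
  set K : ℝ := 1 + L * khintchineConst L with hK
  have hN : (0 : ℝ) < n + 1 := by positivity
  have h1 : rowMoment μ t * (n + 1 : ℝ) ^ L - 1
      = ∑ t' : Fin L → Fin (n + 1) with ¬ Function.Injective t',
        (rowMoment μ t - rowMoment μ t') := by
    rw [Finset.sum_filter]
    have h2 : ∀ t' : Fin L → Fin (n + 1), (if ¬ Function.Injective t' then
        rowMoment μ t - rowMoment μ t' else 0) = rowMoment μ t - rowMoment μ t' := by
      intro t'
      split_ifs with h
      · rw [rowMoment_eq_of_injective μ ht h, sub_self]
      · rfl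
    rw [Finset.sum_congr rfl fun t' _ => h2 t', Finset.sum_sub_distrib, Finset.sum_const,
      Finset.card_univ, Fintype.card_fun, Fintype.card_fin, Fintype.card_fin, nsmul_eq_mul, mul_comm,
      sum_rowMoment]
    push_cast
    rfl
  have h2 : |rowMoment μ t * (n + 1 : ℝ) ^ L - 1| ≤ L ^ 2 * K / (n + 1) := by
    calc _ ≤ ∑ t' : Fin L → Fin (n + 1) with ¬ Function.Injective t',
          |rowMoment μ t - rowMoment μ t'| := by
          rw [h1]; exact Finset.abs_sum_le_sum_abs _ _
      _ ≤ ∑ t' : Fin L → Fin (n + 1) with ¬ Function.Injective t', K / (n + 1 : ℝ) ^ L := by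
          refine Finset.sum_le_sum fun t' _ => ?_
          rw [abs_le]
          constructor <;> linarith [rowMoment_nonneg μ t, rowMoment_nonneg μ t',
            rowMoment_le μ t, rowMoment_le μ t']
      _ = #{t' : Fin L → Fin (n + 1) | ¬ Function.Injective t'} * (K / (n + 1 : ℝ) ^ L) := by
          simp
      _ ≤ (L ^ 2 * (n + 1 : ℝ) ^ L / (n + 1)) * (K / (n + 1 : ℝ) ^ L) := by
          have h3 := card_mul_card_not_injective_le L (n + 1)
          push_cast at h3
          have h4 : (0 : ℝ) ≤ K := by
            have := khintchineConst_nonneg L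
            positivity
          gcongr
          rw [le_div_iff₀ hN]
          linarith
      _ = _ := by field_simp
  have h3 : rowMoment μ t - 1 / (n + 1 : ℝ) ^ L
      = (rowMoment μ t * (n + 1 : ℝ) ^ L - 1) / (n + 1 : ℝ) ^ L := by field_simp
  rw [h3, abs_div, abs_of_pos (pow_pos hN L), div_le_iff₀ (pow_pos hN L)]
  refine h2.trans (le_of_eq ?_)
  field_simp
  ring

theorem abs_sum_rowMoment_sub_mul_le {n L : ℕ}
    (μ : Measure (Matrix.unitaryGroup (Fin (n + 1)) ℂ))
    [IsProbabilityMeasure μ] [μ.IsMulLeftInvariant] [μ.IsMulRightInvariant]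
    (f : (Fin L → Fin (n + 1)) → ℝ) (g : Fin L → Fin (n + 1) → ℝ) (hg : ∀ c i, 0 ≤ g c i)
    (hf : ∀ t, |f t| ≤ ∑ c, g c (t c)) :
    |∑ t, (rowMoment μ t - 1 / (n + 1 : ℝ) ^ L) * f t|
      ≤ 2 * L ^ 2 * (1 + L * khintchineConst L) / (n + 1)
        * ∑ c, (1 / (n + 1 : ℝ)) * ∑ i, g c i := by
  set K : ℝ := 1 + L * khintchineConst L with hK
  have hK1 : 1 ≤ K := by
    have := khintchineConst_nonneg L
    rw [hK]
    nlinarith [show (0 : ℝ) ≤ L * khintchineConst L by positivity]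
  have hN : (0 : ℝ) < n + 1 := by positivity
  have hterm : ∀ t : Fin L → Fin (n + 1), |rowMoment μ t - 1 / (n + 1 : ℝ) ^ L|
      ≤ L ^ 2 * K / (n + 1 : ℝ) ^ (L + 1)
        + if ¬ Function.Injective t then K / (n + 1 : ℝ) ^ L else 0 := by
    intro t
    by_cases ht : Function.Injective t
    · rw [if_neg (not_not.2 ht), add_zero]
      exact abs_rowMoment_sub_le μ ht
    · rw [if_pos ht]
      have h1 : 1 / (n + 1 : ℝ) ^ L ≤ K / (n + 1 : ℝ) ^ L := by gcongr
      have h2 : 0 ≤ 1 / (n + 1 : ℝ) ^ L := by positivity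
      have h3 : 0 ≤ L ^ 2 * K / (n + 1 : ℝ) ^ (L + 1) := by positivity
      rw [abs_le]
      constructor <;> linarith [rowMoment_nonneg μ t, rowMoment_le μ t]
  have hc : ∀ c, ∑ t : Fin L → Fin (n + 1), (L ^ 2 * K / (n + 1 : ℝ) ^ (L + 1)
        + if ¬ Function.Injective t then K / (n + 1 : ℝ) ^ L else 0) * g c (t c)
      ≤ 2 * L ^ 2 * K / (n + 1) * ((1 / (n + 1 : ℝ)) * ∑ i, g c i) := by
    intro c
    have h1 := card_mul_sum_not_injective_le c (g c) (hg c)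
    have h2 := sum_apply_eq c (g c)
    push_cast at h1 h2
    set S := ∑ t : Fin L → Fin (n + 1), g c (t c)
    set T := ∑ t : Fin L → Fin (n + 1) with ¬ Function.Injective t, g c (t c) with hT
    have h3 : ∑ t : Fin L → Fin (n + 1), (L ^ 2 * K / (n + 1 : ℝ) ^ (L + 1)
        + if ¬ Function.Injective t then K / (n + 1 : ℝ) ^ L else 0) * g c (t c)
        = L ^ 2 * K / (n + 1 : ℝ) ^ (L + 1) * S + K / (n + 1 : ℝ) ^ L * T := by
      simp_rw [add_mul, ite_mul, zero_mul]
      rw [Finset.sum_add_distrib, ← Finset.mul_sum, ← Finset.sum_filter, ← Finset.mul_sum]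
    have h4 : T ≤ L ^ 2 * S / (n + 1) := by
      rw [le_div_iff₀ hN]
      linarith
    have h5 : ∑ i, g c i = (n + 1) * S / (n + 1 : ℝ) ^ L := by
      rw [h2]
      field_simp
    rw [h3, h5]
    calc _ ≤ L ^ 2 * K / (n + 1 : ℝ) ^ (L + 1) * S
          + K / (n + 1 : ℝ) ^ L * (L ^ 2 * S / (n + 1)) := by gcongr
      _ = _ := by
        field_simp
        ring
  calc |∑ t, (rowMoment μ t - 1 / (n + 1 : ℝ) ^ L) * f t|
      ≤ ∑ t, (L ^ 2 * K / (n + 1 : ℝ) ^ (L + 1)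
        + if ¬ Function.Injective t then K / (n + 1 : ℝ) ^ L else 0) * ∑ c, g c (t c) := by
        refine (Finset.abs_sum_le_sum_abs _ _).trans (Finset.sum_le_sum fun t _ => ?_)
        rw [abs_mul]
        exact mul_le_mul (hterm t) (hf t) (abs_nonneg _) ((abs_nonneg _).trans (hterm t))
    _ = ∑ c, ∑ t : Fin L → Fin (n + 1), (L ^ 2 * K / (n + 1 : ℝ) ^ (L + 1)
        + if ¬ Function.Injective t then K / (n + 1 : ℝ) ^ L else 0) * g c (t c) := by
        simp_rw [Finset.mul_sum]
        exact Finset.sum_comm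
    _ ≤ ∑ c, 2 * L ^ 2 * K / (n + 1) * ((1 / (n + 1 : ℝ)) * ∑ i, g c i) :=
        Finset.sum_le_sum fun c _ => hc c
    _ = _ := by rw [Finset.mul_sum]

theorem integrable_prod_pow {Ω : Type*} [MeasurableSpace Ω] {Pr : Measure Ω}
    [IsProbabilityMeasure Pr] {n L : ℕ} {D : Ω → Fin (n + 1) → ℝ} (hD : Measurable D)
    (hDint : ∀ i m, Integrable (fun ω => |D ω i| ^ m) Pr) (j : Fin L → ℕ)
    (t : Fin L → Fin (n + 1)) : Integrable (fun ω => ∏ a, D ω (t a) ^ j a) Pr := by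
  rcases Nat.eq_zero_or_pos L with rfl | hL
  · simp
  have hDm : ∀ i, Measurable fun ω => D ω i := fun i => (measurable_pi_apply i).comp hD
  refine Integrable.mono' (integrable_finsetSum univ fun a _ => hDint (t a) (j a * L))
    (Finset.measurable_fun_prod _ fun a _ => (hDm (t a)).pow_const _).aestronglyMeasurable
    (Filter.Eventually.of_forall fun ω => ?_)
  rw [norm_prod]
  refine (prod_le_sum_pow hL _ fun a => norm_nonneg _).trans (le_of_eq ?_)
  simp [pow_mul]

theorem abs_integral_prod_pow_le {Ω : Type*} [MeasurableSpace Ω] {Pr : Measure Ω}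
    {n L : ℕ} (hL : 1 ≤ L) {D : Ω → Fin (n + 1) → ℝ}
    (hDint : ∀ i m, Integrable (fun ω => |D ω i| ^ m) Pr) (j : Fin L → ℕ)
    (t : Fin L → Fin (n + 1)) :
    |∫ ω, ∏ a, D ω (t a) ^ j a ∂Pr| ≤ ∑ c, ∫ ω, |D ω (t c)| ^ (j c * L) ∂Pr := by
  rw [← integral_finsetSum _ fun c _ => hDint (t c) (j c * L), ← Real.norm_eq_abs]
  refine norm_integral_le_of_norm_le (integrable_finsetSum _ fun c _ => hDint (t c) (j c * L))
    (Filter.Eventually.of_forall fun ω => ?_)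
  rw [norm_prod]
  refine (prod_le_sum_pow hL _ fun a => norm_nonneg _).trans (le_of_eq ?_)
  simp [pow_mul]

/-- Conjugating by an independent Haar unitary, joint moments of the diagonal entries
`∑ i, |U_{N i}|² D_i ^ j` agree up to `O(1 / N)` with those of the normalized power sums of `D`. -/
theorem abs_integral_prod_rowWeight_sub_le {Ω : Type*} [MeasurableSpace Ω] {Pr : Measure Ω}
    [IsProbabilityMeasure Pr] {n : ℕ} {U : Ω → Matrix (Fin (n + 1)) (Fin (n + 1)) ℂ}
    {D : Ω → Fin (n + 1) → ℝ} (hU : Measurable U) (hD : Measurable D)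
    (hUuni : ∀ ω, U ω ∈ Matrix.unitaryGroup (Fin (n + 1)) ℂ)
    (hHaar : (Measure.map (fun ω => (⟨U ω, hUuni ω⟩ : Matrix.unitaryGroup (Fin (n + 1)) ℂ))
      Pr).IsMulLeftInvariant)
    (hindep : IndepFun U D Pr) (hDint : ∀ i m, Integrable (fun ω => |D ω i| ^ m) Pr)
    {L : ℕ} (j : Fin L → ℕ) :
    Integrable (fun ω => ∏ a, ∑ i, rowWeight (U ω) i * D ω i ^ j a) Pr ∧
    Integrable (fun ω => ∏ a, (1 / (n + 1 : ℝ)) * ∑ i, D ω i ^ j a) Pr ∧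
    |(∫ ω, ∏ a, ∑ i, rowWeight (U ω) i * D ω i ^ j a ∂Pr)
        - ∫ ω, ∏ a, (1 / (n + 1 : ℝ)) * ∑ i, D ω i ^ j a ∂Pr|
      ≤ 2 * L ^ 2 * (1 + L * khintchineConst L) / (n + 1)
        * ∑ c, (1 / (n + 1 : ℝ)) * ∑ i, ∫ ω, |D ω i| ^ (j c * L) ∂Pr := by
  have hUm : Measurable (fun ω => (⟨U ω, hUuni ω⟩ : Matrix.unitaryGroup (Fin (n + 1)) ℂ)) :=
    hU.subtype_mk
  set μ := Measure.map (fun ω => (⟨U ω, hUuni ω⟩ : Matrix.unitaryGroup (Fin (n + 1)) ℂ)) Pr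
    with hμ
  have hprob : IsProbabilityMeasure μ := Measure.isProbabilityMeasure_map hUm.aemeasurable
  have hright : μ.IsMulRightInvariant := isMulRightInvariant_of_isProbabilityMeasure μ
  have hw : ∀ t : Fin L → Fin (n + 1), ∫ ω, ∏ a, rowWeight (U ω) (t a) ∂Pr = rowMoment μ t := by
    intro t
    have hm : Measurable (fun g : Matrix.unitaryGroup (Fin (n + 1)) ℂ =>
        ∏ a, rowWeight (g : Matrix (Fin (n + 1)) (Fin (n + 1)) ℂ) (t a)) :=
      (measurable_prod_rowWeight t).comp measurable_subtype_coe
    rw [rowMoment, hμ, integral_map hUm.aemeasurable hm.aestronglyMeasurable]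
  have hwint : ∀ t : Fin L → Fin (n + 1),
      Integrable (fun ω => ∏ a, rowWeight (U ω) (t a)) Pr := fun t =>
    Integrable.of_bound ((measurable_prod_rowWeight t).comp hU).aestronglyMeasurable 1
      (Filter.Eventually.of_forall fun ω => norm_prod_rowWeight_le (hUuni ω) t)
  have hf := integrable_prod_pow hD hDint j
  have hind : ∀ t : Fin L → Fin (n + 1), IndepFun (fun ω => ∏ a, rowWeight (U ω) (t a))
      (fun ω => ∏ a, D ω (t a) ^ j a) Pr := fun t =>
    hindep.comp (φ := fun A => ∏ a, rowWeight A (t a))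
      (ψ := fun d : Fin (n + 1) → ℝ => ∏ a, d (t a) ^ j a) (measurable_prod_rowWeight t)
      (Finset.measurable_fun_prod _ fun a _ => (measurable_pi_apply (t a)).pow_const _)
  have hexp1 : ∀ ω, ∏ a, ∑ i, rowWeight (U ω) i * D ω i ^ j a
      = ∑ t : Fin L → Fin (n + 1), (∏ a, rowWeight (U ω) (t a)) * ∏ a, D ω (t a) ^ j a := by
    intro ω
    rw [Fintype.prod_sum]
    simp_rw [Finset.prod_mul_distrib]
  have hexp2 : ∀ ω, ∏ a, (1 / (n + 1 : ℝ)) * ∑ i, D ω i ^ j a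
      = ∑ t : Fin L → Fin (n + 1), (1 / (n + 1 : ℝ) ^ L) * ∏ a, D ω (t a) ^ j a := by
    intro ω
    rw [Finset.prod_mul_distrib, Fintype.prod_sum, ← Finset.mul_sum]
    simp
  have hint1 : ∀ t : Fin L → Fin (n + 1), Integrable
      (fun ω => (∏ a, rowWeight (U ω) (t a)) * ∏ a, D ω (t a) ^ j a) Pr := fun t =>
    (hind t).integrable_mul (hwint t) (hf t)
  have hint2 : ∀ t : Fin L → Fin (n + 1), Integrable
      (fun ω => (1 / (n + 1 : ℝ) ^ L) * ∏ a, D ω (t a) ^ j a) Pr := fun t => (hf t).const_mul _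
  simp_rw [hexp1, hexp2]
  refine ⟨integrable_finsetSum _ fun t _ => hint1 t, integrable_finsetSum _ fun t _ => hint2 t, ?_⟩
  rw [integral_finsetSum _ fun t _ => hint1 t, integral_finsetSum _ fun t _ => hint2 t,
    ← Finset.sum_sub_distrib]
  have hterm : ∀ t : Fin L → Fin (n + 1),
      (∫ ω, (∏ a, rowWeight (U ω) (t a)) * ∏ a, D ω (t a) ^ j a ∂Pr)
        - ∫ ω, (1 / (n + 1 : ℝ) ^ L) * ∏ a, D ω (t a) ^ j a ∂Pr
      = (rowMoment μ t - 1 / (n + 1 : ℝ) ^ L) * ∫ ω, ∏ a, D ω (t a) ^ j a ∂Pr := by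
    intro t
    rw [(hind t).integral_fun_mul_eq_mul_integral (hwint t).aestronglyMeasurable
      (hf t).aestronglyMeasurable, hw, integral_const_mul, sub_mul]
  rw [Finset.sum_congr rfl fun t _ => hterm t]
  rcases Nat.eq_zero_or_pos L with rfl | hL
  · simp [rowMoment]
  · exact abs_sum_rowMoment_sub_mul_le μ _ (fun c i => ∫ ω, |D ω i| ^ (j c * L) ∂Pr)
      (fun c i => integral_nonneg fun ω => by positivity)
      fun t => abs_integral_prod_pow_le hL hDint j t

theorem exists_prod_eq_prod_fin (u : ℕ →₀ ℕ) :
    ∃ (L : ℕ) (j : Fin L → ℕ), ∀ f : ℕ → ℝ, (u.prod fun i e => f i ^ e) = ∏ a, f (j a) := by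
  induction u using Finsupp.induction_linear with
  | zero => exact ⟨0, Fin.elim0, fun f => by simp⟩
  | add u v hu hv =>
    obtain ⟨L, j, h⟩ := hu
    obtain ⟨L', j', h'⟩ := hv
    refine ⟨L + L', Fin.append j j', fun f => ?_⟩
    rw [Finsupp.prod_add_index' (fun _ => pow_zero _) (fun _ _ _ => pow_add _ _ _), h, h',
      Fin.prod_univ_add]
    simp
  | single i e => exact ⟨e, fun _ => i, fun f => by simp⟩

/-- Comparing all mixed moments of two families up to `O(1 / n)` compares the expectations of
all polynomials in them. -/
theorem exists_abs_integral_eval_sub_le {Ω : Type*} [MeasurableSpace Ω] {Pr : Measure Ω}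
    [IsProbabilityMeasure Pr] {Y Z : ℕ → ℕ → Ω → ℝ}
    (h : ∀ (L : ℕ) (j : Fin L → ℕ), ∃ C : ℝ, ∀ n : ℕ,
      Integrable (fun ω => ∏ a, Y n (j a) ω) Pr ∧ Integrable (fun ω => ∏ a, Z n (j a) ω) Pr ∧
      |(∫ ω, ∏ a, Y n (j a) ω ∂Pr) - ∫ ω, ∏ a, Z n (j a) ω ∂Pr| ≤ C / (n + 1))
    (q : MvPolynomial ℕ ℝ) : ∃ C : ℝ, ∀ n : ℕ,
      Integrable (fun ω => MvPolynomial.eval (fun j => Y n j ω) q) Pr ∧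
      Integrable (fun ω => MvPolynomial.eval (fun j => Z n j ω) q) Pr ∧
      |(∫ ω, MvPolynomial.eval (fun j => Y n j ω) q ∂Pr)
        - ∫ ω, MvPolynomial.eval (fun j => Z n j ω) q ∂Pr| ≤ C / (n + 1) := by
  induction q using MvPolynomial.induction_on' with
  | monomial u x =>
    obtain ⟨L, j, hj⟩ := exists_prod_eq_prod_fin u
    obtain ⟨C, hC⟩ := h L j
    refine ⟨|x| * C, fun n => ?_⟩
    obtain ⟨h1, h2, h3⟩ := hC n
    simp_rw [MvPolynomial.eval_monomial, hj]
    refine ⟨h1.const_mul x, h2.const_mul x, ?_⟩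
    rw [integral_const_mul, integral_const_mul, ← mul_sub, abs_mul, mul_div_assoc]
    exact mul_le_mul_of_nonneg_left h3 (abs_nonneg x)
  | add p q hp hq =>
    obtain ⟨C, hC⟩ := hp
    obtain ⟨C', hC'⟩ := hq
    refine ⟨C + C', fun n => ?_⟩
    obtain ⟨h1, h2, h3⟩ := hC n
    obtain ⟨h1', h2', h3'⟩ := hC' n
    simp_rw [map_add]
    refine ⟨h1.add h1', h2.add h2', ?_⟩
    rw [integral_add h1 h1', integral_add h2 h2', add_sub_add_comm, add_div]
    exact (abs_add_le _ _).trans (add_le_add h3 h3')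

theorem unitary_conj_pow {n : ℕ} {V : Matrix (Fin n) (Fin n) ℂ}
    (hV : V ∈ Matrix.unitaryGroup (Fin n) ℂ) (d : Fin n → ℝ) (k : ℕ) :
    (V * Matrix.diagonal (fun i => (d i : ℂ)) * star V) ^ k
      = V * Matrix.diagonal (fun i => ((d i ^ k : ℝ) : ℂ)) * star V := by
  induction k with
  | zero =>
    have h : (fun i => ((d i ^ 0 : ℝ) : ℂ)) = 1 := by
      ext i
      simp
    rw [h, Matrix.diagonal_one', mul_one, pow_zero, Matrix.mem_unitaryGroup_iff.1 hV]
  | succ k ih =>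
    have h : (fun i => ((d i ^ (k + 1) : ℝ) : ℂ)) = fun i => ((d i ^ k : ℝ) : ℂ) * (d i : ℂ) := by
      ext i
      push_cast
      ring
    rw [pow_succ, ih, h, ← Matrix.diagonal_mul_diagonal]
    calc _ = V * Matrix.diagonal (fun i => ((d i ^ k : ℝ) : ℂ)) * (star V * V)
          * Matrix.diagonal (fun i => (d i : ℂ)) * star V := by simp only [mul_assoc]
      _ = _ := by rw [Matrix.mem_unitaryGroup_iff'.1 hV, mul_one]; simp only [mul_assoc]

theorem trace_unitary_conj_pow {n : ℕ} {V : Matrix (Fin n) (Fin n) ℂ}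
    (hV : V ∈ Matrix.unitaryGroup (Fin n) ℂ) (d : Fin n → ℝ) (k : ℕ) :
    ((V * Matrix.diagonal (fun i => (d i : ℂ)) * star V) ^ k).trace = ((∑ i, d i ^ k : ℝ) : ℂ) := by
  rw [unitary_conj_pow hV, Matrix.trace_mul_comm, ← mul_assoc, Matrix.mem_unitaryGroup_iff'.1 hV,
    one_mul, Matrix.trace_diagonal]
  push_cast
  rfl

theorem unitary_conj_pow_apply_last {n : ℕ} {V : Matrix (Fin (n + 1)) (Fin (n + 1)) ℂ}
    (hV : V ∈ Matrix.unitaryGroup (Fin (n + 1)) ℂ) (d : Fin (n + 1) → ℝ) (k : ℕ) :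
    ((V * Matrix.diagonal (fun i => (d i : ℂ)) * star V) ^ k) (Fin.last n) (Fin.last n)
      = ((∑ i, rowWeight V i * d i ^ k : ℝ) : ℂ) := by
  rw [unitary_conj_pow hV, Matrix.mul_apply]
  push_cast
  refine Finset.sum_congr rfl fun i _ => ?_
  rw [Matrix.mul_diagonal, Matrix.star_apply, rowWeight, ← Complex.mul_conj]
  rw [starRingEnd_apply]
  ring

theorem abs_pow_le_one_add (x : ℝ) (m : ℕ) : |x| ^ m ≤ 1 + x ^ (2 * m) := by
  rw [mul_comm, pow_mul, ← sq_abs (x ^ m), abs_pow]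
  nlinarith [sq_nonneg (|x| ^ m - 1), sq_nonneg (|x| ^ m)]

theorem integrable_abs_pow_of_powerSum {Ω : Type*} [MeasurableSpace Ω] {Pr : Measure Ω}
    [IsProbabilityMeasure Pr] {n : ℕ} {D : Ω → Fin (n + 1) → ℝ} (hD : Measurable D)
    (hint : ∀ m, Integrable (fun ω => (1 / (n + 1 : ℝ)) * ∑ i, D ω i ^ m) Pr)
    (i : Fin (n + 1)) (m : ℕ) : Integrable (fun ω => |D ω i| ^ m) Pr := by
  refine Integrable.mono' ((integrable_const 1).add ((hint (2 * m)).const_mul (n + 1 : ℝ)))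
    (((measurable_pi_apply i).comp hD).abs.pow_const m).aestronglyMeasurable
    (Filter.Eventually.of_forall fun ω => ?_)
  rw [Real.norm_of_nonneg (by positivity), Pi.add_apply, ← mul_assoc, mul_one_div_cancel (by positivity),
    one_mul]
  refine (abs_pow_le_one_add _ m).trans (add_le_add_right ?_ 1)
  exact Finset.single_le_sum (f := fun i => D ω i ^ (2 * m))
    (fun l _ => (even_two_mul m).pow_nonneg _) (Finset.mem_univ i)

theorem average_integral_abs_pow_le {Ω : Type*} [MeasurableSpace Ω] {Pr : Measure Ω}
    [IsProbabilityMeasure Pr] {n : ℕ} {D : Ω → Fin (n + 1) → ℝ} (hD : Measurable D)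
    (hint : ∀ m, Integrable (fun ω => (1 / (n + 1 : ℝ)) * ∑ i, D ω i ^ m) Pr) (m : ℕ) :
    (1 / (n + 1 : ℝ)) * ∑ i, ∫ ω, |D ω i| ^ m ∂Pr
      ≤ 1 + ∫ ω, (1 / (n + 1 : ℝ)) * ∑ i, D ω i ^ (2 * m) ∂Pr := by
  have hDint := integrable_abs_pow_of_powerSum hD hint
  have h1 : 1 + ∫ ω, (1 / (n + 1 : ℝ)) * ∑ i, D ω i ^ (2 * m) ∂Pr
      = ∫ ω, (1 + (1 / (n + 1 : ℝ)) * ∑ i, D ω i ^ (2 * m)) ∂Pr := by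
    rw [integral_add (integrable_const _) (hint (2 * m))]
    simp
  rw [← integral_finsetSum _ fun i _ => hDint i m, ← integral_const_mul, h1]
  refine integral_mono ((integrable_finsetSum _ fun i _ => hDint i m).const_mul _)
    ((integrable_const 1).add (hint (2 * m))) fun ω => ?_
  have h2 : ∑ i, |D ω i| ^ m ≤ (n + 1) + ∑ i, D ω i ^ (2 * m) := by
    refine (Finset.sum_le_sum fun i _ => abs_pow_le_one_add (D ω i) m).trans (le_of_eq ?_)
    simp [Finset.sum_add_distrib]
  calc (1 / (n + 1 : ℝ)) * ∑ i, |D ω i| ^ m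
      ≤ (1 / (n + 1 : ℝ)) * ((n + 1) + ∑ i, D ω i ^ (2 * m)) := by gcongr
    _ = 1 + (1 / (n + 1 : ℝ)) * ∑ i, D ω i ^ (2 * m) := by
      rw [mul_add, one_div_mul_cancel (by positivity)]

/-- In the setting of the rotationally invariant Hermitian random
matrices `X_N = U_N D_N U_N^*` (with `U_N` Haar unitary, `D_N` independent diagonal),
with `Mκ n k` the moments of the Rayleigh measure `κ_N` and `fc n` the free cumulants
of the empirical eigenvalue distribution `m_N`, and assuming
`sup_N E[M_k(m_N)] < ∞` for all even `k`, for every `k ≥ 1`: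
`E[M_k(κ_N)²] = Σ_{ρ₁,ρ₂ ∈ NC(k)} |K(ρ₁)|·|K(ρ₂)|·E[fc_{ρ₁}(m_N) fc_{ρ₂}(m_N)] + O(1/N)`,
where `K(ρ)` is the Kreweras complement of `ρ`. -/
theorem statement6
    {Ω : Type} [MeasurableSpace Ω] (Pr : Measure Ω) [IsProbabilityMeasure Pr]
    (U : (n : ℕ) → Ω → Matrix (Fin (n + 1)) (Fin (n + 1)) ℂ)
    (D : (n : ℕ) → Ω → (Fin (n + 1) → ℝ))
    (hUmeas : ∀ n, Measurable (U n))
    (hDmeas : ∀ n, Measurable (D n))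
    (hUuni : ∀ n ω, U n ω ∈ Matrix.unitaryGroup (Fin (n + 1)) ℂ)
    -- `U_N` is Haar distributed on the unitary group:
    (hHaar : ∀ n, (Measure.map
      (fun ω => (⟨U n ω, hUuni n ω⟩ : Matrix.unitaryGroup (Fin (n + 1)) ℂ)) Pr).IsHaarMeasure)
    -- `D_N` is independent of `U_N`:
    (hindep : ∀ n, IndepFun (U n) (D n) Pr)
    (X : (n : ℕ) → Ω → Matrix (Fin (n + 1)) (Fin (n + 1)) ℂ)
    (hX : ∀ n ω, X n ω = U n ω * Matrix.diagonal (fun i => (D n ω i : ℂ)) * star (U n ω))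
    -- the ordered eigenvalues `λ_1 ≤ ⋯ ≤ λ_N` of `X_N`:
    (lam : (n : ℕ) → Ω → (Fin (n + 1) → ℝ))
    (hlam_mono : ∀ n ω, Monotone (lam n ω))
    (hlam_eig : ∀ n ω, ∃ V ∈ Matrix.unitaryGroup (Fin (n + 1)) ℂ,
      X n ω = V * Matrix.diagonal (fun i => (lam n ω i : ℂ)) * star V)
    -- the ordered eigenvalues `λ̃_1 ≤ ⋯ ≤ λ̃_{N−1}` of the principal submatrix:
    (lamt : (n : ℕ) → Ω → (Fin n → ℝ))
    (hlamt_mono : ∀ n ω, Monotone (lamt n ω))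
    (hlamt_eig : ∀ n ω, ∃ V ∈ Matrix.unitaryGroup (Fin n) ℂ,
      (X n ω).submatrix Fin.castSucc Fin.castSucc
        = V * Matrix.diagonal (fun j => (lamt n ω j : ℂ)) * star V)
    -- the moments of the empirical eigenvalue distribution `m_N`:
    (Mm : ℕ → ℕ → Ω → ℝ)
    (hMm : ∀ n k ω, Mm n k ω = (1 / (n + 1 : ℝ)) * ∑ i, lam n ω i ^ k)
    (hint : ∀ n k, Integrable (Mm n k) Pr)
    -- `sup_{N ≥ 1} E[M_k(m_N)] < ∞` for every even `k`:
    (hsup : ∀ k : ℕ, Even k → ∃ C : ℝ, ∀ n, (∫ ω, Mm n k ω ∂Pr) ≤ C)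
    -- the free cumulants of `m_N`, characterized by the moment–cumulant formula:
    (fc : ℕ → ℕ → Ω → ℝ)
    (hfc : ∀ n, ∀ k : ℕ, 1 ≤ k → ∀ ω,
      Mm n k ω = ∑ ρ ∈ NCFinset k, ∏ B ∈ ρ, fc n B.card ω)
    -- the moments of the Rayleigh measure `κ_N`:
    (Mκ : ℕ → ℕ → Ω → ℝ)
    (hMκ : ∀ n k ω, Mκ n k ω = (∑ i, lam n ω i ^ k) - ∑ j, lamt n ω j ^ k)
    (k : ℕ) (hk : 1 ≤ k)
    -- the Kreweras complement `K(ρ)` of each `ρ ∈ NC(k)`: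
    (Kc : Finset (Finset ℕ) → Finset (Finset ℕ))
    (hKc : ∀ ρ ∈ NCFinset k, IsKrewerasOn (Finset.Icc 1 k) ρ (Kc ρ)) :
    ∃ C : ℝ, ∀ n : ℕ,
      |(∫ ω, (Mκ n k ω) ^ 2 ∂Pr)
          - ∑ ρ₁ ∈ NCFinset k, ∑ ρ₂ ∈ NCFinset k,
              ((Kc ρ₁).card : ℝ) * ((Kc ρ₂).card : ℝ)
                * ∫ ω, (∏ B ∈ ρ₁, fc n B.card ω) * (∏ B ∈ ρ₂, fc n B.card ω) ∂Pr|
        ≤ C / (n + 1) := by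
  have hDX : ∀ n j ω, ∑ i, lam n ω i ^ j = ∑ i, D n ω i ^ j := by
    intro n j ω
    obtain ⟨V, hV, hVX⟩ := hlam_eig n ω
    have h := trace_unitary_conj_pow hV (lam n ω) j
    rw [← hVX, hX n ω, trace_unitary_conj_pow (hUuni n ω)] at h
    exact_mod_cast h.symm
  have hMmD : ∀ n j ω, Mm n j ω = (1 / (n + 1 : ℝ)) * ∑ i, D n ω i ^ j := fun n j ω => by
    rw [hMm, hDX]
  have hMm0 : ∀ n ω, Mm n 0 ω = 1 := fun n ω => by
    rw [hMmD]
    simp only [pow_zero, Finset.sum_const, Finset.card_univ, Fintype.card_fin, nsmul_eq_mul,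
      mul_one]
    push_cast
    exact one_div_mul_cancel (by positivity)
  have hncM : ∀ n j ω, Mm n j ω = ncMoment (fun b => fc n b ω) j := by
    intro n j ω
    rcases Nat.eq_zero_or_pos j with rfl | hj
    · rw [hMm0, ncMoment_zero]
    · exact hfc n j hj ω
  have hintD : ∀ n m : ℕ, Integrable (fun ω => (1 / (n + 1 : ℝ)) * ∑ i, D n ω i ^ m) Pr :=
    fun n m => (hint n m).congr (Filter.Eventually.of_forall (hMmD n m))
  have hDint : ∀ n i m, Integrable (fun ω => |D n ω i| ^ m) Pr :=
    fun n => integrable_abs_pow_of_powerSum (hDmeas n) (hintD n)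
  have hDbound : ∀ m, ∃ C : ℝ, ∀ n : ℕ,
      (1 / (n + 1 : ℝ)) * ∑ i, ∫ ω, |D n ω i| ^ m ∂Pr ≤ C := by
    intro m
    obtain ⟨C, hC⟩ := hsup (2 * m) (even_two_mul m)
    refine ⟨1 + C, fun n => ?_⟩
    refine (average_integral_abs_pow_le (hDmeas n) (hintD n) m).trans
      (add_le_add_right ((le_of_eq ?_).trans (hC n)) 1)
    simp only [hMmD]
  have hmix : ∀ (L : ℕ) (j : Fin L → ℕ), ∃ C : ℝ, ∀ n : ℕ,
      Integrable (fun ω => ∏ a, ∑ i, rowWeight (U n ω) i * D n ω i ^ j a) Pr ∧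
      Integrable (fun ω => ∏ a, Mm n (j a) ω) Pr ∧
      |(∫ ω, ∏ a, ∑ i, rowWeight (U n ω) i * D n ω i ^ j a ∂Pr)
        - ∫ ω, ∏ a, Mm n (j a) ω ∂Pr| ≤ C / (n + 1) := by
    intro L j
    choose C hC using hDbound
    refine ⟨2 * L ^ 2 * (1 + L * khintchineConst L) * ∑ c, C (j c * L), fun n => ?_⟩
    obtain ⟨h1, h2, h3⟩ := abs_integral_prod_rowWeight_sub_le (hUmeas n) (hDmeas n) (hUuni n)
      (hHaar n).toIsMulLeftInvariant (hindep n) (hDint n) j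
    simp only [hMmD]
    refine ⟨h1, h2, h3.trans ?_⟩
    have hK := khintchineConst_nonneg L
    rw [div_mul_eq_mul_div]
    gcongr with c
    exact hC (j c * L) n
  have hpoly := exists_abs_integral_eval_sub_le
    (Y := fun n j ω => ∑ i, rowWeight (U n ω) i * D n ω i ^ j) (Z := Mm) hmix
  obtain ⟨p, hp⟩ := exists_mvPolynomial_newton k hk
  have hκ : ∀ n ω, Mκ n k ω
      = MvPolynomial.eval (fun j => ∑ i, rowWeight (U n ω) i * D n ω i ^ j) p := by
    intro n ω
    refine hp (fun j => ∑ i, rowWeight (U n ω) i * D n ω i ^ j) (fun l => Mκ n l ω) ?_ fun l _ => ?_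
    · simpa using sum_rowWeight (hUuni n ω)
    · obtain ⟨V, hV, hVX⟩ := hlam_eig n ω
      obtain ⟨W, hW, hWX⟩ := hlamt_eig n ω
      have htr : ∀ l, (X n ω ^ l).trace = ((∑ i, lam n ω i ^ l : ℝ) : ℂ) := fun l => by
        rw [hVX, trace_unitary_conj_pow hV]
      have h := Matrix.sum_pow_last_mul_trace_sub (X n ω) l
      simp only [htr, hWX, trace_unitary_conj_pow hW] at h
      simp only [hX, unitary_conj_pow_apply_last (hUuni n ω)] at h
      simp only [hMκ]
      exact_mod_cast h
  have hgap : ∀ n ω, ncGapMoment (fun b => fc n b ω) k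
      = MvPolynomial.eval (fun j => Mm n j ω) p := fun n ω =>
    hp _ (ncGapMoment fun b => fc n b ω) (hMm0 n ω) fun l _ => by
      simpa only [hncM] using sum_ncMoment_mul_ncGapMoment (fun b => fc n b ω) l
  have hsum : ∀ n ω, ∑ ρ ∈ NCFinset k, ((Kc ρ).card : ℝ) * ∏ B ∈ ρ, fc n B.card ω
      = MvPolynomial.eval (fun j => Mm n j ω) p := by
    intro n ω
    rw [← hgap]
    exact Finset.sum_congr rfl fun ρ hρ => by rw [(hKc ρ hρ).card_eq]; rfl
  have hblock : ∀ ρ ∈ NCFinset k, ∃ q : MvPolynomial ℕ ℝ, ∀ n ω,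
      ∏ B ∈ ρ, fc n B.card ω = MvPolynomial.eval (fun j => Mm n j ω) q := by
    intro ρ hρ
    choose! r hr using exists_mvPolynomial_freeCumulant
    refine ⟨∏ B ∈ ρ, r B.card, fun n ω => ?_⟩
    rw [map_prod]
    exact Finset.prod_congr rfl fun B hB =>
      hr B.card (((mem_ncPartitions.1 hρ).1.1 B hB).card_pos) (fun j => Mm n j ω)
        (fun b => fc n b ω) fun l _ => hncM n l ω
  have hfcint : ∀ n, ∀ ρ₁ ∈ NCFinset k, ∀ ρ₂ ∈ NCFinset k, Integrable
      (fun ω => (∏ B ∈ ρ₁, fc n B.card ω) * ∏ B ∈ ρ₂, fc n B.card ω) Pr := by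
    intro n ρ₁ h₁ ρ₂ h₂
    obtain ⟨q₁, hq₁⟩ := hblock ρ₁ h₁
    obtain ⟨q₂, hq₂⟩ := hblock ρ₂ h₂
    obtain ⟨C, hC⟩ := hpoly (q₁ * q₂)
    simpa only [hq₁, hq₂, map_mul] using (hC n).2.1
  obtain ⟨C, hC⟩ := hpoly (p ^ 2)
  refine ⟨C, fun n => ?_⟩
  have hrhs : ∑ ρ₁ ∈ NCFinset k, ∑ ρ₂ ∈ NCFinset k, ((Kc ρ₁).card : ℝ) * ((Kc ρ₂).card : ℝ)
        * ∫ ω, (∏ B ∈ ρ₁, fc n B.card ω) * (∏ B ∈ ρ₂, fc n B.card ω) ∂Pr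
      = ∫ ω, MvPolynomial.eval (fun j => Mm n j ω) (p ^ 2) ∂Pr := by
    have hI : ∀ ρ₁ ∈ NCFinset k, ∀ ρ₂ ∈ NCFinset k, Integrable (fun ω =>
        (((Kc ρ₁).card : ℝ) * ∏ B ∈ ρ₁, fc n B.card ω)
          * (((Kc ρ₂).card : ℝ) * ∏ B ∈ ρ₂, fc n B.card ω)) Pr := fun ρ₁ h₁ ρ₂ h₂ =>
      ((hfcint n ρ₁ h₁ ρ₂ h₂).const_mul (((Kc ρ₁).card : ℝ) * (Kc ρ₂).card)).congr
        (Filter.Eventually.of_forall fun ω => mul_mul_mul_comm _ _ _ _)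
    simp_rw [map_pow, ← hsum, sq, Finset.sum_mul_sum]
    rw [integral_finsetSum _ fun ρ₁ h₁ => integrable_finsetSum _ fun ρ₂ h₂ => hI ρ₁ h₁ ρ₂ h₂]
    refine Finset.sum_congr rfl fun ρ₁ h₁ => ?_
    rw [integral_finsetSum _ fun ρ₂ h₂ => hI ρ₁ h₁ ρ₂ h₂]
    refine Finset.sum_congr rfl fun ρ₂ h₂ => ?_
    rw [← integral_const_mul]
    simp_rw [mul_mul_mul_comm]
  rw [hrhs]
  simp_rw [hκ]
  simpa only [map_pow] using (hC n).2.2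
end

section
/- For each N ≥ 1, let X_N = U_N D_N U_N^* be an N×N Hermitian random matrix, where U_N is Haar-distributed on the unitary group U(N) and D_N is a random real diagonal matrix independent of U_N. Let λ_1^{(N)} ≤ ⋯ ≤ λ_N^{(N)} be the eigenvalues of X_N, let m_N = (1/N) Σ_{i=1}^N δ_{λ_i^{(N)}} be the empirical eigenvalue distribution, and let λ̃_1^{(N)} ≤ ⋯ ≤ λ̃_{N−1}^{(N)} be the eigenvalues of the principal submatrix X̃_N obtained by deleting the last row and column of X_N. Set M_k(κ_N) = Σ_{i=1}^N (λ_i^{(N)})^k − Σ_{j=1}^{N−1} (λ̃_j^{(N)})^k. Let m be a probability measure on ℝ with finite moments of all orders and let M_k(τ) denote the moments of the Rayleigh measure τ associated with m by the Markov–Krein correspondence. Assume: (i) sup_{N≥1} E[M_k(m_N)] < ∞ for every even k; and (ii) for every k ≥ 1 and every ε > 0, P(|M_k(m_N) − M_k(m)| ≥ ε) → 0 as N → ∞. Then for every k ≥ 1, E[(M_k(κ_N) − M_k(τ))^2] → 0 as N → ∞, i.e., M_k(κ_N) converges to M_k(τ) in L². -/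
open MeasureTheory ProbabilityTheory Finset
open scoped Classical

section MarkovKrein

open Matrix PowerSeries

variable {R : Type*} [CommRing R]

/-- If `b i j` satisfies the recursion of the entries of `X ^ i * W ^ j`, where `W` is `X` with a
row erased, then the sums of `b` over antidiagonals satisfy the Markov–Krein recursion. -/
theorem markovKrein_of_recursion (a : ℕ → R) (b : ℕ → ℕ → R) (M : ℕ → R)
    (ha : a 0 = 1) (hb0 : ∀ i, b i 0 = a i) (h0b : ∀ j, b 0 (j + 1) = 0)
    (hb : ∀ i j, b i (j + 1) = b (i + 1) j - a i * b 1 j)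
    (hM : ∀ k, M k = ∑ j ∈ range k, b (k - j) j) (k : ℕ) :
    M k = k * a k - ∑ r ∈ Ico 1 k, M r * a (k - r) := by
  have hbs : ∀ j i, b i j = a (i + j) - ∑ s ∈ range j, b 1 s * a (i + j - 1 - s) := by
    intro j
    induction j with
    | zero => intro i; simp [hb0]
    | succ j ih =>
      intro i
      rw [hb, ih (i + 1), sum_range_succ]
      have h1 : i + 1 + j = i + (j + 1) := by ring
      have h2 : i + (j + 1) - 1 - j = i := by omega
      rw [h1, h2]
      ring
  let A : R⟦X⟧ := .mk a
  let C : R⟦X⟧ := X * .mk (b 1)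
  let B : R⟦X⟧ := .mk fun n => n * a n
  have hAC : A * (1 - C) = 1 := by
    have hCA : A = 1 + C * A := by
      ext n
      cases n with
      | zero => simp [A, C, ha]
      | succ n =>
        have := hbs (n + 1) 0
        rw [h0b] at this
        rw [map_add, mul_assoc, coeff_succ_X_mul, coeff_mul,
          Nat.sum_antidiagonal_eq_sum_range_succ
            (fun p q => coeff p (PowerSeries.mk (b 1)) * coeff q A)]
        simp only [A, coeff_mk, coeff_one]
        simp only [zero_add, Nat.add_sub_cancel] at this
        simp only [Nat.add_eq_zero_iff, one_ne_zero, and_false, if_false, zero_add]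
        exact (sub_eq_zero.mp this.symm)
    linear_combination hCA
  have hMB : PowerSeries.mk M = (1 - C) * B := by
    ext n
    cases n with
    | zero => simp [B, C, hM]
    | succ n =>
      rw [sub_mul, one_mul, map_sub, mul_assoc, coeff_succ_X_mul, coeff_mul,
        Nat.sum_antidiagonal_eq_sum_range_succ
          (fun p q => coeff p (PowerSeries.mk (b 1)) * coeff q B)]
      simp only [B, coeff_mk, hM]
      have : ∀ j ∈ range (n + 1), b (n + 1 - j) j
          = a (n + 1) - ∑ s ∈ range (n + 1), if s < j then b 1 s * a (n - s) else 0 := by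
        intro j hj
        have hj := mem_range.mp hj
        rw [hbs, show n + 1 - j + j = n + 1 by omega, Nat.add_sub_cancel, ← sum_filter]
        congr 2
        ext s
        simp
        omega
      rw [sum_congr rfl this, sum_sub_distrib, sum_const, card_range, nsmul_eq_mul, sum_comm]
      congr 1
      refine sum_congr rfl fun s hs => ?_
      have hs := mem_range.mp hs
      rw [← sum_filter, sum_const, nsmul_eq_mul,
        show (range (n + 1)).filter (s < ·) = Ioo s (n + 1) by ext; simp; omega, Nat.card_Ioo,
        show n + 1 - s - 1 = n - s by omega]
      ring
  have hAM : A * PowerSeries.mk M = B := by rw [hMB, ← mul_assoc, hAC, one_mul]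
  have hk := congrArg (coeff k) hAM
  rw [mul_comm, coeff_mul, Nat.sum_antidiagonal_eq_sum_range_succ
    (fun p q => coeff p (PowerSeries.mk M) * coeff q A), sum_range_succ] at hk
  simp only [A, B, coeff_mk, Nat.sub_self, ha, mul_one] at hk
  rcases Nat.eq_zero_or_pos k with rfl | hk0
  · simp [hM]
  rw [range_eq_Ico, sum_eq_sum_Ico_succ_bot hk0, hM 0] at hk
  simp only [range_zero, sum_empty, zero_mul, zero_add] at hk
  rw [← hk]; ring

variable {ι : Type*} [Fintype ι] [DecidableEq ι]

theorem pow_sub_pow_eq_sum_mul {S : Type*} [Ring S] (x w : S) (k : ℕ) :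
    x ^ k - w ^ k = ∑ j ∈ range k, w ^ j * (x - w) * x ^ (k - 1 - j) := by
  induction k with
  | zero => simp
  | succ k ih =>
    rw [sum_range_succ, Nat.add_sub_cancel, Nat.sub_self, pow_zero, mul_one]
    have : ∀ j ∈ range k, w ^ j * (x - w) * x ^ (k - j)
        = w ^ j * (x - w) * x ^ (k - 1 - j) * x := by
      intro j hj
      have hj := mem_range.mp hj
      rw [mul_assoc _ _ x, ← pow_succ, show k - 1 - j + 1 = k - j by omega]
    rw [sum_congr rfl this, ← sum_mul, ← ih, pow_succ, pow_succ]
    noncomm_ring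

theorem trace_mul_single_mul (M N : Matrix ι ι R) (l : ι) :
    (M * single l l 1 * N).trace = (N * M) l l := by
  rw [Matrix.trace_mul_comm, ← mul_assoc, Matrix.trace_mul_single]
  simp

theorem mul_single_mul_apply (M N : Matrix ι ι R) (i j l : ι) :
    (M * single l l (1 : R) * N : Matrix ι ι R) i j = M i l * N l j := by
  simp [Matrix.mul_apply, Matrix.single_apply, Finset.sum_ite_eq, ite_and]

theorem trace_pow_sub_trace_pow_compression (X : Matrix ι ι R) (l : ι) (k : ℕ) :
    (X ^ k).trace - (((1 - single l l (1 : R)) * X) ^ k).trace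
      = ∑ j ∈ range k, (X ^ (k - j) * ((1 - single l l (1 : R)) * X) ^ j : Matrix ι ι R) l l := by
  rw [← trace_sub, pow_sub_pow_eq_sum_mul, trace_sum]
  refine sum_congr rfl fun j hj => ?_
  have hj := mem_range.mp hj
  rw [show X - (1 - single l l (1 : R)) * X = single l l 1 * X by noncomm_ring, ← mul_assoc,
    mul_assoc _ X, ← pow_succ', trace_mul_single_mul, show k - 1 - j + 1 = k - j by omega]

/-- The Markov–Krein recursion between the diagonal entries of the powers of a matrix and the
differences of power traces of the matrix and of its compression. -/
theorem trace_pow_sub_trace_pow_compression_recursion (X : Matrix ι ι R) (l : ι) (k : ℕ) :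
    (X ^ k).trace - (((1 - single l l (1 : R)) * X) ^ k).trace
      = k * (X ^ k) l l - ∑ r ∈ Ico 1 k,
        ((X ^ r).trace - (((1 - single l l (1 : R)) * X) ^ r).trace) * (X ^ (k - r)) l l := by
  refine markovKrein_of_recursion (fun n => (X ^ n) l l)
    (fun i j => (X ^ i * ((1 - single l l (1 : R)) * X) ^ j : Matrix ι ι R) l l)
    (fun n => (X ^ n).trace - (((1 - single l l (1 : R)) * X) ^ n).trace) ?_ ?_ ?_ ?_
    (trace_pow_sub_trace_pow_compression X l) k
  · simp
  · simp
  · intro j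
    rw [pow_succ', pow_zero, one_mul, mul_assoc, sub_mul, one_mul, Matrix.sub_apply]
    have := mul_single_mul_apply (1 : Matrix _ _ R) (X * ((1 - single l l (1 : R)) * X) ^ j) l l l
    simp only [one_mul, Matrix.one_apply_eq] at this
    rw [this, sub_self]
  · intro i j
    rw [pow_one, ← mul_single_mul_apply, ← Matrix.sub_apply, pow_succ' _ j, pow_succ X i]
    noncomm_ring

/-- The compression to the complement of the last index has the power traces of the principal
submatrix. -/
theorem trace_compression_last_pow {n : ℕ} (X : Matrix (Fin (n + 1)) (Fin (n + 1)) R) {k : ℕ}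
    (hk : k ≠ 0) :
    (((1 - single (Fin.last n) (Fin.last n) (1 : R)) * X) ^ k).trace
      = ((X.submatrix Fin.castSucc Fin.castSucc) ^ k).trace := by
  set W := (1 - single (Fin.last n) (Fin.last n) (1 : R)) * X with hW
  have hl : ∀ j, W (Fin.last n) j = 0 := by
    intro j
    have := mul_single_mul_apply (1 : Matrix _ _ R) X (Fin.last n) j (Fin.last n)
    simp only [one_mul, Matrix.one_apply_eq] at this
    rw [hW, sub_mul, one_mul, Matrix.sub_apply, this, sub_self]
  have hc : W.submatrix Fin.castSucc Fin.castSucc = X.submatrix Fin.castSucc Fin.castSucc := by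
    ext i j
    have := mul_single_mul_apply (1 : Matrix _ _ R) X i.castSucc j.castSucc (Fin.last n)
    rw [Matrix.one_apply_ne (Fin.castSucc_lt_last i).ne, zero_mul, one_mul] at this
    rw [submatrix_apply, submatrix_apply, hW, sub_mul, one_mul, Matrix.sub_apply, this, sub_zero]
  have hpow : ∀ k, (W ^ k).submatrix Fin.castSucc Fin.castSucc
      = (X.submatrix Fin.castSucc Fin.castSucc) ^ k := by
    intro k
    induction k with
    | zero => simp [Matrix.submatrix_one, Fin.castSucc_injective]
    | succ k ih =>
      rw [pow_succ (X.submatrix _ _), ← ih, ← hc]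
      ext i j
      simp [pow_succ, Matrix.mul_apply, Fin.sum_univ_castSucc, hl]
  rw [← hpow, Matrix.trace, Fin.sum_univ_castSucc]
  obtain ⟨k, rfl⟩ := Nat.exists_eq_succ_of_ne_zero hk
  simp [Matrix.trace, pow_succ' W k, Matrix.mul_apply, hl]

end MarkovKrein

section MomentConvergence

open Filter Topology
open scoped ENNReal NNReal

variable {Ω : Type*} [MeasurableSpace Ω] {P : Measure Ω}

theorem eLpNorm_mul_le_two_mul {f g : Ω → ℝ} (hf : AEStronglyMeasurable f P)
    (hg : AEStronglyMeasurable g P) (p : ℝ≥0∞) :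
    eLpNorm (f * g) p P ≤ eLpNorm f (2 * p) P * eLpNorm g (2 * p) P := by
  have : ENNReal.HolderTriple (2 * p) (2 * p) p := ⟨by
    rw [ENNReal.mul_inv (.inl two_ne_zero) (.inl ENNReal.ofNat_ne_top), ← add_mul,
      ENNReal.inv_two_add_inv_two, one_mul]⟩
  have h := eLpNorm_le_eLpNorm_mul_eLpNorm_of_nnnorm (p := 2 * p) (q := 2 * p) (r := p) hf hg
    (fun x y => x * y) 1 (ae_of_all _ fun x => by simp [nnnorm_mul])
  rw [ENNReal.coe_one, one_mul] at h
  exact h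

/-- Convergence in measure upgrades to convergence of all moments when all moments are bounded. -/
theorem tendsto_eLpNorm_of_tendstoInMeasure_of_bounded [IsFiniteMeasure P] {Z : ℕ → Ω → ℝ} {c : ℝ}
    (hZ : ∀ n, AEStronglyMeasurable (Z n) P)
    (hbdd : ∀ p : ℕ, 1 ≤ p → ∃ C : ℝ≥0, ∀ n, eLpNorm (Z n) p P ≤ C)
    (hconv : TendstoInMeasure P Z atTop fun _ => c) (p : ℕ) (hp : 1 ≤ p) :
    Tendsto (fun n => eLpNorm (Z n - fun _ => c) p P) atTop (𝓝 0) := by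
  have hp1 : (1 : ℝ≥0∞) ≤ p := by exact_mod_cast hp
  refine tendsto_Lp_finite_of_tendstoInMeasure hp1 (by simp) hZ (memLp_const c)
    (unifIntegrable_of hp1 (by simp) hZ fun ε hε => ?_) hconv
  obtain ⟨C, hC⟩ := hbdd (2 * p) (by omega)
  set K : ℝ≥0 := C * C / ε.toNNReal + 1 with hK
  have hKpos : (0 : ℝ) < K := by rw [hK]; positivity
  refine ⟨K, fun n => ?_⟩
  calc eLpNorm ({x | K ≤ ‖Z n x‖₊}.indicator (Z n)) p P
      ≤ eLpNorm ((K : ℝ)⁻¹ • (Z n * Z n)) p P := by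
        refine eLpNorm_mono fun x => ?_
        by_cases hx : K ≤ ‖Z n x‖₊
        · have hx' : (K : ℝ) ≤ ‖Z n x‖ := hx
          rw [Set.indicator_of_mem (by exact hx)]
          simp only [Pi.smul_apply, Pi.mul_apply, smul_eq_mul, norm_mul, norm_inv,
            Real.norm_of_nonneg hKpos.le]
          rw [← div_eq_inv_mul, le_div_iff₀ hKpos]
          gcongr
        · rw [Set.indicator_of_notMem (by exact hx)]
          simp only [norm_zero, norm_nonneg]
    _ = ENNReal.ofReal (K : ℝ)⁻¹ * eLpNorm (Z n * Z n) p P := by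
        rw [eLpNorm_const_smul, Real.enorm_of_nonneg (by positivity)]
    _ ≤ ENNReal.ofReal (K : ℝ)⁻¹ * (C * C) := by
        gcongr
        refine (eLpNorm_mul_le_two_mul (hZ n) (hZ n) p).trans ?_
        have := hC n
        push_cast at this
        gcongr
    _ = ENNReal.ofReal ((K : ℝ)⁻¹ * (C * C)) := by
        rw [ENNReal.ofReal_mul (by positivity), ENNReal.ofReal_mul (by positivity)]
        simp
    _ ≤ ENNReal.ofReal ε := by
        refine ENNReal.ofReal_le_ofReal ?_
        rw [← div_eq_inv_mul, div_le_iff₀ hKpos, hK]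
        push_cast
        rw [Real.coe_toNNReal _ hε.le, mul_add, mul_div_cancel₀ _ hε.ne']
        linarith

/-- Convergence of random variables to a constant in every `L^p`, `1 ≤ p < ∞`. -/
structure TendstoAllMoments (P : Measure Ω) (Z : ℕ → Ω → ℝ) (c : ℝ) : Prop where
  aestronglyMeasurable : ∀ n, AEStronglyMeasurable (Z n) P
  tendsto : ∀ p : ℕ, 1 ≤ p → Tendsto (fun n => eLpNorm (Z n - fun _ => c) p P) atTop (𝓝 0)

namespace TendstoAllMoments

variable {Z W : ℕ → Ω → ℝ} {c d : ℝ}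

theorem const_zero : TendstoAllMoments P (fun _ _ => 0) 0 where
  aestronglyMeasurable _ := aestronglyMeasurable_const
  tendsto p _ := by
    simp

theorem add (hZ : TendstoAllMoments P Z c) (hW : TendstoAllMoments P W d) :
    TendstoAllMoments P (fun n => Z n + W n) (c + d) where
  aestronglyMeasurable n := (hZ.1 n).add (hW.1 n)
  tendsto p hp := by
    have h := (hZ.2 p hp).add (hW.2 p hp)
    rw [add_zero] at h
    refine tendsto_of_tendsto_of_tendsto_of_le_of_le tendsto_const_nhds h (fun _ => zero_le) ?_
    intro n
    have : (Z n + W n - fun _ => c + d) = (Z n - fun _ => c) + (W n - fun _ => d) := by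
      ext x; simp; ring
    simp only [this]
    exact eLpNorm_add_le ((hZ.1 n).sub aestronglyMeasurable_const)
      ((hW.1 n).sub aestronglyMeasurable_const) (by exact_mod_cast hp)

theorem const_smul (hZ : TendstoAllMoments P Z c) (t : ℝ) :
    TendstoAllMoments P (fun n => t • Z n) (t * c) where
  aestronglyMeasurable n := (hZ.1 n).const_smul t
  tendsto p hp := by
    have h := ENNReal.Tendsto.const_mul (a := ‖t‖ₑ) (hZ.2 p hp) (Or.inr (by simp))
    rw [mul_zero] at h
    refine h.congr fun n => ?_
    rw [← eLpNorm_const_smul]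
    congr 1
    ext x; simp; ring

theorem mul (hZ : TendstoAllMoments P Z c) (hW : TendstoAllMoments P W d) :
    TendstoAllMoments P (fun n => Z n * W n) (c * d) := by
  have hmeas : ∀ n, AEStronglyMeasurable ((Z n - fun _ => c) * (W n - fun _ => d)) P := fun n =>
    ((hZ.1 n).sub aestronglyMeasurable_const).mul ((hW.1 n).sub aestronglyMeasurable_const)
  have key : TendstoAllMoments P (fun n => (Z n - fun _ => c) * (W n - fun _ => d)) 0 := by
    refine ⟨hmeas, fun p hp => ?_⟩
    have h := ENNReal.Tendsto.mul (hZ.2 (2 * p) (by omega)) (Or.inr (by simp))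
      (hW.2 (2 * p) (by omega)) (Or.inr (by simp))
    rw [mul_zero] at h
    refine tendsto_of_tendsto_of_tendsto_of_le_of_le tendsto_const_nhds h (fun _ => zero_le) ?_
    intro n
    have h0 : ∀ f : Ω → ℝ, (f - fun _ => 0) = f := fun f => by ext; simp
    simp only [h0]
    push_cast
    exact eLpNorm_mul_le_two_mul ((hZ.1 n).sub aestronglyMeasurable_const)
      ((hW.1 n).sub aestronglyMeasurable_const) p
  have hlin := (key.add (hZ.const_smul d)).add (hW.const_smul c)
  refine ⟨fun n => (hZ.1 n).mul (hW.1 n), fun p hp => (hlin.2 p hp).congr fun n => ?_⟩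
  congr 1
  ext x; simp; ring

theorem sum {κ : Type*} (s : Finset κ) {Z : κ → ℕ → Ω → ℝ} {c : κ → ℝ}
    (h : ∀ i ∈ s, TendstoAllMoments P (Z i) (c i)) :
    TendstoAllMoments P (fun n => ∑ i ∈ s, Z i n) (∑ i ∈ s, c i) := by
  induction s using Finset.induction_on with
  | empty => simpa using! const_zero
  | insert i s hi ih =>
    simp only [sum_insert hi]
    exact (h i (mem_insert_self i s)).add (ih fun j hj => h j (mem_insert_of_mem hj))

theorem tendsto_integral_sq (hZ : TendstoAllMoments P Z c) :
    Tendsto (fun n => ∫ ω, (Z n ω - c) ^ 2 ∂P) atTop (𝓝 0) := by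
  have h := (ENNReal.tendsto_toReal ENNReal.zero_ne_top).comp
    (((ENNReal.continuous_pow 2).tendsto' 0 0 (by simp)).comp (hZ.2 2 (by norm_num)))
  rw [ENNReal.toReal_zero] at h
  refine h.congr fun n => ?_
  rw [integral_eq_lintegral_of_nonneg_ae (f := fun ω => (Z n ω - c) ^ 2)
    (ae_of_all _ fun _ => sq_nonneg _) (((hZ.1 n).sub aestronglyMeasurable_const).pow 2)]
  simp only [Function.comp_apply]
  congr 1
  have := eLpNorm_nnreal_pow_eq_lintegral (μ := P) (f := Z n - fun _ => c) (p := 2) (by norm_num)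
  have h2 : ∀ x : ℝ≥0∞, x ^ ((2 : ℝ≥0) : ℝ) = x ^ 2 := fun x => by
    rw [NNReal.coe_ofNat, ENNReal.rpow_ofNat]
  simp only [h2] at this
  rw [Nat.cast_ofNat, show (2 : ℝ≥0∞) = ((2 : ℝ≥0) : ℝ≥0∞) by norm_num, this]
  refine lintegral_congr fun x => ?_
  rw [← enorm_pow, ← Real.enorm_of_nonneg (sq_nonneg _)]
  rfl

end TendstoAllMoments

/-- A sequence converging in measure whose even powers have bounded expectation converges in every
`L^p`. -/
theorem tendstoAllMoments_of_tendstoInMeasure [IsProbabilityMeasure P] {Z : ℕ → Ω → ℝ} {c : ℝ}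
    (hZ : ∀ n, AEStronglyMeasurable (Z n) P)
    (hbdd : ∀ q : ℕ, ∃ C : ℝ, ∀ n, Integrable (fun ω => Z n ω ^ (2 * q)) P ∧
      ∫ ω, Z n ω ^ (2 * q) ∂P ≤ C)
    (hconv : TendstoInMeasure P Z atTop fun _ => c) :
    TendstoAllMoments P Z c := by
  refine ⟨hZ, tendsto_eLpNorm_of_tendstoInMeasure_of_bounded hZ (fun p hp => ?_) hconv⟩
  obtain ⟨C, hC⟩ := hbdd p
  have hC0 : 0 ≤ C := (integral_nonneg fun ω => (even_two_mul p).pow_nonneg _).trans (hC 0).2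
  refine ⟨(C ^ ((2 * p : ℕ) : ℝ)⁻¹).toNNReal, fun n => ?_⟩
  refine (eLpNorm_le_eLpNorm_of_exponent_le (q := ((2 * p : ℕ) : ℝ≥0∞)) ?_ (hZ n)).trans ?_
  · exact_mod_cast (by omega : p ≤ 2 * p)
  have hp0 : (0 : ℝ) < ((2 * p : ℕ) : ℝ) := by positivity
  have h1 := eLpNorm_nnreal_pow_eq_lintegral (μ := P) (f := Z n) (p := ((2 * p : ℕ) : ℝ≥0))
    (by positivity)
  have h2 : ∫⁻ x, ‖Z n x‖ₑ ^ (((2 * p : ℕ) : ℝ≥0) : ℝ) ∂P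
      = ENNReal.ofReal (∫ ω, Z n ω ^ (2 * p) ∂P) := by
    rw [ofReal_integral_eq_lintegral_ofReal (hC n).1
      (ae_of_all _ fun ω => (even_two_mul p).pow_nonneg _)]
    refine lintegral_congr fun x => ?_
    rw [NNReal.coe_natCast, ENNReal.rpow_natCast, ← enorm_pow,
      Real.enorm_of_nonneg ((even_two_mul p).pow_nonneg _)]
  rw [h2, NNReal.coe_natCast] at h1
  have h3 : eLpNorm (Z n) ((2 * p : ℕ) : ℝ≥0∞) P ^ ((2 * p : ℕ) : ℝ) ≤ ENNReal.ofReal C := by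
    refine le_trans (le_of_eq ?_) (ENNReal.ofReal_le_ofReal (hC n).2)
    rw [← h1]; norm_cast
  rw [← ENNReal.le_rpow_inv_iff hp0, ENNReal.ofReal_rpow_of_nonneg hC0 (by positivity)] at h3
  exact h3

end MomentConvergence

section ConjugationInvariance

open Matrix
open scoped ComplexConjugate

variable {Ω : Type*} [MeasurableSpace Ω] {P : Measure Ω}
variable {ι : Type*} [Fintype ι] [DecidableEq ι]

instance matrixBorelSpace : BorelSpace (Matrix ι ι ℂ) :=
  inferInstanceAs (BorelSpace (ι → ι → ℂ))

instance matrixSecondCountableTopology : SecondCountableTopology (Matrix ι ι ℂ) :=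
  inferInstanceAs (SecondCountableTopology (ι → ι → ℂ))

/-- The law of the random matrix `Y` is invariant under unitary conjugation. -/
def IsConjInvariant (P : Measure Ω) (Y : Ω → Matrix ι ι ℂ) : Prop :=
  ∀ g ∈ unitaryGroup ι ℂ, IdentDistrib (fun ω => star g * Y ω * g) Y P P

theorem measurable_re_pow_apply {Y : Ω → Matrix ι ι ℂ} (hY : Measurable Y) (k : ℕ) (i : ι) :
    Measurable fun ω => ((Y ω ^ k) i i).re := by
  have hF : Continuous fun M : Matrix ι ι ℂ => ((M ^ k) i i).re := by fun_prop
  exact hF.measurable.comp hY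

theorem measurable_mul_diagonal_mul_star {U : Ω → Matrix ι ι ℂ} {D : Ω → ι → ℝ}
    (hU : Measurable U) (hD : Measurable D) :
    Measurable fun ω => U ω * diagonal (fun i => (D ω i : ℂ)) * star (U ω) := by
  have hF : Continuous fun x : Matrix ι ι ℂ × (ι → ℝ) =>
      x.1 * diagonal (fun i => (x.2 i : ℂ)) * star x.1 := by fun_prop
  have h := hF.measurable.comp (hU.prodMk hD)
  simpa only [Function.comp_def] using h

/-- A matrix `U D U*` is conjugation invariant if `U` is Haar distributed and independent of `D`. -/
theorem isConjInvariant_of_isHaarMeasure [IsProbabilityMeasure P] {U : Ω → Matrix ι ι ℂ}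
    {D : Ω → ι → ℝ} (hU : Measurable U) (hD : Measurable D)
    (hUuni : ∀ ω, U ω ∈ unitaryGroup ι ℂ)
    (hHaar : (P.map fun ω => (⟨U ω, hUuni ω⟩ : unitaryGroup ι ℂ)).IsHaarMeasure)
    (hindep : IndepFun U D P) :
    IsConjInvariant P fun ω => U ω * diagonal (fun i => (D ω i : ℂ)) * star (U ω) := by
  intro g hg
  have hsg : star g ∈ unitaryGroup ι ℂ := Unitary.star_mem hg
  have hmul : Measurable fun M : Matrix ι ι ℂ => star g * M :=
    (continuous_const.mul continuous_id).measurable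
  have hUg : IdentDistrib (fun ω => star g * U ω) U P P := by
    refine ⟨(hmul.comp hU).aemeasurable, hU.aemeasurable, ?_⟩
    set V : Ω → unitaryGroup ι ℂ := fun ω => ⟨U ω, hUuni ω⟩ with hV
    have hVm : Measurable V := hU.subtype_mk
    have hinv := Measure.IsMulLeftInvariant.map_mul_left_eq_self (μ := P.map V)
      (⟨star g, hsg⟩ : unitaryGroup ι ℂ)
    have hgm : Measurable fun x : unitaryGroup ι ℂ => (⟨star g, hsg⟩ : unitaryGroup ι ℂ) * x :=
      (hmul.comp measurable_subtype_coe).subtype_mk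
    rw [Measure.map_map hgm hVm] at hinv
    have h := congrArg (Measure.map ((↑) : unitaryGroup ι ℂ → Matrix ι ι ℂ)) hinv
    rwa [Measure.map_map measurable_subtype_coe (hgm.comp hVm),
      Measure.map_map measurable_subtype_coe hVm] at h
  have hpair : IdentDistrib (fun ω => (star g * U ω, D ω)) (fun ω => (U ω, D ω)) P P := by
    refine ⟨((hmul.comp hU).prodMk hD).aemeasurable, (hU.prodMk hD).aemeasurable, ?_⟩
    have hi : IndepFun (fun ω => star g * U ω) D P := hindep.comp hmul measurable_id
    rw [(indepFun_iff_map_prod_eq_prod_map_map hU.aemeasurable hD.aemeasurable).mp hindep,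
      (indepFun_iff_map_prod_eq_prod_map_map hUg.aemeasurable_fst hD.aemeasurable).mp hi,
      hUg.map_eq]
  have hF : Continuous fun x : Matrix ι ι ℂ × (ι → ℝ) =>
      x.1 * diagonal (fun i => (x.2 i : ℂ)) * star x.1 := by fun_prop
  have h := hpair.comp hF.measurable
  simpa only [Function.comp_def, star_mul, star_star, mul_assoc] using h

variable {Y : Ω → Matrix ι ι ℂ}

theorem IsConjInvariant.comp (hY : IsConjInvariant P Y) {F : Matrix ι ι ℂ → Matrix ι ι ℂ}
    (hF : Continuous F)
    (hFg : ∀ g ∈ unitaryGroup ι ℂ, ∀ M, F (star g * M * g) = star g * F M * g) :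
    IsConjInvariant P fun ω => F (Y ω) := by
  intro g hg
  simpa only [Function.comp_def, hFg g hg] using (hY g hg).comp hF.measurable

/-- Every unit vector is a column of a unitary matrix. -/
theorem exists_unitaryGroup_col_eq (v : ι → ℂ) (hv : star v ⬝ᵥ v = 1) (l : ι) :
    ∃ g ∈ unitaryGroup ι ℂ, ∀ i, g i l = v i := by
  have hon : Orthonormal ℂ (Set.domRestrict {l} fun _ : ι => WithLp.toLp 2 v) := by
    rw [orthonormal_iff_ite]
    rintro ⟨i, rfl⟩ ⟨j, rfl⟩
    rw [if_pos rfl, Set.domRestrict_apply, PiLp.inner_apply, ← hv]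
    exact sum_congr rfl fun i _ => by simp [mul_comm, RCLike.mul_conj]
  obtain ⟨b, hb⟩ := hon.exists_orthonormalBasis_extension_of_card_eq (by simp)
  refine ⟨(EuclideanSpace.basisFun ι ℂ).toBasis.toMatrix b,
    (EuclideanSpace.basisFun ι ℂ).toMatrix_orthonormalBasis_mem_unitary b, fun i => ?_⟩
  simp [Module.Basis.toMatrix_apply, hb l rfl]

theorem IsConjInvariant.identDistrib_quadraticForm (hY : IsConjInvariant P Y) (v : ι → ℂ)
    (hv : star v ⬝ᵥ v = 1) (l : ι) :
    IdentDistrib (fun ω => (star v ⬝ᵥ Y ω *ᵥ v).re) (fun ω => (Y ω l l).re) P P := by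
  obtain ⟨g, hg, hgv⟩ := exists_unitaryGroup_col_eq v hv l
  have hc : Continuous fun M : Matrix ι ι ℂ => (M l l).re := by fun_prop
  have h := (hY g hg).comp hc.measurable
  have hcol : ∀ ω, star v ⬝ᵥ Y ω *ᵥ v = (star g * Y ω * g) l l := fun ω => by
    rw [dotProduct_mulVec]
    simp [Matrix.mul_apply, dotProduct, vecMul, star_apply, hgv]
  simpa only [hcol] using! h

theorem IsConjInvariant.identDistrib_diag (hY : IsConjInvariant P Y) (i l : ι) :
    IdentDistrib (fun ω => (Y ω i i).re) (fun ω => (Y ω l l).re) P P := by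
  have h := hY.identDistrib_quadraticForm (Pi.single i 1) (by simp) l
  simpa using h

/-- First moment of a diagonal entry of a conjugation invariant random matrix. -/
theorem IsConjInvariant.card_mul_integral_diag (hY : IsConjInvariant P Y)
    (hint : ∀ i, Integrable (fun ω => (Y ω i i).re) P) (l : ι) :
    Fintype.card ι * ∫ ω, (Y ω l l).re ∂P = ∫ ω, (Y ω).trace.re ∂P := by
  simp only [Matrix.trace, diag_apply, Complex.re_sum]
  rw [integral_finsetSum _ fun i _ => hint i]
  simp [(hY.identDistrib_diag _ l).integral_eq]

theorem quadraticForm_single_add_single (M : Matrix ι ι ℂ) (i j : ι) (x y : ℂ) :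
    star (Pi.single i x + Pi.single j y) ⬝ᵥ M *ᵥ (Pi.single i x + Pi.single j y)
      = conj x * x * M i i + conj x * y * M i j + conj y * x * M j i + conj y * y * M j j := by
  simp [mulVec_add, add_dotProduct, dotProduct_add]
  ring

/-- Squared quadratic forms averaged over four phases. -/
theorem exists_unit_vectors_sum_sq_quadraticForm {i j : ι} (hij : i ≠ j) :
    ∃ v : Fin 4 → ι → ℂ, (∀ t, star (v t) ⬝ᵥ v t = 1) ∧
      ∀ M : Matrix ι ι ℂ, M.IsHermitian → ∑ t, (star (v t) ⬝ᵥ M *ᵥ v t).re ^ 2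
        = 4 / 625 * (81 * (M i i).re ^ 2 + 256 * (M j j).re ^ 2
          + 288 * ((M i i).re * (M j j).re + Complex.normSq (M i j))) := by
  let θ : Fin 4 → ℂ := ![1, -1, Complex.I, -Complex.I]
  refine ⟨fun t => Pi.single i (3 / 5 : ℂ) + Pi.single j (4 / 5 * θ t), fun t => ?_, fun M hM => ?_⟩
  · have h := quadraticForm_single_add_single (1 : Matrix ι ι ℂ) i j (3 / 5) (4 / 5 * θ t)
    rw [one_mulVec] at h
    rw [h]
    fin_cases t <;> simp [θ, hij, hij.symm, Complex.ext_iff, map_ofNat] <;> norm_num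
  · have hji : M j i = conj (M i j) := (hM.apply j i).symm
    simp only [quadraticForm_single_add_single, hji, Fin.sum_univ_four, θ, Complex.normSq_apply]
    simp [map_ofNat]
    ring

/-- Second moment of a diagonal entry of a conjugation invariant Hermitian random matrix. -/
theorem IsConjInvariant.card_mul_integral_diag_sq (hY : IsConjInvariant P Y) (hYm : Measurable Y)
    (hH : ∀ ω, (Y ω).IsHermitian)
    (hint : ∀ i j, Integrable (fun ω => Complex.normSq (Y ω i j)) P) (l : ι) :
    Fintype.card ι * (Fintype.card ι + 1) * ∫ ω, (Y ω l l).re ^ 2 ∂P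
      = ∫ ω, ((Y ω).trace.re ^ 2 + ∑ i, ∑ j, Complex.normSq (Y ω i j)) ∂P := by
  have hre : ∀ i, Measurable fun ω => (Y ω i i).re := fun i =>
    (show Continuous fun M : Matrix ι ι ℂ => (M i i).re by fun_prop).measurable.comp hYm
  have hns : ∀ i ω, Complex.normSq (Y ω i i) = (Y ω i i).re ^ 2 := fun i ω => by
    have := congrArg Complex.im ((hH ω).apply i i)
    simp only [RCLike.star_def, Complex.conj_im] at this
    rw [Complex.normSq_apply, show (Y ω i i).im = 0 by linarith]
    ring
  have hsq : ∀ i, Integrable (fun ω => (Y ω i i).re ^ 2) P := fun i => by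
    simpa only [hns] using hint i i
  have hmul : ∀ i j, Integrable (fun ω => (Y ω i i).re * (Y ω j j).re) P := fun i j =>
    ((memLp_two_iff_integrable_sq (hre i).aestronglyMeasurable).mpr (hsq i)).integrable_mul
      ((memLp_two_iff_integrable_sq (hre j).aestronglyMeasurable).mpr (hsq j))
  have hadd : ∀ i j, Integrable
      (fun ω => (Y ω i i).re * (Y ω j j).re + Complex.normSq (Y ω i j)) P := fun i j =>
    (hmul i j).add (hint i j)
  set c := ∫ ω, (Y ω l l).re ^ 2 ∂P with hc
  have hci : ∀ i, ∫ ω, (Y ω i i).re ^ 2 ∂P = c := fun i => (hY.identDistrib_diag i l).sq.integral_eq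
  have hpair : ∀ i j, ∫ ω, ((Y ω i i).re * (Y ω j j).re + Complex.normSq (Y ω i j)) ∂P
      = c + if i = j then c else 0 := by
    intro i j
    by_cases hij : i = j
    · subst hij
      simp only [hns, ← sq, if_true]
      rw [integral_add (hsq i) (hsq i), hci]
    · obtain ⟨v, hv, hvM⟩ := exists_unit_vectors_sum_sq_quadraticForm hij
      have hq : ∀ t, IdentDistrib (fun ω => (star (v t) ⬝ᵥ Y ω *ᵥ v t).re ^ 2)
          (fun ω => (Y ω l l).re ^ 2) P P := fun t =>
        (hY.identDistrib_quadraticForm (v t) (hv t) l).sq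
      have h4 : ∫ ω, ∑ t, (star (v t) ⬝ᵥ Y ω *ᵥ v t).re ^ 2 ∂P = 4 * c := by
        rw [integral_finsetSum _ fun t _ => (hq t).integrable_iff.mpr (hsq l)]
        simp [fun t => (hq t).integral_eq, hc]
      simp only [fun ω => hvM (Y ω) (hH ω)] at h4
      rw [integral_const_mul, integral_add
        (f := fun ω => 81 * (Y ω i i).re ^ 2 + 256 * (Y ω j j).re ^ 2)
        (((hsq i).const_mul _).add ((hsq j).const_mul _)) ((hadd i j).const_mul _),
        integral_add ((hsq i).const_mul _)
        ((hsq j).const_mul _), integral_const_mul, integral_const_mul, integral_const_mul, hci,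
        hci] at h4
      rw [if_neg hij]
      linarith
  have hexp : ∀ ω, (Y ω).trace.re ^ 2 + ∑ i, ∑ j, Complex.normSq (Y ω i j)
      = ∑ i, ∑ j, ((Y ω i i).re * (Y ω j j).re + Complex.normSq (Y ω i j)) := fun ω => by
    simp only [Matrix.trace, diag_apply, Complex.re_sum, sq, sum_mul_sum, sum_add_distrib]
  simp only [hexp]
  rw [integral_finsetSum _ fun i _ => integrable_finsetSum _ fun j _ => hadd i j]
  rw [sum_congr rfl fun i _ => integral_finsetSum _ fun j _ => hadd i j]
  simp only [hpair, sum_add_distrib]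
  simp
  ring

end ConjugationInvariance

section SpectralDecomposition

open Matrix

variable {ι : Type*} [Fintype ι]

theorem sum_normSq_eq_re_trace {M : Matrix ι ι ℂ} (hM : M.IsHermitian) :
    ∑ i, ∑ j, Complex.normSq (M i j) = ((M * M).trace).re := by
  simp only [Matrix.trace, diag_apply, Matrix.mul_apply, Complex.re_sum]
  refine sum_congr rfl fun i _ => sum_congr rfl fun j _ => ?_
  rw [← hM.apply j i, RCLike.star_def, Complex.mul_conj, Complex.ofReal_re]

theorem im_trace_eq_zero {M : Matrix ι ι ℂ} (hM : M.IsHermitian) : M.trace.im = 0 := by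
  have h := trace_conjTranspose M
  rw [hM.eq] at h
  exact Complex.conj_eq_iff_im.mp h.symm

variable [DecidableEq ι]

theorem unitary_diagonal_pow {V : Matrix ι ι ℂ} (hV : V ∈ unitaryGroup ι ℂ) (d : ι → ℝ) (k : ℕ) :
    (V * diagonal (fun i => (d i : ℂ)) * star V) ^ k
      = V * diagonal (fun i => ((d i ^ k : ℝ) : ℂ)) * star V := by
  have hVV : star V * V = 1 := (mem_unitaryGroup_iff').mp hV
  induction k with
  | zero => simpa using! ((mem_unitaryGroup_iff).mp hV).symm
  | succ k ih =>
    rw [pow_succ, ih]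
    calc V * diagonal (fun i => ((d i ^ k : ℝ) : ℂ)) * star V
          * (V * diagonal (fun i => (d i : ℂ)) * star V)
        = V * (diagonal (fun i => ((d i ^ k : ℝ) : ℂ)) * (star V * V)
          * diagonal (fun i => (d i : ℂ))) * star V := by simp only [mul_assoc]
      _ = _ := by
        rw [hVV, mul_one, diagonal_mul_diagonal]
        simp [pow_succ]

theorem trace_unitary_diagonal_pow {V : Matrix ι ι ℂ} (hV : V ∈ unitaryGroup ι ℂ) (d : ι → ℝ)
    (k : ℕ) :
    ((V * diagonal (fun i => (d i : ℂ)) * star V) ^ k).trace = ((∑ i, d i ^ k : ℝ) : ℂ) := by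
  rw [unitary_diagonal_pow hV, trace_mul_comm, ← mul_assoc, (mem_unitaryGroup_iff').mp hV, one_mul,
    trace_diagonal]
  rw [Complex.ofReal_sum]

theorem unitary_diagonal_pow_apply {V : Matrix ι ι ℂ} (hV : V ∈ unitaryGroup ι ℂ) (d : ι → ℝ)
    (k : ℕ) (l : ι) :
    ((V * diagonal (fun i => (d i : ℂ)) * star V) ^ k) l l
      = ((∑ i, Complex.normSq (V l i) * d i ^ k : ℝ) : ℂ) := by
  rw [unitary_diagonal_pow hV, Matrix.mul_apply]
  push_cast
  refine sum_congr rfl fun i _ => ?_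
  rw [mul_diagonal, star_apply, RCLike.star_def, ← Complex.mul_conj]
  ring

theorem sum_normSq_row_unitary {V : Matrix ι ι ℂ} (hV : V ∈ unitaryGroup ι ℂ) (l : ι) :
    ∑ i, Complex.normSq (V l i) = 1 := by
  have h := unitary_diagonal_pow_apply hV (fun _ => 0) 0 l
  simp only [pow_zero, Matrix.one_apply_eq, mul_one] at h
  exact_mod_cast h.symm

/-- The even powers of a diagonal entry of a power are dominated by diagonal entries of powers. -/
theorem re_unitary_diagonal_pow_apply_pow_le {V : Matrix ι ι ℂ} (hV : V ∈ unitaryGroup ι ℂ)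
    (d : ι → ℝ) (k q : ℕ) (l : ι) :
    (((V * diagonal (fun i => (d i : ℂ)) * star V) ^ k) l l).re ^ (2 * q)
      ≤ (((V * diagonal (fun i => (d i : ℂ)) * star V) ^ (k * (2 * q))) l l).re := by
  rw [unitary_diagonal_pow_apply hV, unitary_diagonal_pow_apply hV, Complex.ofReal_re,
    Complex.ofReal_re]
  simp only [pow_mul _ k]
  exact Real.pow_arith_mean_le_arith_mean_pow_of_even _ _ _ (fun i _ => Complex.normSq_nonneg _)
    (sum_normSq_row_unitary hV l) (even_two_mul q)

theorem re_unitary_diagonal_pow_apply_le_trace {V : Matrix ι ι ℂ} (hV : V ∈ unitaryGroup ι ℂ)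
    (d : ι → ℝ) {k : ℕ} (hk : Even k) (l : ι) :
    0 ≤ (((V * diagonal (fun i => (d i : ℂ)) * star V) ^ k) l l).re ∧
      (((V * diagonal (fun i => (d i : ℂ)) * star V) ^ k) l l).re
        ≤ (((V * diagonal (fun i => (d i : ℂ)) * star V) ^ k).trace).re := by
  have h : ∀ i, 0 ≤ (((V * diagonal (fun i => (d i : ℂ)) * star V) ^ k) i i).re := fun i => by
    rw [unitary_diagonal_pow_apply hV, Complex.ofReal_re]
    exact sum_nonneg fun j _ => mul_nonneg (Complex.normSq_nonneg _) (hk.pow_nonneg _)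
  refine ⟨h l, ?_⟩
  simp only [Matrix.trace, diag_apply, Complex.re_sum]
  exact single_le_sum (f := fun i => (((V * diagonal (fun i => (d i : ℂ)) * star V) ^ k) i i).re)
    (fun i _ => h i) (mem_univ l)

theorem isHermitian_unitary_diagonal (V : Matrix ι ι ℂ) (d : ι → ℝ) :
    (V * diagonal (fun i => (d i : ℂ)) * star V).IsHermitian := by
  refine isHermitian_mul_mul_conjTranspose V ?_
  rw [isHermitian_diagonal_iff]
  exact fun i => by simp [isSelfAdjoint_iff]

/-- The trace-free part of a power of a matrix. -/
noncomputable def traceFreePow (k : ℕ) (M : Matrix ι ι ℂ) : Matrix ι ι ℂ :=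
  M ^ k - ((M ^ k).trace / Fintype.card ι) • (1 : Matrix ι ι ℂ)

theorem continuous_traceFreePow (k : ℕ) :
    Continuous (traceFreePow k : Matrix ι ι ℂ → Matrix ι ι ℂ) := by
  unfold traceFreePow
  fun_prop

theorem star_mul_mul_pow {g : Matrix ι ι ℂ} (hg : g ∈ unitaryGroup ι ℂ) (M : Matrix ι ι ℂ) (k : ℕ) :
    (star g * M * g) ^ k = star g * M ^ k * g := by
  have hgg : g * star g = 1 := (mem_unitaryGroup_iff).mp hg
  induction k with
  | zero => simpa using! ((mem_unitaryGroup_iff').mp hg).symm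
  | succ k ih =>
    rw [pow_succ, ih]
    calc star g * M ^ k * g * (star g * M * g)
        = star g * (M ^ k * (g * star g) * M) * g := by simp only [mul_assoc]
      _ = _ := by rw [hgg, mul_one, pow_succ]

theorem traceFreePow_star_mul_mul (k : ℕ) {g : Matrix ι ι ℂ} (hg : g ∈ unitaryGroup ι ℂ)
    (M : Matrix ι ι ℂ) : traceFreePow k (star g * M * g) = star g * traceFreePow k M * g := by
  have htr : (star g * M ^ k * g).trace = (M ^ k).trace := by
    rw [trace_mul_comm, ← mul_assoc, (mem_unitaryGroup_iff).mp hg, one_mul]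
  rw [traceFreePow, traceFreePow, star_mul_mul_pow hg, htr, mul_sub, sub_mul, mul_smul_comm,
    smul_mul_assoc, mul_one, (mem_unitaryGroup_iff').mp hg]

theorem isHermitian_traceFreePow (k : ℕ) {M : Matrix ι ι ℂ} (hM : M.IsHermitian) :
    (traceFreePow k M).IsHermitian := by
  refine (hM.pow k).sub ?_
  have h := Complex.conj_eq_iff_im.mpr (im_trace_eq_zero (hM.pow k))
  rw [IsHermitian, conjTranspose_smul, conjTranspose_one]
  simp [h]

theorem trace_traceFreePow [Nonempty ι] (k : ℕ) (M : Matrix ι ι ℂ) :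
    (traceFreePow k M).trace = 0 := by
  simp [traceFreePow]

theorem sum_normSq_traceFreePow_le [Nonempty ι] (k : ℕ) {M : Matrix ι ι ℂ} (hM : M.IsHermitian) :
    ∑ i, ∑ j, Complex.normSq (traceFreePow k M i j) ≤ ((M ^ (2 * k)).trace).re := by
  rw [sum_normSq_eq_re_trace (isHermitian_traceFreePow k hM)]
  have h0 := trace_traceFreePow k M
  have him := im_trace_eq_zero (hM.pow k)
  set t : ℂ := (M ^ k).trace / Fintype.card ι with ht
  have h1 : (traceFreePow k M * traceFreePow k M).trace
      = (M ^ (2 * k)).trace - t * (M ^ k).trace := by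
    nth_rw 2 [traceFreePow]
    rw [mul_sub, trace_sub, mul_smul_comm, trace_smul, mul_one, h0, smul_zero, sub_zero,
      traceFreePow, sub_mul, trace_sub, smul_mul_assoc, one_mul, trace_smul, smul_eq_mul, two_mul,
      pow_add]
  have h2 : t * (M ^ k).trace = (((M ^ k).trace.re ^ 2 / Fintype.card ι : ℝ) : ℂ) := by
    have h3 : (M ^ k).trace = ((M ^ k).trace.re : ℂ) := Complex.ext (by simp) (by simp [him])
    rw [ht, h3]
    push_cast
    rw [Complex.ofReal_re]
    ring
  rw [h1, h2, Complex.sub_re, Complex.ofReal_re]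
  have : 0 ≤ (M ^ k).trace.re ^ 2 / Fintype.card ι := by positivity
  linarith

theorem re_traceFreePow_apply (k : ℕ) (M : Matrix ι ι ℂ) (l : ι) :
    (traceFreePow k M l l).re = ((M ^ k) l l).re - (M ^ k).trace.re / Fintype.card ι := by
  simp [traceFreePow]

variable {Ω : Type*} [MeasurableSpace Ω] {P : Measure Ω} {X : Ω → Matrix ι ι ℂ}

/-- The diagonal entries of powers of a conjugation invariant matrix concentrate around the
normalized traces. -/
theorem IsConjInvariant.integral_sq_diag_sub_trace_le [Nonempty ι] (hX : IsConjInvariant P X)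
    (hXm : Measurable X) (hH : ∀ ω, (X ω).IsHermitian) (k : ℕ)
    (hint : Integrable (fun ω => ((X ω ^ (2 * k)).trace).re) P) (l : ι) :
    Integrable (fun ω => (((X ω ^ k) l l).re - (X ω ^ k).trace.re / Fintype.card ι) ^ 2) P ∧
    Fintype.card ι * (Fintype.card ι + 1) *
        ∫ ω, (((X ω ^ k) l l).re - (X ω ^ k).trace.re / Fintype.card ι) ^ 2 ∂P
      ≤ ∫ ω, ((X ω ^ (2 * k)).trace).re ∂P := by
  simp only [← re_traceFreePow_apply]
  have hYm : Measurable fun ω => traceFreePow k (X ω) :=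
    (continuous_traceFreePow k).measurable.comp hXm
  have hY : IsConjInvariant P fun ω => traceFreePow k (X ω) :=
    hX.comp (continuous_traceFreePow k) fun g hg M => traceFreePow_star_mul_mul k hg M
  have hm : ∀ i j, Measurable fun ω => Complex.normSq (traceFreePow k (X ω) i j) := fun i j =>
    (show Continuous fun M : Matrix ι ι ℂ => Complex.normSq (M i j) from
      Complex.continuous_normSq.comp (by fun_prop)).measurable.comp hYm
  have hi : ∀ i j, Integrable (fun ω => Complex.normSq (traceFreePow k (X ω) i j)) P := by
    intro i j
    refine hint.mono' (hm i j).aestronglyMeasurable (ae_of_all _ fun ω => ?_)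
    rw [Real.norm_of_nonneg (Complex.normSq_nonneg _)]
    refine le_trans ?_ (sum_normSq_traceFreePow_le k (hH ω))
    refine le_trans ?_ (single_le_sum
      (f := fun i => ∑ j, Complex.normSq (traceFreePow k (X ω) i j))
      (fun i _ => sum_nonneg fun j _ => Complex.normSq_nonneg _) (mem_univ i))
    exact single_le_sum (f := fun j => Complex.normSq (traceFreePow k (X ω) i j))
      (fun j _ => Complex.normSq_nonneg _) (mem_univ j)
  have hre : Measurable fun ω => (traceFreePow k (X ω) l l).re :=
    (show Continuous fun M : Matrix ι ι ℂ => (M l l).re by fun_prop).measurable.comp hYm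
  refine ⟨(hi l l).mono' (hre.pow_const 2).aestronglyMeasurable (ae_of_all _ fun ω => ?_), ?_⟩
  · rw [Real.norm_of_nonneg (sq_nonneg _), Complex.normSq_apply]
    nlinarith [mul_self_nonneg (traceFreePow k (X ω) l l).im]
  · rw [hY.card_mul_integral_diag_sq hYm (fun ω => isHermitian_traceFreePow k (hH ω)) hi l]
    simp only [trace_traceFreePow, Complex.zero_re, ne_eq, OfNat.ofNat_ne_zero, not_false_eq_true,
      zero_pow, zero_add]
    exact integral_mono (integrable_finsetSum _ fun i _ => integrable_finsetSum _ fun j _ => hi i j)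
      hint fun ω => sum_normSq_traceFreePow_le k (hH ω)

end SpectralDecomposition

section ConvergenceInMeasure

open Filter Topology

variable {Ω : Type*} [MeasurableSpace Ω] {P : Measure Ω}

theorem TendstoInMeasure.of_tendsto_integral_sq_sub [IsFiniteMeasure P] {A B : ℕ → Ω → ℝ} {c : ℝ}
    (hB : TendstoInMeasure P B atTop fun _ => c)
    (hint : ∀ n, Integrable (fun ω => (A n ω - B n ω) ^ 2) P)
    (hAB : Tendsto (fun n => ∫ ω, (A n ω - B n ω) ^ 2 ∂P) atTop (𝓝 0)) :
    TendstoInMeasure P A atTop fun _ => c := by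
  rw [tendstoInMeasure_iff_measureReal_norm] at hB ⊢
  intro ε hε
  have h := (hAB.const_mul ((ε / 2) ^ 2)⁻¹).add (hB (ε / 2) (by positivity))
  rw [mul_zero, zero_add] at h
  refine squeeze_zero (fun _ => measureReal_nonneg) (fun n => ?_) h
  have hmark := mul_meas_ge_le_integral_of_nonneg (ae_of_all _ fun ω => sq_nonneg _) (hint n)
    ((ε / 2) ^ 2)
  calc P.real {ω | ε ≤ ‖A n ω - c‖}
      ≤ P.real ({ω | (ε / 2) ^ 2 ≤ (A n ω - B n ω) ^ 2} ∪ {ω | ε / 2 ≤ ‖B n ω - c‖}) := by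
        refine measureReal_mono fun ω hω => ?_
        by_contra hcon
        simp only [Set.mem_union, Set.mem_ofPred_eq, not_or, not_le, Real.norm_eq_abs] at hcon hω
        have h1 := abs_lt_of_sq_lt_sq hcon.1 (by positivity)
        have h2 := abs_sub_le (A n ω) (B n ω) c
        linarith [hcon.2]
    _ ≤ _ := measureReal_union_le _ _
    _ ≤ _ := by
        gcongr
        rw [← div_eq_inv_mul, le_div_iff₀ (by positivity), mul_comm]
        exact hmark

end ConvergenceInMeasure

/-- In the setting of the rotationally invariant Hermitian random
matrices `X_N = U_N D_N U_N^*` (with `U_N` Haar unitary, `D_N` independent diagonal),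
with `Mκ n k` the moments of the Rayleigh measure `κ_N` and `Mm n k` the moments of
the empirical eigenvalue distribution `m_N`: if `sup_N E[M_k(m_N)] < ∞` for all even
`k` and the moments of `m_N` converge in probability to those of a probability measure
`m` with finite moments of all orders, then `M_k(κ_N)` converges in `L²` to the moment
`Mτ k` of the Rayleigh measure `τ` associated with `m` by the Markov–Krein
correspondence. -/
theorem statement7
    {Ω : Type} [MeasurableSpace Ω] (Pr : Measure Ω) [IsProbabilityMeasure Pr]
    (U : (n : ℕ) → Ω → Matrix (Fin (n + 1)) (Fin (n + 1)) ℂ)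
    (D : (n : ℕ) → Ω → (Fin (n + 1) → ℝ))
    (hUmeas : ∀ n, Measurable (U n))
    (hDmeas : ∀ n, Measurable (D n))
    (hUuni : ∀ n ω, U n ω ∈ Matrix.unitaryGroup (Fin (n + 1)) ℂ)
    -- `U_N` is Haar distributed on the unitary group:
    (hHaar : ∀ n, (Measure.map
      (fun ω => (⟨U n ω, hUuni n ω⟩ : Matrix.unitaryGroup (Fin (n + 1)) ℂ)) Pr).IsHaarMeasure)
    -- `D_N` is independent of `U_N`:
    (hindep : ∀ n, IndepFun (U n) (D n) Pr)
    (X : (n : ℕ) → Ω → Matrix (Fin (n + 1)) (Fin (n + 1)) ℂ)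
    (hX : ∀ n ω, X n ω = U n ω * Matrix.diagonal (fun i => (D n ω i : ℂ)) * star (U n ω))
    -- the ordered eigenvalues `λ_1 ≤ ⋯ ≤ λ_N` of `X_N`:
    (lam : (n : ℕ) → Ω → (Fin (n + 1) → ℝ))
    (hlam_mono : ∀ n ω, Monotone (lam n ω))
    (hlam_eig : ∀ n ω, ∃ V ∈ Matrix.unitaryGroup (Fin (n + 1)) ℂ,
      X n ω = V * Matrix.diagonal (fun i => (lam n ω i : ℂ)) * star V)
    -- the ordered eigenvalues `λ̃_1 ≤ ⋯ ≤ λ̃_{N−1}` of the principal submatrix: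
    (lamt : (n : ℕ) → Ω → (Fin n → ℝ))
    (hlamt_mono : ∀ n ω, Monotone (lamt n ω))
    (hlamt_eig : ∀ n ω, ∃ V ∈ Matrix.unitaryGroup (Fin n) ℂ,
      (X n ω).submatrix Fin.castSucc Fin.castSucc
        = V * Matrix.diagonal (fun j => (lamt n ω j : ℂ)) * star V)
    -- the moments of the empirical eigenvalue distribution `m_N`:
    (Mm : ℕ → ℕ → Ω → ℝ)
    (hMm : ∀ n k ω, Mm n k ω = (1 / (n + 1 : ℝ)) * ∑ i, lam n ω i ^ k)
    (hint : ∀ n k, Integrable (Mm n k) Pr)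
    -- `sup_{N ≥ 1} E[M_k(m_N)] < ∞` for every even `k`:
    (hsup : ∀ k : ℕ, Even k → ∃ C : ℝ, ∀ n, (∫ ω, Mm n k ω ∂Pr) ≤ C)
    -- the moments of the Rayleigh measure `κ_N`:
    (Mκ : ℕ → ℕ → Ω → ℝ)
    (hMκ : ∀ n k ω, Mκ n k ω = (∑ i, lam n ω i ^ k) - ∑ j, lamt n ω j ^ k)
    -- the limiting probability measure `m`, with finite moments of all orders:
    (m : Measure ℝ) [IsProbabilityMeasure m]
    (hm : ∀ j : ℕ, Integrable (fun x => x ^ j) m)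
    -- the moments of the Rayleigh measure `τ` of `m` (Markov–Krein correspondence):
    (Mτ : ℕ → ℝ)
    (hMτ : ∀ j : ℕ, 1 ≤ j → Mτ j
      = j * (∫ x, x ^ j ∂m) - ∑ r ∈ Finset.Ico 1 j, Mτ r * ∫ x, x ^ (j - r) ∂m)
    -- the moments of `m_N` converge to those of `m` in probability:
    (hconv : ∀ j : ℕ, 1 ≤ j → ∀ ε : ℝ, 0 < ε →
      Filter.Tendsto (fun n => Pr {ω | ε ≤ |Mm n j ω - ∫ x, x ^ j ∂m|})
        Filter.atTop (nhds 0))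
    (k : ℕ) (hk : 1 ≤ k) :
    Filter.Tendsto (fun n => ∫ ω, (Mκ n k ω - Mτ k) ^ 2 ∂Pr)
      Filter.atTop (nhds 0) := by
  have hXfun : ∀ n, X n = fun ω =>
      U n ω * Matrix.diagonal (fun i => (D n ω i : ℂ)) * star (U n ω) := fun n => funext (hX n)
  have hXm : ∀ n, Measurable (X n) := fun n => by
    rw [hXfun]
    exact measurable_mul_diagonal_mul_star (hUmeas n) (hDmeas n)
  have hXinv : ∀ n, IsConjInvariant Pr (X n) := fun n => by
    rw [hXfun]
    exact isConjInvariant_of_isHaarMeasure (hUmeas n) (hDmeas n) (hUuni n) (hHaar n) (hindep n)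
  have hXherm : ∀ n ω, (X n ω).IsHermitian := fun n ω => by
    rw [hX]
    exact isHermitian_unitary_diagonal _ _
  have htr : ∀ n k ω, (X n ω ^ k).trace = ((∑ i, lam n ω i ^ k : ℝ) : ℂ) := fun n k ω => by
    obtain ⟨V, hV, hXV⟩ := hlam_eig n ω
    rw [hXV, trace_unitary_diagonal_pow hV]
  have hMm' : ∀ n k ω, Mm n k ω = (X n ω ^ k).trace.re / Fintype.card (Fin (n + 1)) :=
    fun n k ω => by
      rw [htr, Complex.ofReal_re, hMm, Fintype.card_fin]
      push_cast
      ring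
  have htrint : ∀ n k, Integrable (fun ω => (X n ω ^ k).trace.re) Pr := fun n k => by
    refine ((hint n k).const_mul (n + 1 : ℝ)).congr (ae_of_all _ fun ω => ?_)
    change (n + 1 : ℝ) * Mm n k ω = (X n ω ^ k).trace.re
    rw [htr, Complex.ofReal_re, hMm]
    field_simp
  -- the diagonal entries of the powers of `X n`
  let a : ℕ → ℕ → Ω → ℝ := fun k n ω => (X n ω ^ k) (Fin.last n) (Fin.last n) |>.re
  have ham : ∀ k n, Measurable (a k n) := fun k n =>
    measurable_re_pow_apply (hXm n) k (Fin.last n)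
  have hdiag : ∀ k n, Even k → ∀ i, Integrable (fun ω => ((X n ω ^ k) i i).re) Pr := by
    intro k n hk i
    refine (htrint n k).mono' (measurable_re_pow_apply (hXm n) k i).aestronglyMeasurable
      (ae_of_all _ fun ω => ?_)
    rw [hX]
    have h := re_unitary_diagonal_pow_apply_le_trace (hUuni n ω) (D n ω) hk i
    rw [Real.norm_of_nonneg h.1]
    exact h.2
  have hmean : ∀ k n, Even k → ∫ ω, a k n ω ∂Pr = ∫ ω, Mm n k ω ∂Pr := by
    intro k n hk
    have hinv := (hXinv n).comp (F := fun M => M ^ k) (by fun_prop)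
      fun g hg M => star_mul_mul_pow hg M k
    have h := hinv.card_mul_integral_diag (hdiag k n hk) (Fin.last n)
    simp only [hMm']
    rw [integral_div, ← h, mul_div_cancel_left₀ _ (Nat.cast_ne_zero.mpr Fintype.card_ne_zero)]
  have hconcl : ∀ j, 1 ≤ j → TendstoAllMoments Pr (a j) (∫ x, x ^ j ∂m) := by
    intro j hj
    refine tendstoAllMoments_of_tendstoInMeasure (fun n => (ham j n).aestronglyMeasurable)
      (fun q => ?_) ?_
    · have heven : Even (j * (2 * q)) := (even_two_mul q).mul_left j
      obtain ⟨C, hC⟩ := hsup _ heven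
      have hle : ∀ n ω, a j n ω ^ (2 * q) ≤ a (j * (2 * q)) n ω := fun n ω => by
        simp only [a, hX]
        exact re_unitary_diagonal_pow_apply_pow_le (hUuni n ω) _ _ _ _
      refine ⟨C, fun n => ?_⟩
      have hi : Integrable (fun ω => a j n ω ^ (2 * q)) Pr := by
        refine (hdiag _ n heven (Fin.last n)).mono' ((ham j n).pow_const _).aestronglyMeasurable
          (ae_of_all _ fun ω => ?_)
        rw [Real.norm_of_nonneg ((even_two_mul q).pow_nonneg _)]
        exact hle n ω
      refine ⟨hi, ?_⟩
      calc ∫ ω, a j n ω ^ (2 * q) ∂Pr ≤ ∫ ω, a (j * (2 * q)) n ω ∂Pr :=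
            integral_mono hi (hdiag _ n heven (Fin.last n)) (hle n)
        _ = ∫ ω, Mm n (j * (2 * q)) ω ∂Pr := hmean _ n heven
        _ ≤ C := hC n
    · have hvar := fun n => (hXinv n).integral_sq_diag_sub_trace_le (hXm n) (hXherm n) j
        (htrint n (2 * j)) (Fin.last n)
      simp only [← hMm'] at hvar
      obtain ⟨C, hC⟩ := hsup _ (even_two_mul j)
      refine TendstoInMeasure.of_tendsto_integral_sq_sub (B := fun n => Mm n j) ?_
        (fun n => (hvar n).1) ?_
      · rw [tendstoInMeasure_iff_norm]
        exact hconv j hj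
      · have hlim : Filter.Tendsto (fun n : ℕ => C * (1 / ((n : ℝ) + 1))) Filter.atTop (nhds 0) := by
          simpa using tendsto_one_div_add_atTop_nhds_zero_nat.const_mul C
        refine squeeze_zero (fun n => integral_nonneg fun ω => sq_nonneg _) (fun n => ?_) hlim
        have hv := (hvar n).2
        have hC0 := hC n
        simp only [hMm'] at hC0
        rw [integral_div, div_le_iff₀ (by simp; positivity)] at hC0
        simp only [Fintype.card_fin, Nat.cast_add, Nat.cast_one] at hv hC0
        have hn : (0 : ℝ) < n + 1 := by positivity
        set I := ∫ ω, (((X n ω ^ j) (Fin.last n) (Fin.last n)).re - Mm n j ω) ^ 2 ∂Pr with hI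
        have hI0 : 0 ≤ I := integral_nonneg fun ω => sq_nonneg _
        have h1 : (n + 1 + 1 : ℝ) * I ≤ C := by
          refine le_of_mul_le_mul_left ?_ hn
          calc _ = ((n : ℝ) + 1) * (n + 1 + 1) * I := by ring
            _ ≤ _ := hv.trans hC0
            _ = _ := mul_comm _ _
        change I ≤ _
        rw [mul_one_div, le_div_iff₀ hn]
        linarith
  have hrec : ∀ n k, 1 ≤ k → Mκ n k
      = (k : ℝ) • a k n + (-1 : ℝ) • ∑ r ∈ Ico 1 k, Mκ n r * a (k - r) n := by
    intro n k hk
    ext ω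
    have hκ : ∀ r, 1 ≤ r → ((Mκ n r ω : ℝ) : ℂ) = (X n ω ^ r).trace
        - (((1 - Matrix.single (Fin.last n) (Fin.last n) (1 : ℂ)) * X n ω) ^ r).trace := by
      intro r hr
      obtain ⟨V, hV, hXV⟩ := hlamt_eig n ω
      rw [trace_compression_last_pow _ (by omega), hXV, trace_unitary_diagonal_pow hV, htr, hMκ]
      push_cast
      rfl
    have ha : ∀ r, ((a r n ω : ℝ) : ℂ) = (X n ω ^ r) (Fin.last n) (Fin.last n) := fun r => by
      simp only [a]
      rw [hX, unitary_diagonal_pow_apply (hUuni n ω), Complex.ofReal_re]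
    have h := trace_pow_sub_trace_pow_compression_recursion (X n ω) (Fin.last n) k
    rw [← hκ k hk, ← ha, sum_congr rfl fun r hr => by
      rw [← hκ r (mem_Ico.mp hr).1, ← ha]] at h
    simp only [Pi.add_apply, Pi.smul_apply, Finset.sum_apply, Pi.mul_apply, smul_eq_mul]
    rw [neg_one_mul, ← sub_eq_add_neg]
    exact_mod_cast h
  have hfinal : ∀ k, 1 ≤ k → TendstoAllMoments Pr (fun n => Mκ n k) (Mτ k) := by
    intro k
    induction k using Nat.strong_induction_on with
    | _ k ih =>
      intro hk
      have hsum : TendstoAllMoments Pr (fun n => ∑ r ∈ Ico 1 k, Mκ n r * a (k - r) n)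
          (∑ r ∈ Ico 1 k, Mτ r * ∫ x, x ^ (k - r) ∂m) :=
        TendstoAllMoments.sum (Z := fun r n => Mκ n r * a (k - r) n) (Ico 1 k) fun r hr => by
          obtain ⟨h1, h2⟩ := mem_Ico.mp hr
          exact (ih r h2 h1).mul (hconcl (k - r) (by omega))
      have h := ((hconcl k hk).const_smul k).add (hsum.const_smul (-1))
      rw [hMτ k hk, sub_eq_add_neg, ← neg_one_mul]
      simpa only [fun n => hrec n k hk] using! h
  exact (hfinal k hk).tendsto_integral_sq
end
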